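/- Fix integers k ≥ 2 and p ≥ 1. Let (w_{1,n}, …, w_{p,n}) be independent F_k-valued random variables satisfying radial symmetry, positive drift, and subexponential growth. Then with probability going to 1 exponentially fast as n → ∞, the subgroup H = ⟨w_{1,n}, …, w_{p,n}⟩ is Aut-malnormal in F_k. -/

import Mathlib

open MeasureTheory

noncomputable section

/-- Every set of a free group is measurable (discrete σ-algebra). -/
instance freeGroupMeasurableSpace {α : Type*} : MeasurableSpace (FreeGroup α) := ⊤

/-- The length `|g|` of the reduced word representing `g`. -/
def wlen {k : ℕ} (g : FreeGroup (Fin k)) : ℕ := (FreeGroup.toWord g).length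

/-- A family of "failure probabilities" decays exponentially: the corresponding events
hold with probability going to 1 exponentially fast as `n → ∞`. -/
def ExpDecay (f : ℕ → ENNReal) : Prop :=
  ∃ C : ℝ, 0 < C ∧ ∃ κ : ℝ, 1 < κ ∧ ∀ n : ℕ, f n ≤ ENNReal.ofReal (C / κ ^ n)

/-- `H` is Aut-malnormal: any automorphism `α` with `α(H) ∩ H ≠ {1}` is conjugation by an
element of `H`. -/
def AutMalnormal {k : ℕ} (H : Subgroup (FreeGroup (Fin k))) : Prop :=
  ∀ α : FreeGroup (Fin k) ≃* FreeGroup (Fin k),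
    (∃ x : FreeGroup (Fin k), x ≠ 1 ∧ x ∈ H ∧ α.symm x ∈ H) →
    ∃ h, h ∈ H ∧ ∀ g, α g = h * g * h⁻¹

section Decay

theorem ExpDecay.mono {f g : ℕ → ENNReal} (hg : ExpDecay g) (h : ∀ n, f n ≤ g n) : ExpDecay f := by
  obtain ⟨C, hC, κ, hκ, hb⟩ := hg
  exact ⟨C, hC, κ, hκ, fun n => (h n).trans (hb n)⟩

theorem ExpDecay.add {f g : ℕ → ENNReal} (hf : ExpDecay f) (hg : ExpDecay g) :
    ExpDecay fun n => f n + g n := by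
  obtain ⟨C, hC, κ, hκ, hb⟩ := hf
  obtain ⟨C', hC', κ', hκ', hb'⟩ := hg
  refine ⟨C + C', by positivity, min κ κ', lt_min hκ hκ', fun n => ?_⟩
  have h0 : 0 < min κ κ' := lt_min (by linarith) (by linarith)
  rw [add_div, ENNReal.ofReal_add (by positivity) (by positivity)]
  refine add_le_add ((hb n).trans (ENNReal.ofReal_le_ofReal ?_))
    ((hb' n).trans (ENNReal.ofReal_le_ofReal ?_))
  · gcongr; exact min_le_left _ _
  · gcongr; exact min_le_right _ _

theorem ExpDecay.zero : ExpDecay fun _ => 0 := ⟨1, one_pos, 2, one_lt_two, fun _ => zero_le⟩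

theorem ExpDecay.sum {ι : Type*} (s : Finset ι) {f : ι → ℕ → ENNReal}
    (h : ∀ i ∈ s, ExpDecay (f i)) : ExpDecay fun n => ∑ i ∈ s, f i n := by
  classical
  induction s using Finset.induction_on with
  | empty => simpa using ExpDecay.zero
  | insert a s ha ih =>
    simp only [Finset.sum_insert ha]
    exact (h a (Finset.mem_insert_self _ _)).add
      (ih fun i hi => h i (Finset.mem_insert_of_mem hi))

theorem ExpDecay.exp {C c : ℝ} (hC : 0 < C) (hc : 0 < c) :
    ExpDecay fun n => ENNReal.ofReal (C * Real.exp (-(c * n))) := by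
  refine ⟨C, hC, Real.exp c, Real.one_lt_exp_iff.2 hc, fun n => le_of_eq ?_⟩
  simp only
  rw [← Real.exp_nat_mul, Real.exp_neg, mul_comm c, div_eq_mul_inv]

theorem ExpDecay.initial (n₀ : ℕ) : ExpDecay fun n => if n < n₀ then 1 else 0 := by
  refine ⟨2 ^ n₀, by positivity, 2, one_lt_two, fun n => ?_⟩
  simp only
  split_ifs with h
  · rw [← ENNReal.ofReal_one]
    refine ENNReal.ofReal_le_ofReal ?_
    rw [le_div_iff₀ (by positivity), one_mul]
    exact pow_le_pow_right₀ one_le_two h.le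
  · exact zero_le

end Decay

namespace AutMal
open FreeGroup

section Words
variable {α : Type*} [DecidableEq α]

/-- The inverse letter. -/
def bar (a : α × Bool) : α × Bool := (a.1, !a.2)

/-- The group element given by a letter. -/
def lt (a : α × Bool) : FreeGroup α := mk [a]

/-- The first letter of the reduced word, if any. -/
def hd (g : FreeGroup α) : Option (α × Bool) := (toWord g).head?

omit [DecidableEq α] in
@[simp] theorem bar_bar (a : α × Bool) : bar (bar a) = a := by simp [bar]

omit [DecidableEq α] in
theorem bar_ne (a : α × Bool) : bar a ≠ a := by
  intro h
  have := congrArg Prod.snd h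
  simp [bar] at this

omit [DecidableEq α] in
theorem bar_injective : Function.Injective (bar : α × Bool → α × Bool) :=
  fun a b h => by simpa using congrArg bar h

omit [DecidableEq α] in
theorem bar_eq_comm {a b : α × Bool} : bar a = b ↔ a = bar b :=
  ⟨fun h => by rw [← h, bar_bar], fun h => by rw [h, bar_bar]⟩

omit [DecidableEq α] in
theorem lt_bar (a : α × Bool) : lt (bar a) = (lt a)⁻¹ := by
  simp [lt, bar, inv_mk, invRev]

omit [DecidableEq α] in
theorem rel_iff (a b : α × Bool) : (a.1 = b.1 → a.2 = b.2) ↔ b ≠ bar a := by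
  rcases a with ⟨a, x⟩; rcases b with ⟨b, y⟩
  simp only [bar, ne_eq, Prod.mk.injEq, not_and]
  constructor
  · rintro h rfl; have := h rfl; subst this; cases x <;> simp
  · rintro h rfl; have := h rfl; revert this; cases x <;> cases y <;> simp

omit [DecidableEq α] in
theorem isReduced_iff (L : List (α × Bool)) :
    FreeGroup.IsReduced L ↔ L.IsChain (fun a b => b ≠ bar a) := by
  unfold FreeGroup.IsReduced
  simp only [rel_iff]

@[simp] theorem toWord_lt (a : α × Bool) : toWord (lt a) = [a] := by
  simp [lt]

theorem lt_injective : Function.Injective (lt : α × Bool → FreeGroup α) := fun a b h => by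
  have := congrArg toWord h
  simpa using this

@[simp] theorem hd_lt (a : α × Bool) : hd (lt a) = some a := by simp [hd]

@[simp] theorem hd_one : hd (1 : FreeGroup α) = none := by simp [hd]

theorem hd_eq_none {g : FreeGroup α} : hd g = none ↔ g = 1 := by
  simp [hd, toWord_eq_nil_iff]

theorem lt_ne_one (a : α × Bool) : lt a ≠ 1 := by
  rw [Ne, ← hd_eq_none]; simp

theorem hd_inv (g : FreeGroup α) : hd g⁻¹ = (toWord g).getLast?.map bar := by
  unfold hd
  rw [toWord_inv, invRev, List.head?_reverse, List.getLast?_map]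
  rfl

theorem toWord_mul_of_ne {g h : FreeGroup α} (H : hd g⁻¹ ≠ hd h) :
    toWord (g * h) = toWord g ++ toWord h := by
  rw [toWord_mul, FreeGroup.IsReduced.reduce_eq]
  rw [isReduced_iff, List.isChain_append]
  refine ⟨(isReduced_iff _).1 isReduced_toWord, (isReduced_iff _).1 isReduced_toWord, ?_⟩
  intro a ha b hb
  rintro rfl
  apply H
  rw [hd_inv, Option.mem_def.1 ha]
  unfold hd
  rw [Option.mem_def.1 hb]
  rfl

theorem hd_mul_of_ne {g h : FreeGroup α} (H : hd g⁻¹ ≠ hd h) (hg : g ≠ 1) :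
    hd (g * h) = hd g := by
  unfold hd
  rw [toWord_mul_of_ne H, List.head?_append]
  have : (toWord g).head? ≠ none := by
    rw [Ne, List.head?_eq_none_iff, toWord_eq_nil_iff]; exact hg
  obtain ⟨a, ha⟩ := Option.ne_none_iff_exists'.1 this
  simp [ha]

/-- Splitting off the first letter. -/
theorem exists_of_hd {g : FreeGroup α} {a : α × Bool} (h : hd g = some a) :
    ∃ g', g = lt a * g' ∧ hd g' ≠ some (bar a) ∧ toWord g = a :: toWord g' := by
  unfold hd at h
  obtain ⟨L, hL⟩ := List.head?_eq_some_iff.1 h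
  have hred : FreeGroup.IsReduced (a :: L) := hL ▸ isReduced_toWord
  have hL' : toWord (mk L) = L := by
    rw [toWord_mk, FreeGroup.IsReduced.reduce_eq]
    exact hred.infix ⟨[a], [], by simp⟩
  refine ⟨mk L, ?_, ?_, by rw [hL', hL]⟩
  · rw [← mk_toWord (x := g), hL, lt, mul_mk]; rfl
  · unfold hd
    rw [hL']
    rw [isReduced_iff, List.isChain_cons] at hred
    intro h2
    exact hred.1 _ h2 rfl

theorem hd_lt_mul {g : FreeGroup α} {a : α × Bool} (h : hd g ≠ some (bar a)) :
    hd (lt a * g) = some a := by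
  rw [hd_mul_of_ne _ (lt_ne_one a), hd_lt]
  rw [← lt_bar, hd_lt]; exact h.symm

/-- `g` does not start with `a` iff `a⁻¹ g` starts with `a⁻¹`. -/
theorem hd_inv_lt_mul_iff (g : FreeGroup α) (a : α × Bool) :
    hd ((lt a)⁻¹ * g) = some (bar a) ↔ hd g ≠ some a := by
  constructor
  · intro h h2
    obtain ⟨g', rfl, h3, -⟩ := exists_of_hd h2
    simp at h
    exact h3 h
  · intro h
    rw [← lt_bar]
    exact hd_lt_mul (by simpa using h)

/-- Right multiplication by a letter only changes the first letter finitely often. -/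
theorem hd_mul_lt {g : FreeGroup α} {a : α × Bool} (h1 : g ≠ 1) (h2 : g ≠ (lt a)⁻¹) :
    hd (g * lt a) = hd g := by
  by_cases h : hd g⁻¹ = some a
  · obtain ⟨g', hg, h3, -⟩ := exists_of_hd h
    have hg' : g = g'⁻¹ * lt (bar a) := by
      rw [lt_bar, ← mul_inv_rev, ← hg, inv_inv]
    have : g'⁻¹ ≠ 1 := by
      intro h4; rw [h4, one_mul, lt_bar] at hg'; exact h2 hg'
    rw [hg', mul_assoc, ← bar_bar a, lt_bar (bar a), bar_bar, mul_inv_cancel, mul_one,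
      hd_mul_of_ne _ this]
    rw [inv_inv, hd_lt]; exact h3
  · exact hd_mul_of_ne (by simpa using h) h1

end Words

section AlmostInvariant
variable {α : Type*}

/-- Sets which are invariant under right translations up to finite sets. -/
def AI (U : Set (FreeGroup α)) : Prop :=
  ∀ t : FreeGroup α, {g | ¬ (g ∈ U ↔ g * t ∈ U)}.Finite

theorem AI.of_letters {U : Set (FreeGroup α)}
    (h : ∀ a : α × Bool, {g | ¬ (g ∈ U ↔ g * lt a ∈ U)}.Finite) : AI U := by
  intro t
  obtain ⟨L, rfl⟩ := Quot.exists_rep t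
  change {g | ¬ (g ∈ U ↔ g * mk L ∈ U)}.Finite
  induction L with
  | nil => simp [← one_eq_mk]
  | cons a L ih =>
    have : {g | ¬ (g ∈ U ↔ g * mk (a :: L) ∈ U)} ⊆ {g | ¬ (g ∈ U ↔ g * lt a ∈ U)} ∪
        (fun g => g * lt a) ⁻¹' {g | ¬ (g ∈ U ↔ g * mk L ∈ U)} := by
      intro g hg
      simp only [Set.mem_union, Set.mem_ofPred_eq, Set.mem_preimage] at hg ⊢
      have : mk (a :: L) = lt a * mk L := by rw [lt, mul_mk]; rfl
      rw [this, ← mul_assoc] at hg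
      tauto
    refine ((h a).union ?_).subset this
    exact ih.preimage (fun x _ y _ hxy => mul_right_cancel hxy)

theorem AI.compl {U : Set (FreeGroup α)} (h : AI U) : AI Uᶜ := fun t =>
  (h t).subset fun g hg => by
    simp only [Set.mem_ofPred_eq, Set.mem_compl_iff] at *; tauto

theorem AI.union {U V : Set (FreeGroup α)} (h : AI U) (h' : AI V) : AI (U ∪ V) := fun t =>
  ((h t).union (h' t)).subset fun g hg => by
    simp only [Set.mem_ofPred_eq, Set.mem_union] at *; tauto

theorem AI.translate {U : Set (FreeGroup α)} (h : AI U) (v : FreeGroup α) :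
    AI ((fun g => v * g) ⁻¹' U) := fun t => by
  have := (h t).preimage (f := fun g => v * g) (fun x _ y _ hxy => mul_left_cancel hxy)
  refine this.subset fun g hg => ?_
  simpa [mul_assoc] using hg

theorem AI.preimage_equiv {U : Set (FreeGroup α)} (h : AI U) (e : FreeGroup α ≃* FreeGroup α) :
    AI (e ⁻¹' U) := fun t => by
  have := (h (e t)).preimage (f := e) (fun x _ y _ hxy => e.injective hxy)
  refine this.subset fun g hg => ?_
  simpa using hg

variable [DecidableEq α]

/-- Union of the half-trees at `v` in the directions `J`. -/
def St (v : FreeGroup α) (J : Finset (α × Bool)) : Set (FreeGroup α) :=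
  {g | ∃ s ∈ J, hd (v⁻¹ * g) = some s}

theorem St_eq_preimage (v : FreeGroup α) (J : Finset (α × Bool)) :
    St v J = (fun g => v⁻¹ * g) ⁻¹' St 1 J := by
  ext g; simp [St]

theorem mem_St_singleton {v g : FreeGroup α} {s : α × Bool} :
    g ∈ St v {s} ↔ hd (v⁻¹ * g) = some s := by simp [St]

theorem AI_St (v : FreeGroup α) (J : Finset (α × Bool)) : AI (St v J) := by
  rw [St_eq_preimage]
  refine AI.translate (AI.of_letters fun a => ?_) _
  refine (Set.toFinite {1, (lt a)⁻¹}).subset fun g hg => ?_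
  by_contra h
  simp only [Set.mem_insert_iff, Set.mem_singleton_iff, not_or] at h
  apply hg
  simp [St, hd_mul_lt h.1 h.2]

theorem St_disjoint {v : FreeGroup α} {I J : Finset (α × Bool)} (h : Disjoint I J) :
    Disjoint (St v I) (St v J) := by
  rw [Set.disjoint_left]
  rintro g ⟨s, hs, h1⟩ ⟨t, ht, h2⟩
  rw [h1] at h2
  cases h2
  exact Finset.disjoint_left.1 h hs ht

theorem St_compl_singleton (v : FreeGroup α) (s : α × Bool) :
    (St v {s})ᶜ = St (v * lt s) {bar s} := by
  ext g
  rw [Set.mem_compl_iff, mem_St_singleton, mem_St_singleton, mul_inv_rev, mul_assoc,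
    hd_inv_lt_mul_iff]

end AlmostInvariant

section Lines
variable {α : Type*} [DecidableEq α]

/-- A bi-infinite geodesic in the Cayley tree. -/
structure IsLine (v : ℤ → FreeGroup α) (Y : ℤ → α × Bool) : Prop where
  step : ∀ n, v (n + 1) = v n * lt (Y n)
  red : ∀ n, Y (n + 1) ≠ bar (Y n)

/-- The word read along the segment of length `m` starting at `n`. -/
def seg (Y : ℤ → α × Bool) (n : ℤ) (m : ℕ) : List (α × Bool) :=
  (List.range m).map fun i : ℕ => Y (n + i)

variable {v : ℤ → FreeGroup α} {Y : ℤ → α × Bool}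

omit [DecidableEq α] in
theorem IsLine.isReduced_seg (h : IsLine v Y) (n : ℤ) (m : ℕ) : FreeGroup.IsReduced (seg Y n m) := by
  rw [isReduced_iff, seg, List.isChain_map]
  have : List.IsChain (fun a b : ℕ => b = a + 1) (List.range m) := by
    have := List.isChain_range (r := fun a b : ℕ => b = a + 1) (n := m)
    rw [this]; intros; rfl
  refine this.imp ?_
  rintro a b rfl
  have := h.red (n + a)
  push_cast
  rwa [← add_assoc]

omit [DecidableEq α] in
theorem IsLine.mul_seg (h : IsLine v Y) (n : ℤ) (m : ℕ) : v (n + m) = v n * FreeGroup.mk (seg Y n m) := by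
  induction m with
  | zero => simp [seg, ← one_eq_mk]
  | succ m ih =>
    have : seg Y n (m + 1) = seg Y n m ++ [Y (n + m)] := by simp [seg, List.range_succ]
    rw [this, ← mul_mk, ← mul_assoc, ← ih]
    push_cast
    rw [← add_assoc, h.step]; rfl

theorem IsLine.toWord_seg (h : IsLine v Y) (n : ℤ) (m : ℕ) :
    toWord ((v n)⁻¹ * v (n + m)) = seg Y n m := by
  rw [h.mul_seg, inv_mul_cancel_left, toWord_mk, (h.isReduced_seg n m).reduce_eq]

theorem IsLine.hd_pos (h : IsLine v Y) {n m : ℤ} (hnm : n < m) :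
    hd ((v n)⁻¹ * v m) = some (Y n) := by
  obtain ⟨d, hd⟩ := Int.eq_ofNat_of_zero_le (a := m - n - 1) (by lia)
  have hm : m = n + ((d + 1 : ℕ) : ℤ) := by push_cast; lia
  rw [hm]
  unfold AutMal.hd
  rw [h.toWord_seg, seg, List.range_succ_eq_map]
  simp

theorem IsLine.hd_neg (h : IsLine v Y) {n m : ℤ} (hnm : m < n) :
    hd ((v n)⁻¹ * v m) = some (bar (Y (n - 1))) := by
  obtain ⟨d, hd⟩ := Int.eq_ofNat_of_zero_le (a := n - m - 1) (by lia)
  have hm : n = m + ((d + 1 : ℕ) : ℤ) := by push_cast; lia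
  have : (v n)⁻¹ * v m = ((v m)⁻¹ * v n)⁻¹ := by simp
  rw [this, hd_inv, hm, h.toWord_seg, seg, List.range_succ]
  simp
  congr 2; lia

theorem IsLine.injective (h : IsLine v Y) : Function.Injective v := by
  have key : ∀ n m, n < m → v n ≠ v m := fun n m hnm he => by
    have := h.hd_pos hnm
    rw [he] at this
    simp at this
  intro n m he
  rcases lt_trichotomy n m with h1 | h1 | h1
  · exact absurd he (key _ _ h1)
  · exact h1
  · exact absurd he.symm (key _ _ h1)

variable {x : FreeGroup α} {N : ℤ}

omit [DecidableEq α] in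
theorem zpow_line (hp : ∀ n, v (n + N) = x * v n) (n j : ℤ) : v (n + j * N) = x ^ j * v n := by
  induction j using Int.induction_on with
  | zero => simp
  | succ i ih =>
    rw [add_mul, one_mul, ← add_assoc, hp, ih, ← mul_assoc, ← zpow_one_add, add_comm (1 : ℤ)]
  | pred i ih =>
    have := hp (n + (-↑i - 1) * N)
    rw [show n + (-↑i - 1) * N + N = n + -↑i * N by ring, ih] at this
    rw [sub_eq_add_neg (-(i : ℤ)), add_comm (-(i : ℤ)), zpow_add, zpow_neg_one, mul_assoc, this,
      inv_mul_cancel_left]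
    ring_nf

theorem IsLine.periodic_letter (h : IsLine v Y) (hp : ∀ n, v (n + N) = x * v n) (n : ℤ) :
    Y (n + N) = Y n := by
  apply lt_injective
  have h1 := h.step (n + N)
  rw [show n + N + 1 = (n + 1) + N by ring, hp, hp, h.step, mul_assoc] at h1
  exact (mul_left_cancel (mul_left_cancel h1)).symm

end Lines

section Ends
variable {α : Type*}

/-- The ray `m ↦ g x ^ m` eventually lies in `U`. -/
def PlusIn (x : FreeGroup α) (U : Set (FreeGroup α)) (g : FreeGroup α) : Prop :=
  ∀ᶠ m : ℤ in Filter.atTop, g * x ^ m ∈ U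

theorem PlusIn.shift {x : FreeGroup α} {U : Set (FreeGroup α)} {g : FreeGroup α}
    (h : PlusIn x U g) (j : ℤ) : PlusIn x U (g * x ^ j) := by
  have := (Filter.tendsto_atTop_add_const_left (Filter.atTop : Filter ℤ) j
    Filter.tendsto_id).eventually h
  refine this.mono fun m hm => ?_
  rw [mul_assoc, ← zpow_add]
  exact hm

theorem plusIn_shift_iff {x : FreeGroup α} {U : Set (FreeGroup α)} {g : FreeGroup α} (j : ℤ) :
    PlusIn x U (g * x ^ j) ↔ PlusIn x U g :=
  ⟨fun h => by simpa [mul_assoc] using h.shift (-j), fun h => h.shift j⟩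

theorem zpow_injective {x : FreeGroup α} (hx : x ≠ 1) : Function.Injective fun m : ℤ => x ^ m := by
  rw [injective_zpow_iff_not_isOfFinOrder]
  exact not_isOfFinOrder_of_isMulTorsionFree hx

theorem eventually_notMem_finite {x : FreeGroup α} (hx : x ≠ 1) {S : Set (FreeGroup α)}
    (hS : S.Finite) (g b : FreeGroup α) : ∀ᶠ m : ℤ in Filter.atTop, g * x ^ m * b ∉ S := by
  have hinj : Function.Injective fun m : ℤ => g * x ^ m * b := fun m m' h =>
    zpow_injective hx (mul_left_cancel (mul_right_cancel h))
  have h1 := hinj.tendsto_cofinite.eventually hS.compl_mem_cofinite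
  rw [Int.cofinite_eq] at h1
  exact h1.filter_mono le_sup_right

theorem plusIn_compl_iff {x : FreeGroup α} (hx : x ≠ 1) {U : Set (FreeGroup α)} (hU : AI U)
    (g : FreeGroup α) : PlusIn x Uᶜ g ↔ ¬ PlusIn x U g := by
  constructor
  · intro h h'
    obtain ⟨m, h1, h2⟩ := (h.and h').exists
    exact h1 h2
  · intro h
    have h1 := eventually_notMem_finite hx (hU x) g 1
    obtain ⟨M, hM⟩ := Filter.eventually_atTop.1 h1
    have hc : ∀ m, M ≤ m → (g * x ^ m ∈ U ↔ g * x ^ M ∈ U) := by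
      intro m hm
      induction m, hm using Int.leInduction with
      | base => rfl
      | succ m hm ih =>
        have := hM m hm
        simp only [mul_one, Set.mem_ofPred_eq, not_not] at this
        rw [← ih, this, mul_assoc, zpow_add_one]
    by_cases hMU : g * x ^ M ∈ U
    · exact absurd (Filter.eventually_atTop.2 ⟨M, fun m hm => (hc m hm).2 hMU⟩) h
    · exact Filter.eventually_atTop.2 ⟨M, fun m hm h' => hMU ((hc m hm).1 h')⟩

theorem plusIn_right_mul {x : FreeGroup α} (hx : x ≠ 1) {U : Set (FreeGroup α)} (hU : AI U)
    (g b : FreeGroup α) : (∀ᶠ m : ℤ in Filter.atTop, g * x ^ m * b ∈ U) ↔ PlusIn x U g := by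
  have h1 := eventually_notMem_finite hx (hU b) g 1
  refine Filter.eventually_congr (h1.mono fun m hm => ?_)
  simp only [mul_one, Set.mem_ofPred_eq, not_not] at hm
  exact hm.symm

/-- Equality of sets up to a finite set. -/
def Alm (U V : Set (FreeGroup α)) : Prop := {g | ¬ (g ∈ U ↔ g ∈ V)}.Finite

theorem Alm.symm {U V : Set (FreeGroup α)} (h : Alm U V) : Alm V U :=
  h.subset fun g hg => by simp only [Set.mem_ofPred_eq] at *; tauto

theorem Alm.trans {U V W : Set (FreeGroup α)} (h : Alm U V) (h' : Alm V W) : Alm U W :=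
  (h.union h').subset fun g hg => by simp only [Set.mem_ofPred_eq, Set.mem_union] at *; tauto

theorem Alm.compl {U V : Set (FreeGroup α)} (h : Alm U V) : Alm Uᶜ Vᶜ :=
  h.subset fun g hg => by simp only [Set.mem_ofPred_eq, Set.mem_compl_iff] at *; tauto

theorem Alm.plusIn {x : FreeGroup α} (hx : x ≠ 1) {U V : Set (FreeGroup α)} (h : Alm U V)
    (g : FreeGroup α) : PlusIn x U g ↔ PlusIn x V g := by
  refine Filter.eventually_congr ((eventually_notMem_finite hx h g 1).mono fun m hm => ?_)
  simpa using hm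

/-- The translates of the axis of `x` whose two ends are separated by `U`. -/
def Sep (x : FreeGroup α) (U : Set (FreeGroup α)) : Set (FreeGroup α ⧸ Subgroup.zpowers x) :=
  {c | ∃ g : FreeGroup α, (g : FreeGroup α ⧸ Subgroup.zpowers x) = c ∧
    ¬ (PlusIn x U g ↔ PlusIn x⁻¹ U g)}

theorem mk_mem_Sep {x : FreeGroup α} {U : Set (FreeGroup α)} {g : FreeGroup α} :
    (g : FreeGroup α ⧸ Subgroup.zpowers x) ∈ Sep x U ↔ ¬ (PlusIn x U g ↔ PlusIn x⁻¹ U g) := by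
  constructor
  · rintro ⟨g', h1, h2⟩
    rw [QuotientGroup.eq] at h1
    obtain ⟨j, hj⟩ := h1
    have : g = g' * x ^ j := by simp only at hj; rw [hj]; group
    rw [this, plusIn_shift_iff]
    have h3 : g' * x ^ j = g' * x⁻¹ ^ (-j) := by simp
    rw [h3, plusIn_shift_iff]
    exact h2
  · exact fun h => ⟨g, rfl, h⟩

/-- The number of translates of the axis of `x` crossing `U`. -/
def crossing (x : FreeGroup α) (U : Set (FreeGroup α)) : ℕ∞ := (Sep x U).encard

theorem Alm.crossing_eq {x : FreeGroup α} (hx : x ≠ 1) {U V : Set (FreeGroup α)} (h : Alm U V) :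
    crossing x U = crossing x V := by
  have : Sep x U = Sep x V := by
    ext c
    induction c using QuotientGroup.induction_on with
    | H g => rw [mk_mem_Sep, mk_mem_Sep, h.plusIn hx, h.plusIn (inv_ne_one.2 hx)]
  rw [crossing, this, crossing]

theorem crossing_compl {x : FreeGroup α} (hx : x ≠ 1) {U : Set (FreeGroup α)} (h : AI U) :
    crossing x Uᶜ = crossing x U := by
  have : Sep x Uᶜ = Sep x U := by
    ext c
    induction c using QuotientGroup.induction_on with
    | H g =>
      rw [mk_mem_Sep, mk_mem_Sep, plusIn_compl_iff hx h, plusIn_compl_iff (inv_ne_one.2 hx) h]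
      tauto
  rw [crossing, this, crossing]

theorem plusIn_inter {x : FreeGroup α} {U V : Set (FreeGroup α)} {g : FreeGroup α} :
    PlusIn x (U ∩ V) g ↔ PlusIn x U g ∧ PlusIn x V g := Filter.eventually_and

theorem plusIn_union {x : FreeGroup α} (hx : x ≠ 1) {U V : Set (FreeGroup α)} (hU : AI U)
    (hV : AI V) {g : FreeGroup α} : PlusIn x (U ∪ V) g ↔ PlusIn x U g ∨ PlusIn x V g := by
  have := plusIn_compl_iff hx (hU.union hV) g
  rw [Set.compl_union, plusIn_inter, plusIn_compl_iff hx hU, plusIn_compl_iff hx hV] at this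
  tauto

theorem crossing_submodular {x : FreeGroup α} (hx : x ≠ 1) {U V : Set (FreeGroup α)} (hU : AI U)
    (hV : AI V) : crossing x (U ∪ V) + crossing x (U ∩ V) ≤ crossing x U + crossing x V := by
  unfold crossing
  have hx' := inv_ne_one.2 hx
  rw [← Set.encard_union_add_encard_inter, ← Set.encard_union_add_encard_inter (Sep x U)]
  refine add_le_add (Set.encard_le_encard ?_) (Set.encard_le_encard ?_)
  all_goals
    intro c
    induction c using QuotientGroup.induction_on with
    | H g =>
      simp only [Set.mem_union, Set.mem_inter_iff, mk_mem_Sep, plusIn_union hx hU hV,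
        plusIn_union hx' hU hV, plusIn_inter]
      tauto

theorem crossing_translate (x v : FreeGroup α) (U : Set (FreeGroup α)) :
    crossing x ((fun g => v * g) ⁻¹' U) = crossing x U := by
  have : Sep x ((fun g => v * g) ⁻¹' U) = (MulAction.toPerm v) ⁻¹' Sep x U := by
    ext c
    induction c using QuotientGroup.induction_on with
    | H g =>
      rw [Set.mem_preimage, MulAction.toPerm_apply, MulAction.Quotient.smul_coe, mk_mem_Sep,
        mk_mem_Sep]
      simp [PlusIn, mul_assoc]
  rw [crossing, this, Set.encard_preimage_of_bijective (MulAction.toPerm v).bijective, crossing]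

theorem crossing_map (e : FreeGroup α ≃* FreeGroup α) (x : FreeGroup α)
    (U : Set (FreeGroup α)) : crossing x (e ⁻¹' U) = crossing (e x) U := by
  let E : (FreeGroup α ⧸ Subgroup.zpowers x) ≃ (FreeGroup α ⧸ Subgroup.zpowers (e x)) :=
    Quotient.congr e.toEquiv (by
      intro a b
      rw [QuotientGroup.leftRel_apply, QuotientGroup.leftRel_apply]
      simp only [Subgroup.mem_zpowers_iff, MulEquiv.toEquiv_eq_coe, EquivLike.coe_coe]
      refine exists_congr fun j => ?_
      rw [← map_zpow, ← _root_.map_inv, ← _root_.map_mul, e.injective.eq_iff])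
  have : Sep x (e ⁻¹' U) = E ⁻¹' Sep (e x) U := by
    ext c
    induction c using QuotientGroup.induction_on with
    | H g =>
      have : E (g : FreeGroup α ⧸ Subgroup.zpowers x) = ((e g : FreeGroup α) :) := rfl
      rw [Set.mem_preimage, this, mk_mem_Sep, mk_mem_Sep]
      simp [PlusIn]
  rw [crossing, this, Set.encard_preimage_of_bijective E.bijective, crossing]

end Ends

section Axis
variable {α : Type*} [DecidableEq α] {v : ℤ → FreeGroup α} {Y : ℤ → α × Bool}
  {x : FreeGroup α} {N : ℤ}

theorem IsLine.ne_one (h : IsLine v Y) (hN : 0 < N) (hp : ∀ n, v (n + N) = x * v n) : x ≠ 1 := by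
  rintro rfl
  have := h.injective ((hp 0).trans (one_mul _))
  lia

theorem IsLine.plusIn (h : IsLine v Y) (hN : 0 < N) (hp : ∀ n, v (n + N) = x * v n) (n : ℤ)
    (J : Finset (α × Bool)) : PlusIn x (St 1 J) (v n)⁻¹ ↔ Y n ∈ J := by
  rw [← plusIn_right_mul (h.ne_one hN hp) (AI_St 1 J) _ (v n)]
  have key : ∀ m : ℤ, 0 < m → ((v n)⁻¹ * x ^ m * v n ∈ St 1 J ↔ Y n ∈ J) := by
    intro m hm
    have h1 := h.hd_pos (n := n) (m := n + m * N) (by nlinarith)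
    rw [zpow_line hp, ← mul_assoc] at h1
    simp only [St, inv_one, one_mul, h1, Set.mem_ofPred_eq]
    constructor
    · rintro ⟨s, hs, hs'⟩; cases hs'; exact hs
    · exact fun hs => ⟨_, hs, rfl⟩
  constructor
  · intro H
    obtain ⟨m, h1, h2⟩ := (H.and (Filter.eventually_gt_atTop 0)).exists
    exact (key m h2).1 h1
  · intro H
    exact (Filter.eventually_gt_atTop 0).mono fun m hm => (key m hm).2 H

theorem IsLine.minusIn (h : IsLine v Y) (hN : 0 < N) (hp : ∀ n, v (n + N) = x * v n) (n : ℤ)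
    (J : Finset (α × Bool)) : PlusIn x⁻¹ (St 1 J) (v n)⁻¹ ↔ bar (Y (n - 1)) ∈ J := by
  rw [← plusIn_right_mul (inv_ne_one.2 (h.ne_one hN hp)) (AI_St 1 J) _ (v n)]
  have key : ∀ m : ℤ, 0 < m → ((v n)⁻¹ * x⁻¹ ^ m * v n ∈ St 1 J ↔ bar (Y (n - 1)) ∈ J) := by
    intro m hm
    have h1 := h.hd_neg (n := n) (m := n + (-m) * N) (by nlinarith)
    rw [zpow_line hp, ← mul_assoc, ← inv_zpow'] at h1
    simp only [St, inv_one, one_mul, h1, Set.mem_ofPred_eq]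
    simp
  constructor
  · intro H
    obtain ⟨m, h1, h2⟩ := (H.and (Filter.eventually_gt_atTop 0)).exists
    exact (key m h2).1 h1
  · intro H
    exact (Filter.eventually_gt_atTop 0).mono fun m hm => (key m hm).2 H

/-- A translate of the axis whose ends are separated by a union of half-trees at `1`
passes through `1`. -/
theorem IsLine.exists_eq_of_sep (h : IsLine v Y) (hN : 0 < N) (hp : ∀ n, v (n + N) = x * v n)
    {g : FreeGroup α} {J : Finset (α × Bool)}
    (hg : ¬ (PlusIn x (St 1 J) g ↔ PlusIn x⁻¹ (St 1 J) g)) : ∃ n, g⁻¹ = v n := by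
  have hx := h.ne_one hN hp
  have hx' := inv_ne_one.2 hx
  have key : ∀ᶠ m : ℤ in Filter.atTop, hd (g * x ^ m * v 0) ≠ hd (g * x⁻¹ ^ m * v 0) := by
    have hAI := AI_St 1 J
    by_cases h1 : PlusIn x (St 1 J) g
    · have h2 : ¬ PlusIn x⁻¹ (St 1 J) g := by tauto
      rw [← plusIn_compl_iff hx' hAI] at h2
      rw [← plusIn_right_mul hx hAI _ (v 0)] at h1
      rw [← plusIn_right_mul hx' hAI.compl _ (v 0)] at h2
      filter_upwards [h1, h2] with m h3 h4 h5
      apply h4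
      simpa [St, h5] using h3
    · have h2 : PlusIn x⁻¹ (St 1 J) g := by tauto
      rw [← plusIn_compl_iff hx hAI] at h1
      rw [← plusIn_right_mul hx hAI.compl _ (v 0)] at h1
      rw [← plusIn_right_mul hx' hAI _ (v 0)] at h2
      filter_upwards [h1, h2] with m h3 h4 h5
      apply h3
      simpa [St, h5] using h4
  obtain ⟨m, h1, hm⟩ := (key.and (Filter.eventually_gt_atTop 0)).exists
  have e1 : x ^ m * v 0 = v (m * N) := by rw [← zpow_line hp, zero_add]
  have e2 : x⁻¹ ^ m * v 0 = v (-m * N) := by rw [inv_zpow', ← zpow_line hp, zero_add]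
  rw [mul_assoc, mul_assoc, e1, e2] at h1
  have h2 := toWord_mul_of_ne (g := (g * v (-m * N))⁻¹) (h := g * v (m * N))
    (by rw [inv_inv]; exact h1.symm)
  rw [show (g * v (-m * N))⁻¹ * (g * v (m * N)) = (v (-m * N))⁻¹ * v (m * N) by group] at h2
  obtain ⟨d, hd⟩ := Int.eq_ofNat_of_zero_le (a := 2 * m * N) (by positivity)
  have e3 : m * N = -m * N + d := by rw [← hd]; ring
  rw [e3, h.toWord_seg] at h2
  have h3 : toWord (g * v (-m * N))⁻¹ = seg Y (-m * N) (toWord (g * v (-m * N))⁻¹).length := by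
    have hl : (toWord (g * v (-m * N))⁻¹).length ≤ d := by
      have := congrArg List.length h2
      rw [List.length_append] at this
      simp only [seg, List.length_map, List.length_range] at this
      lia
    have h4 := congrArg (List.take (toWord (g * v (-m * N))⁻¹).length) h2
    rw [List.take_left] at h4
    rw [← h4]
    simp only [seg, ← List.map_take, List.take_range]
    rw [List.length_map, List.length_range, min_eq_left hl]
  refine ⟨-m * N + (toWord (g * v (-m * N))⁻¹).length, ?_⟩
  rw [h.mul_seg, ← h3, mk_toWord]
  group

theorem crossing_St (h : IsLine v Y) (hN : 0 < N) (hp : ∀ n, v (n + N) = x * v n)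
    (J : Finset (α × Bool)) : crossing x (St 1 J) =
      ((Finset.Ico 0 N).filter fun n => ¬ (Y n ∈ J ↔ bar (Y (n - 1)) ∈ J)).card := by
  rw [crossing, ← Set.encard_coe_eq_coe_finsetCard]
  symm
  have hinj : Set.InjOn (fun n : ℤ => (((v n)⁻¹ : FreeGroup α) : FreeGroup α ⧸ Subgroup.zpowers x))
      ((Finset.Ico 0 N).filter fun n => ¬ (Y n ∈ J ↔ bar (Y (n - 1)) ∈ J) : Finset ℤ) := by
    intro n hn n' hn' he
    simp only [Finset.coe_filter, Finset.mem_Ico, Set.mem_ofPred_eq] at hn hn'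
    simp only [QuotientGroup.eq, inv_inv] at he
    obtain ⟨j, hj⟩ := he
    simp only at hj
    have : v n = v (n' + j * N) := by rw [zpow_line hp, hj]; group
    have := h.injective this
    have hj0 : j = 0 := by
      rcases lt_trichotomy j 0 with h1 | h1 | h1
      · nlinarith
      · exact h1
      · nlinarith
    subst hj0; simpa using this
  rw [← hinj.encard_image]
  congr 1
  ext c
  constructor
  · rintro ⟨n, hn, rfl⟩
    simp only [Finset.coe_filter, Finset.mem_Ico, Set.mem_ofPred_eq] at hn
    simp only
    rw [mk_mem_Sep, h.plusIn hN hp, h.minusIn hN hp]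
    exact hn.2
  · induction c using QuotientGroup.induction_on with
    | H g =>
      intro hc
      rw [mk_mem_Sep] at hc
      obtain ⟨n, hn⟩ := h.exists_eq_of_sep hN hp hc
      have hg : g = (v n)⁻¹ := by rw [← hn, inv_inv]
      have hper := h.periodic_letter hp
      have hperj : ∀ (n j : ℤ), Y (n + j * N) = Y n := by
        intro n j
        induction j using Int.induction_on with
        | zero => simp
        | succ i ih => rw [add_mul, one_mul, ← add_assoc, hper, ih]
        | pred i ih => rw [← hper, ← ih]; congr 1; ring
      rw [hg, h.plusIn hN hp, h.minusIn hN hp] at hc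
      refine ⟨n % N, ?_, ?_⟩
      · simp only [Finset.coe_filter, Finset.mem_Ico, Set.mem_ofPred_eq]
        refine ⟨⟨Int.emod_nonneg _ hN.ne', Int.emod_lt_of_pos _ hN⟩, ?_⟩
        have e1 : n = n % N + (n / N) * N := by rw [Int.emod_add_ediv_mul]
        rw [e1, add_sub_right_comm, hperj, hperj] at hc
        exact hc
      · simp only
        rw [QuotientGroup.eq, inv_inv, hg]
        refine ⟨-(n / N), ?_⟩
        simp only
        have e1 : n % N = n + (-(n / N)) * N := by
          have := Int.emod_add_ediv_mul n N; linarith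
        rw [e1, zpow_line hp]; group

/-- Two periodic geodesics with the same period element coincide up to a shift. -/
theorem IsLine.unique (h : IsLine v Y) (hN : 0 < N) (hp : ∀ n, v (n + N) = x * v n)
    {v' : ℤ → FreeGroup α} {Y' : ℤ → α × Bool} {N' : ℤ} (h' : IsLine v' Y') (hN' : 0 < N')
    (hp' : ∀ n, v' (n + N') = x * v' n) :
    ∃ d : ℤ, ∀ j : ℕ, v' j = v (d + j) ∧ Y' j = Y (d + j) := by
  have key : ∀ n', ∃ n, v' n' = v n ∧ Y' n' = Y n := by
    intro n'
    have h1 : PlusIn x (St 1 {Y' n'}) (v' n')⁻¹ := (h'.plusIn hN' hp' n' _).2 (by simp)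
    have h2 : ¬ PlusIn x⁻¹ (St 1 {Y' n'}) (v' n')⁻¹ := by
      rw [h'.minusIn hN' hp']
      have := h'.red (n' - 1)
      rw [sub_add_cancel] at this
      simpa using this.symm
    obtain ⟨n, hn⟩ := h.exists_eq_of_sep hN hp (g := (v' n')⁻¹) (J := {Y' n'}) (by tauto)
    rw [inv_inv] at hn
    refine ⟨n, hn, ?_⟩
    rw [hn, h.plusIn hN hp] at h1
    simpa [eq_comm] using h1
  obtain ⟨d, h1, h2⟩ := key 0
  refine ⟨d, fun j => ?_⟩
  induction j with
  | zero => simpa using ⟨h1, h2⟩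
  | succ j ih =>
    obtain ⟨n, h3, h4⟩ := key (j + 1)
    have h5 : v' (j + 1) = v (d + j + 1) := by rw [h'.step, h.step, ih.1, ih.2]
    have h6 : n = d + j + 1 := h.injective (h3.symm.trans h5)
    subst h6
    push_cast
    rw [← add_assoc]
    exact ⟨h3, h4⟩

end Axis

section Cylinders
variable {α : Type*} [DecidableEq α]

/-- Group elements whose reduced word starts with the reduced word of `v`. -/
def Cyl (v : FreeGroup α) : Set (FreeGroup α) := {g | toWord v <+: toWord g}

theorem self_mem_Cyl (v : FreeGroup α) : v ∈ Cyl v := List.prefix_rfl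

theorem Cyl_one : Cyl (1 : FreeGroup α) = Set.univ := by
  ext g; simp [Cyl]

theorem Cyl_subset {v w : FreeGroup α} (h : w ∈ Cyl v) : Cyl w ⊆ Cyl v :=
  fun _ hg => List.IsPrefix.trans h hg

theorem Cyl_nested {v w g : FreeGroup α} (h : g ∈ Cyl v) (h' : g ∈ Cyl w) :
    Cyl v ⊆ Cyl w ∨ Cyl w ⊆ Cyl v :=
  (List.prefix_or_prefix_of_prefix h h').symm.imp (fun h => Cyl_subset h) fun h => Cyl_subset h

theorem mem_Cyl_iff {v g : FreeGroup α} : g ∈ Cyl v ↔ g = v ∨ hd v⁻¹ ≠ hd (v⁻¹ * g) := by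
  constructor
  · rintro ⟨L, hL⟩
    have hr : FreeGroup.IsReduced (toWord v ++ L) := hL ▸ isReduced_toWord
    have hL' : toWord (FreeGroup.mk L) = L := by
      rw [toWord_mk, IsReduced.reduce_eq]
      exact hr.infix ⟨toWord v, [], by simp⟩
    have hg : v⁻¹ * g = FreeGroup.mk L := by
      rw [inv_mul_eq_iff_eq_mul, ← mk_toWord (x := g), ← hL, ← mul_mk, mk_toWord]
    rw [or_iff_not_imp_left]
    intro hne
    rw [hg, hd_inv]
    have hLne : L ≠ [] := by
      rintro rfl
      rw [← one_eq_mk, inv_mul_eq_one] at hg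
      exact hne hg.symm
    obtain ⟨b, L', rfl⟩ := List.exists_cons_of_ne_nil hLne
    unfold hd
    rw [hL']
    rw [isReduced_iff, List.isChain_append] at hr
    intro h
    rw [List.head?_cons, Option.map_eq_some_iff] at h
    obtain ⟨a, ha, hab⟩ := h
    exact hr.2.2 a ha b (by simp) hab.symm
  · rintro (rfl | h)
    · exact self_mem_Cyl _
    · have := toWord_mul_of_ne h
      rw [mul_inv_cancel_left] at this
      exact ⟨_, this.symm⟩

theorem hd_inv_mul_lt {v : FreeGroup α} {s : α × Bool} (h : hd v⁻¹ ≠ some s) :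
    hd (v * lt s)⁻¹ = some (bar s) := by
  rw [mul_inv_rev, ← lt_bar, hd_lt_mul]
  simpa using h

theorem Cyl_mul_lt {v : FreeGroup α} {s : α × Bool} (h : hd v⁻¹ ≠ some s) :
    Cyl (v * lt s) = St v {s} := by
  ext g
  rw [mem_Cyl_iff, mem_St_singleton, hd_inv_mul_lt h, mul_inv_rev, mul_assoc, ne_comm, Ne,
    hd_inv_lt_mul_iff, not_not]
  constructor
  · rintro (rfl | h)
    · simp
    · exact h
  · exact Or.inr

theorem exists_eq_mul_lt {v : FreeGroup α} (h : v ≠ 1) :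
    ∃ u t, v = u * lt t ∧ hd u⁻¹ ≠ some t := by
  obtain ⟨a, ha⟩ := Option.ne_none_iff_exists'.1 (mt hd_eq_none.1 (inv_ne_one.2 h))
  obtain ⟨g', h1, h2, -⟩ := exists_of_hd ha
  refine ⟨g'⁻¹, bar a, ?_, by simpa using h2⟩
  rw [lt_bar, ← mul_inv_rev, ← h1, inv_inv]

theorem AI_Cyl (v : FreeGroup α) : AI (Cyl v) := by
  by_cases h : v = 1
  · rw [h, Cyl_one]; intro t; simp
  · obtain ⟨u, t, rfl, h2⟩ := exists_eq_mul_lt h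
    rw [Cyl_mul_lt h2]; exact AI_St _ _

theorem norm_mul_lt {v : FreeGroup α} {s : α × Bool} (h : hd v⁻¹ ≠ some s) :
    (v * lt s).norm = v.norm + 1 := by
  rw [FreeGroup.norm, toWord_mul_of_ne (by simpa using h)]
  simp [FreeGroup.norm]

theorem mul_lt_mem_Cyl {v : FreeGroup α} {s : α × Bool} (h : hd v⁻¹ ≠ some s) :
    v * lt s ∈ Cyl v := by
  unfold Cyl
  rw [Set.mem_ofPred_eq, toWord_mul_of_ne (by simpa using h)]
  simp

/-- A set which is locally constant on a cylinder is constant on it. -/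
theorem const_on_Cyl {U : Set (FreeGroup α)} {v : FreeGroup α}
    (h : ∀ g ∈ Cyl v, ∀ s, g ∈ U ↔ g * lt s ∈ U) : ∀ g ∈ Cyl v, g ∈ U ↔ v ∈ U := by
  have key : ∀ n : ℕ, ∀ g ∈ Cyl v, g.norm = v.norm + n → (g ∈ U ↔ v ∈ U) := by
    intro n
    induction n with
    | zero =>
      rintro g hg hn
      have := List.IsPrefix.eq_of_length hg hn.symm
      rw [toWord_injective this]
    | succ n ih =>
      intro g hg hn
      have hg1 : g ≠ 1 := by rintro rfl; simp at hn
      obtain ⟨u, t, rfl, h2⟩ := exists_eq_mul_lt hg1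
      rw [norm_mul_lt h2] at hn
      have hu : u ∈ Cyl v := by
        have h3 : u ∈ {g | toWord v <+: toWord g} := by
          have h4 : toWord v <+: toWord (u * lt t) := hg
          rw [toWord_mul_of_ne (by simpa using h2), toWord_lt] at h4
          rcases List.prefix_concat_iff.1 h4 with h5 | h5
          · have := congrArg List.length h5
            rw [List.length_append] at this
            simp only [FreeGroup.norm, List.length_singleton] at hn this
            lia
          · exact h5
        exact h3
      rw [← h u hu t]
      exact ih u hu (by lia)
  intro g hg
  have hl : v.norm ≤ g.norm := List.IsPrefix.length_le hg
  exact key (g.norm - v.norm) g hg (by lia)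

end Cylinders

section Bichromatic
variable {α : Type*} [DecidableEq α]

/-- Vertices whose cylinder meets both `U` and its complement in infinite sets. -/
def Bi (U : Set (FreeGroup α)) : Set (FreeGroup α) :=
  {v | (U ∩ Cyl v).Infinite ∧ (Uᶜ ∩ Cyl v).Infinite}

theorem Bi_compl (U : Set (FreeGroup α)) : Bi Uᶜ = Bi U := by
  ext v; simp [Bi, and_comm]

theorem Bi_finite [Finite α] {U : Set (FreeGroup α)} (hU : AI U) : (Bi U).Finite := by
  have h1 : (⋃ s : α × Bool, {g | ¬ (g ∈ U ↔ g * lt s ∈ U)}).Finite :=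
    Set.finite_iUnion fun s => hU _
  have h2 : ∀ g : FreeGroup α, {v | g ∈ Cyl v}.Finite := by
    intro g
    have : {v : FreeGroup α | g ∈ Cyl v} ⊆ toWord ⁻¹' {L | L ∈ (toWord g).inits} := by
      intro v hv
      have h : toWord v <+: toWord g := hv
      simpa using h
    exact ((List.finite_toSet _).preimage toWord_injective.injOn).subset this
  refine (h1.biUnion fun g _ => h2 g).subset ?_
  rintro v ⟨hv1, hv2⟩
  by_contra hc
  simp only [Set.mem_iUnion, Set.mem_ofPred_eq, not_exists, exists_prop, not_and,
    forall_exists_index] at hc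
  have := const_on_Cyl (U := U) (v := v) (fun g hg s => by
    by_contra h; exact hc g s h hg)
  obtain ⟨g, hg1, hg2⟩ := hv1.nonempty
  obtain ⟨g', hg1', hg2'⟩ := hv2.nonempty
  exact hg1' ((this g' hg2').2 ((this g hg2).1 hg1))

variable [Fintype α]

/-- The outgoing directions at `v`. -/
def dirs (v : FreeGroup α) : Finset (α × Bool) := Finset.univ.filter fun s => hd v⁻¹ ≠ some s

theorem card_dirs (v : FreeGroup α) : 2 * Fintype.card α - 1 ≤ (dirs v).card := by
  have h : (dirs v)ᶜ.card ≤ 1 := by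
    rw [Finset.card_le_one]
    intro a ha b hb
    simp [dirs] at ha hb
    rw [ha] at hb; simpa using hb
  have := Finset.card_compl (dirs v)
  simp [Fintype.card_prod] at this
  lia

theorem card_dirs_of_ne {v : FreeGroup α} (hv : v ≠ 1) :
    (dirs v).card = 2 * Fintype.card α - 1 := by
  refine le_antisymm ?_ (card_dirs v)
  obtain ⟨a, ha⟩ := Option.ne_none_iff_exists'.1 (mt hd_eq_none.1 (inv_ne_one.2 hv))
  have : (dirs v) ⊆ Finset.univ.erase a := by
    intro s hs
    simp only [dirs, Finset.mem_filter, ha] at hs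
    simp only [Finset.mem_erase, Finset.mem_univ, and_true]
    rintro rfl; exact hs.2 rfl
  have := Finset.card_le_card this
  rw [Finset.card_erase_of_mem (Finset.mem_univ _)] at this
  simp [Fintype.card_prod] at this
  lia

theorem mem_Cyl_cases {v g : FreeGroup α} (h : g ∈ Cyl v) :
    g = v ∨ ∃ s ∈ dirs v, hd (v⁻¹ * g) = some s := by
  by_cases hgv : g = v
  · exact Or.inl hgv
  · right
    have h1 := (mem_Cyl_iff.1 h).resolve_left hgv
    have h2 : v⁻¹ * g ≠ 1 := by rw [Ne, inv_mul_eq_one]; exact fun h => hgv h.symm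
    obtain ⟨a, ha⟩ := Option.ne_none_iff_exists'.1 (mt hd_eq_none.1 h2)
    rw [ha] at h1
    exact ⟨a, by simp [dirs, h1], ha⟩

/-- At a maximal bichromatic vertex `v`, the set `U` is, inside the cylinder of `v`, a union
of half-trees at `v`. -/
theorem exists_star {U : Set (FreeGroup α)} {v : FreeGroup α} (hv : v ∈ Bi U)
    (hmax : ∀ w ∈ Bi U, w.norm ≤ v.norm) :
    ∃ J J' : Finset (α × Bool), J ∪ J' = dirs v ∧ Disjoint J J' ∧ J.Nonempty ∧ J'.Nonempty ∧
      Alm (U ∩ Cyl v) (St v J) ∧ Alm (Uᶜ ∩ Cyl v) (St v J') := by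
  classical
  let J := (dirs v).filter fun s => (U ∩ St v {s}).Infinite
  let J' := (dirs v).filter fun s => ¬ (U ∩ St v {s}).Infinite
  have hd' : ∀ s ∈ dirs v, hd v⁻¹ ≠ some s := fun s hs => by simpa [dirs] using hs
  have hchild : ∀ s ∈ dirs v, (U ∩ St v {s}).Infinite → (Uᶜ ∩ St v {s}).Finite := by
    intro s hs h1
    by_contra h2
    have : v * lt s ∈ Bi U := by
      unfold Bi
      rw [Set.mem_ofPred_eq, Cyl_mul_lt (hd' s hs)]
      exact ⟨h1, h2⟩
    have := hmax _ this
    rw [norm_mul_lt (hd' s hs)] at this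
    lia
  have hfJ : (⋃ s ∈ J, Uᶜ ∩ St v {s}).Finite := by
    refine J.finite_toSet.biUnion fun s hs => ?_
    have := Finset.mem_filter.1 (Finset.mem_coe.1 hs)
    exact hchild s this.1 this.2
  have hfJ' : (⋃ s ∈ J', U ∩ St v {s}).Finite := by
    refine J'.finite_toSet.biUnion fun s hs => ?_
    have := Finset.mem_filter.1 (Finset.mem_coe.1 hs)
    exact Set.not_infinite.1 this.2
  have hSt : ∀ s ∈ dirs v, St v {s} ⊆ Cyl v := by
    intro s hs
    rw [← Cyl_mul_lt (hd' s hs)]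
    exact Cyl_subset (mul_lt_mem_Cyl (hd' s hs))
  have huni : J ∪ J' = dirs v := Finset.filter_union_filter_not_eq _ _
  have hA1 : Alm (U ∩ Cyl v) (St v J) := by
    refine ((hfJ.union hfJ').union (Set.finite_singleton v)).subset fun g hg => ?_
    by_contra hc
    simp only [Set.mem_union, Set.mem_iUnion, Set.mem_inter_iff, mem_St_singleton,
      Set.mem_singleton_iff, not_or, not_exists, not_and, exists_prop] at hc
    apply hg
    constructor
    · rintro ⟨h1, h2⟩
      rcases mem_Cyl_cases h2 with h3 | ⟨s, hs, h3⟩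
      · exact absurd h3 hc.2
      · rw [← huni, Finset.mem_union] at hs
        rcases hs with hs | hs
        · exact ⟨s, hs, h3⟩
        · exact absurd h3 (hc.1.2 s hs h1)
    · rintro ⟨s, hs, h3⟩
      refine ⟨?_, hSt s (Finset.mem_filter.1 hs).1 (mem_St_singleton.2 h3)⟩
      by_contra h4
      exact hc.1.1 s hs h4 h3
  have hA2 : Alm (Uᶜ ∩ Cyl v) (St v J') := by
    refine ((hfJ.union hfJ').union (Set.finite_singleton v)).subset fun g hg => ?_
    by_contra hc
    simp only [Set.mem_union, Set.mem_iUnion, Set.mem_inter_iff, mem_St_singleton,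
      Set.mem_singleton_iff, not_or, not_exists, not_and, exists_prop] at hc
    apply hg
    constructor
    · rintro ⟨h1, h2⟩
      rcases mem_Cyl_cases h2 with h3 | ⟨s, hs, h3⟩
      · exact absurd h3 hc.2
      · rw [← huni, Finset.mem_union] at hs
        rcases hs with hs | hs
        · exact absurd h3 (hc.1.1 s hs h1)
        · exact ⟨s, hs, h3⟩
    · rintro ⟨s, hs, h3⟩
      refine ⟨?_, hSt s (Finset.mem_filter.1 hs).1 (mem_St_singleton.2 h3)⟩
      intro h4
      exact hc.1.2 s hs h4 h3
  have hne : ∀ {V : Set (FreeGroup α)} {I : Finset (α × Bool)}, V.Infinite → Alm V (St v I) →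
      I.Nonempty := by
    intro V I hV hA
    by_contra hI
    rw [Finset.not_nonempty_iff_eq_empty] at hI
    subst hI
    apply hV
    refine hA.subset fun g hg => ?_
    simp [St, hg]
  exact ⟨J, J', huni, Finset.disjoint_filter_filter_not _ _ _, hne hv.1 hA1, hne hv.2 hA2, hA1,
    hA2⟩

end Bichromatic

section Cut
variable {α : Type*} [DecidableEq α] [Fintype α]

/-- Half-trees, up to finite sets. -/
def IsHalf (U : Set (FreeGroup α)) : Prop := ∃ v s, Alm U (St v {s})

omit [Fintype α] in
theorem IsHalf.of_compl {U : Set (FreeGroup α)} (h : IsHalf Uᶜ) : IsHalf U := by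
  obtain ⟨v, s, h⟩ := h
  have := h.compl
  rw [compl_compl, St_compl_singleton] at this
  exact ⟨_, _, this⟩

omit [Fintype α] in
theorem crossing_St_eq (x v : FreeGroup α) (J : Finset (α × Bool)) :
    crossing x (St v J) = crossing x (St 1 J) := by
  rw [St_eq_preimage, crossing_translate]

/-- If all two-sided star cuts are at least `gap` while the single half-trees lie between `lo`
and `hi`, then every nontrivial almost invariant set which is not a half-tree is a large cut. -/
theorem isHalf_or_le_crossing {x : FreeGroup α} (hx : x ≠ 1) (hα : 2 ≤ Fintype.card α)
    {lo hi gap T : ℕ}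
    (hlo : ∀ s, (lo : ℕ∞) ≤ crossing x (St 1 {s}))
    (hhi : ∀ s, crossing x (St 1 {s}) ≤ (hi : ℕ∞))
    (hgap : ∀ J : Finset (α × Bool), 2 ≤ J.card → J.card + 2 ≤ 2 * Fintype.card α →
      (gap : ℕ∞) ≤ crossing x (St 1 J))
    (hT : T + hi ≤ gap + lo) (hT' : T ≤ gap) (hT'' : lo ≤ T)
    (U : Set (FreeGroup α)) (hU : AI U) (h1 : U.Infinite) (h2 : Uᶜ.Infinite) :
    IsHalf U ∨ (T : ℕ∞) ≤ crossing x U := by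
  induction hn : (Bi U).ncard using Nat.strong_induction_on generalizing U with
  | _ n ih =>
  subst hn
  have hone : (1 : FreeGroup α) ∈ Bi U := by simpa [Bi, Cyl_one] using ⟨h1, h2⟩
  obtain ⟨v, hv, hmax⟩ := Set.exists_max_image (Bi U) FreeGroup.norm (Bi_finite hU) ⟨1, hone⟩
  obtain ⟨J, J', hJJ, hdis, hJ, hJ', hA, hA'⟩ := exists_star hv hmax
  have hcard := Finset.card_union_of_disjoint hdis
  rw [hJJ] at hcard
  have hJc := hJ.card_pos
  have hJc' := hJ'.card_pos
  have hbig : ∀ I : Finset (α × Bool), 2 ≤ I.card → I.card + 2 ≤ 2 * Fintype.card α →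
      (T : ℕ∞) ≤ crossing x (St v I) := by
    intro I hI hI'
    rw [crossing_St_eq]
    exact le_trans (by exact_mod_cast hT') (hgap I hI hI')
  by_cases hv1 : v = 1
  · subst hv1
    have hc : (dirs (1 : FreeGroup α)).card = 2 * Fintype.card α := by
      simp [dirs, Fintype.card_prod, mul_comm]
    simp only [Cyl_one, Set.inter_univ] at hA hA'
    by_cases hJ1 : J.card = 1
    · obtain ⟨s, rfl⟩ := Finset.card_eq_one.1 hJ1
      exact Or.inl ⟨1, s, hA⟩
    by_cases hJ1' : J'.card = 1
    · obtain ⟨s, rfl⟩ := Finset.card_eq_one.1 hJ1'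
      exact Or.inl (IsHalf.of_compl ⟨1, s, hA'⟩)
    right
    rw [hA.crossing_eq hx]
    exact hbig J (by lia) (by lia)
  · have hc := card_dirs_of_ne hv1
    -- the argument is symmetric in `U` and its complement
    have main : ∀ (U : Set (FreeGroup α)) (J J' : Finset (α × Bool)), AI U → v ∈ Bi U →
        Alm (U ∩ Cyl v) (St v J) → Alm (Uᶜ ∩ Cyl v) (St v J') → 2 ≤ J.card → 1 ≤ J'.card →
        J.card + J'.card = 2 * Fintype.card α - 1 →
        (∀ W : Set (FreeGroup α), AI W → W.Infinite → Wᶜ.Infinite → (Bi W).ncard < (Bi U).ncard →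
          IsHalf W ∨ (T : ℕ∞) ≤ crossing x W) → IsHalf U ∨ (T : ℕ∞) ≤ crossing x U := by
      clear ih hA hA' hJJ hdis hJ hJ' hJc hJc' hmax hv hone hcard h1 h2 hU U J J'
      intro U J J' hU hv hA hA' hJ hJ' hcard ih
      by_cases hfin : (U ∪ Cyl v)ᶜ.Infinite
      · have hsub : Bi (U ∪ Cyl v) ⊂ Bi U := by
          refine ⟨?_, fun h => ?_⟩
          · rintro w ⟨hw1, hw2⟩
            refine ⟨fun hf => ?_, hw2.mono ?_⟩
            · have h3 : (Cyl v ∩ Cyl w).Infinite := by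
                intro h4
                apply hw1
                rw [Set.union_inter_distrib_right]
                exact hf.union h4
              obtain ⟨g, hg1, hg2⟩ := h3.nonempty
              rcases Cyl_nested hg1 hg2 with h5 | h5
              · exact hv.1 (hf.subset (Set.inter_subset_inter_right _ h5))
              · obtain ⟨g, hg, hg'⟩ := hw2.nonempty
                exact hg (Or.inr (h5 hg'))
            · exact Set.inter_subset_inter_left _ (by
                rw [Set.compl_union]; exact Set.inter_subset_left)
          · have := h hv
            obtain ⟨g, hg, hg'⟩ := this.2.nonempty
            exact hg (Or.inr hg')
        have hI := ih _ (hU.union (AI_Cyl v)) (hv.1.mono (Set.inter_subset_left.trans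
          Set.subset_union_left)) hfin (Set.ncard_lt_ncard hsub (Bi_finite hU))
        have hI' : (lo : ℕ∞) ≤ crossing x (U ∪ Cyl v) := by
          rcases hI with ⟨w, s, h⟩ | h
          · rw [h.crossing_eq hx, crossing_St_eq]; exact hlo s
          · exact le_trans (by exact_mod_cast hT'') h
        have hsm := crossing_submodular hx hU (AI_Cyl v)
        rw [hA.crossing_eq hx, crossing_St_eq] at hsm
        obtain ⟨u, t, rfl, hut⟩ := exists_eq_mul_lt hv1
        have hV : crossing x (Cyl (u * lt t)) ≤ hi := by
          rw [Cyl_mul_lt hut, crossing_St_eq]; exact hhi t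
        right
        have hg := hgap J hJ (by lia)
        have : (T : ℕ∞) + hi ≤ crossing x U + hi :=
          calc (T : ℕ∞) + hi ≤ gap + lo := by exact_mod_cast hT
            _ = lo + gap := add_comm _ _
            _ ≤ _ := add_le_add hI' hg
            _ ≤ _ := hsm
            _ ≤ _ := add_le_add le_rfl hV
        exact (ENat.add_le_add_iff_right (ENat.natCast_ne_top hi)).1 this
      · have hA2 : Alm Uᶜ (St v J') := by
          refine Alm.trans ?_ hA'
          refine (Set.not_infinite.1 hfin).subset fun g hg => ?_
          simp only [Set.mem_ofPred_eq, Set.mem_inter_iff, Set.mem_compl_iff, Set.mem_union] at *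
          tauto
        by_cases hJ1' : J'.card = 1
        · obtain ⟨s, rfl⟩ := Finset.card_eq_one.1 hJ1'
          exact Or.inl (IsHalf.of_compl ⟨v, s, hA2⟩)
        · right
          rw [← crossing_compl hx hU, hA2.crossing_eq hx]
          exact hbig J' (by lia) (by lia)
    by_cases hJ2 : 2 ≤ J.card
    · exact main U J J' hU hv hA hA' hJ2 hJc' (by lia) fun W hW h3 h4 h5 => ih _ h5 W hW h3 h4 rfl
    · have := main Uᶜ J' J hU.compl (by rwa [Bi_compl]) hA' (by rwa [compl_compl]) (by lia) hJc
        (by lia) (fun W hW h3 h4 h5 => ih _ (by rwa [Bi_compl] at h5) W hW h3 h4 rfl)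
      rw [crossing_compl hx hU] at this
      refine this.imp (fun h => IsHalf.of_compl h) id

end Cut

section HalfTrees
variable {α : Type*} [DecidableEq α]

theorem St_singleton_infinite (v : FreeGroup α) (s : α × Bool) : (St v {s}).Infinite := by
  have hw : ∀ n : ℕ, toWord (mk (List.replicate (n + 1) s)) = List.replicate (n + 1) s := fun n => by
    rw [toWord_mk, FreeGroup.IsReduced.reduce_eq]
    rw [isReduced_iff]
    exact List.isChain_replicate_of_rel _ (bar_ne s).symm
  refine Set.infinite_of_injective_forall_mem
    (f := fun n : ℕ => v * mk (List.replicate (n + 1) s)) ?_ ?_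
  · intro m n h
    have := congrArg (fun g => (toWord g).length) (mul_left_cancel h)
    simpa only [hw, List.length_replicate, Nat.add_right_cancel_iff] using this
  · intro n
    rw [mem_St_singleton, inv_mul_cancel_left, hd, hw]
    rfl

/-- Two distinct vertices of the Cayley tree determine nested families of half-trees. -/
theorem exists_nested {v v' : FreeGroup α} (h : v ≠ v') : ∃ a b : α × Bool,
    (∀ c ≠ b, St v' {c} ⊆ St v {a}) ∧ ∀ c ≠ a, St v {c} ⊆ St v' {b} := by
  have key : ∀ v v' : FreeGroup α, v ≠ v' → ∀ a b, hd (v⁻¹ * v') = some a →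
      hd (v'⁻¹ * v) = some b → ∀ c ≠ b, St v' {c} ⊆ St v {a} := by
    intro v v' h a b ha hb c hc g hg
    rw [mem_St_singleton] at hg ⊢
    have : v⁻¹ * g = (v⁻¹ * v') * (v'⁻¹ * g) := by group
    rw [this, hd_mul_of_ne _ (by simpa [inv_mul_eq_one] using h), ha]
    rw [mul_inv_rev, inv_inv, hb, hg]
    simpa using hc.symm
  obtain ⟨a, ha⟩ : ∃ a, hd (v⁻¹ * v') = some a := by
    rw [← Option.ne_none_iff_exists', Ne, hd_eq_none, inv_mul_eq_one]; exact h
  obtain ⟨b, hb⟩ : ∃ a, hd (v'⁻¹ * v) = some a := by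
    rw [← Option.ne_none_iff_exists', Ne, hd_eq_none, inv_mul_eq_one]; exact h.symm
  exact ⟨a, b, key v v' h a b ha hb, key v' v h.symm b a hb ha⟩

omit [DecidableEq α] in
theorem Alm.sub {U V : Set (FreeGroup α)} (h : Alm U V) : (U \ V).Finite :=
  h.subset fun g hg => by
    have := hg.1; have := hg.2; simp only [Set.mem_ofPred_eq]; tauto

omit [DecidableEq α] in
theorem Alm.of_sub {U V : Set (FreeGroup α)} (h : (U \ V).Finite) (h' : (V \ U).Finite) : Alm U V :=
  (h.union h').subset fun g hg => by
    simp only [Set.mem_ofPred_eq, Set.mem_union, Set.mem_sdiff] at *; tauto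

omit [DecidableEq α] in
theorem sub_trans {U V W : Set (FreeGroup α)} (h : (U \ V).Finite) (h' : (V \ W).Finite) :
    (U \ W).Finite :=
  (h.union h').subset fun g hg => by
    simp only [Set.mem_union, Set.mem_sdiff] at *; tauto

/-- A half-tree is not almost contained in another one with the same root. -/
theorem eq_of_sub {v : FreeGroup α} {a b : α × Bool} (h : (St v {a} \ St v {b}).Finite) : a = b := by
  by_contra hab
  have := St_disjoint (v := v) (I := {a}) (J := {b}) (by simpa using hab)
  rw [sdiff_eq_left.2 this] at h
  exact St_singleton_infinite v a h

theorem exists_third [Fintype α] (hα : 2 ≤ Fintype.card α) (a b : α × Bool) :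
    ∃ c, c ≠ a ∧ c ≠ b := by
  have : ((({a, b} : Finset (α × Bool)))ᶜ).Nonempty := by
    rw [← Finset.card_pos, Finset.card_compl]
    have := Finset.card_le_two (a := a) (b := b)
    simp [Fintype.card_prod]; lia
  obtain ⟨c, hc⟩ := this
  exact ⟨c, by simpa using hc⟩

theorem Alm.half_unique [Fintype α] (hα : 2 ≤ Fintype.card α) {v v' : FreeGroup α} {s s' : α × Bool}
    (h : Alm (St v {s}) (St v' {s'})) : v = v' ∧ s = s' := by
  have hv : v = v' := by
    by_contra hv
    obtain ⟨a, b, h1, h2⟩ := exists_nested hv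
    by_cases hb : s' = b
    · subst hb
      obtain ⟨c, hc, hc'⟩ := exists_third hα a s
      refine hc' (eq_of_sub (v := v) (sub_trans (?_ : (_ \ St v' {s'}).Finite) h.symm.sub))
      rw [Set.sdiff_eq_empty.2 (h2 c hc)]; exact Set.finite_empty
    · have hs : s = a := by
        refine eq_of_sub (v := v) (sub_trans h.sub ?_)
        rw [Set.sdiff_eq_empty.2 (h1 s' hb)]; exact Set.finite_empty
      obtain ⟨c, hc, hc'⟩ := exists_third hα b s'
      refine hc' (eq_of_sub (v := v') (sub_trans (?_ : (_ \ St v {s}).Finite) h.sub))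
      rw [hs, Set.sdiff_eq_empty.2 (h1 c hc)]; exact Set.finite_empty
  subst hv
  exact ⟨rfl, eq_of_sub h.sub⟩

omit [DecidableEq α] in
theorem Alm.translate {U V : Set (FreeGroup α)} (h : Alm U V) (v : FreeGroup α) :
    Alm ((fun g => v * g) ⁻¹' U) ((fun g => v * g) ⁻¹' V) :=
  h.preimage fun _ _ _ _ hxy => mul_left_cancel hxy

/-- Half-trees which almost partition the group and are pairwise almost disjoint have a common
root as soon as there are as many of them as letters. -/
theorem common_root [Fintype α] (hα : 2 ≤ Fintype.card α) {u : α × Bool → FreeGroup α}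
    {t : α × Bool → α × Bool} {U : α × Bool → Set (FreeGroup α)}
    (hU : ∀ s, Alm (U s) (St (u s) {t s})) (hdisj : ∀ s s', s ≠ s' → Disjoint (U s) (U s'))
    (hcov : ∀ g, g ≠ 1 → ∃ s, g ∈ U s) (s₀ s : α × Bool) : u s = u s₀ := by
  have hinf : ∀ s, (U s).Infinite := fun s hs => by
    have := (hU s).symm.sub
    exact St_singleton_infinite (u s) (t s) ((this.union hs).subset fun g hg => by
      simp only [Set.mem_union, Set.mem_sdiff]; tauto)
  set v := u s₀
  have hsub : ∀ s, ∃ c, (U s \ St v {c}).Finite := by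
    intro s
    by_cases hv : v = u s
    · exact ⟨t s, hv ▸ (hU s).sub⟩
    obtain ⟨a, b, h1, h2⟩ := exists_nested hv
    by_cases hb : t s = b
    · exfalso
      subst hb
      have hs0 : s ≠ s₀ := fun h => hv (by rw [h])
      have hta : t s₀ = a := by
        by_contra hta
        have h3 : (U s₀ \ U s).Finite :=
          sub_trans (hU s₀).sub (sub_trans (by
            rw [Set.sdiff_eq_empty.2 (h2 _ hta)]; exact Set.finite_empty) (hU s).symm.sub)
        rw [sdiff_eq_left.2 (hdisj _ _ hs0.symm)] at h3
        exact hinf _ h3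
      obtain ⟨s', hs', hs''⟩ := exists_third hα s s₀
      have h3 : (U s')ᶜ ⊇ U s ∪ U s₀ := by
        rintro g (hg | hg)
        · exact Set.disjoint_left.1 (hdisj s s' hs'.symm) hg
        · exact Set.disjoint_left.1 (hdisj s₀ s' hs''.symm) hg
      refine hinf s' ((((hU s).symm.sub.union (hU s₀).symm.sub).union (Set.finite_singleton v)).subset
        fun g hg => ?_)
      have hg1 : g ∉ U s := fun h => h3 (Or.inl h) hg
      have hg2 : g ∉ U s₀ := fun h => h3 (Or.inr h) hg
      by_cases hgv : g = v
      · exact Or.inr hgv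
      left
      obtain ⟨c, hc⟩ : ∃ c, hd (v⁻¹ * g) = some c := by
        rw [← Option.ne_none_iff_exists', Ne, hd_eq_none, inv_mul_eq_one]; exact fun h => hgv h.symm
      by_cases hca : c = a
      · right
        refine ⟨?_, hg2⟩
        rw [mem_St_singleton, hta, ← hca]; exact hc
      · left
        exact ⟨h2 c hca (mem_St_singleton.2 hc), hg1⟩
    · refine ⟨a, sub_trans (hU s).sub ?_⟩
      rw [Set.sdiff_eq_empty.2 (h1 _ hb)]; exact Set.finite_empty
  choose π hπ using hsub
  have hfin : (⋃ s, (U s \ St v {π s})).Finite := Set.finite_iUnion hπ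
  have hsurj : Function.Surjective π := by
    intro c
    by_contra hc
    push Not at hc
    refine St_singleton_infinite v c ((hfin.union (Set.finite_singleton 1)).subset fun g hg => ?_)
    by_cases hg1 : g = 1
    · exact Or.inr hg1
    left
    obtain ⟨s, hs⟩ := hcov g hg1
    refine Set.mem_iUnion.2 ⟨s, hs, fun h => hc s ?_⟩
    rw [mem_St_singleton] at h hg
    rw [h] at hg; simpa using hg
  have hinj : Function.Injective π := Finite.injective_iff_surjective.2 hsurj
  have h4 : Alm (U s) (St v {π s}) := by
    refine Alm.of_sub (hπ s) ((hfin.union (Set.finite_singleton 1)).subset ?_)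
    rintro g ⟨hg, hg'⟩
    by_cases hg1 : g = 1
    · exact Or.inr hg1
    left
    obtain ⟨s', hs'⟩ := hcov g hg1
    refine Set.mem_iUnion.2 ⟨s', hs', fun h => ?_⟩
    rw [mem_St_singleton] at h hg
    rw [h] at hg
    have := hinj (Option.some.inj hg)
    exact hg' (this ▸ hs')
  exact (((hU s).symm.trans h4).half_unique hα).1

/-- An automorphism carrying half-trees to half-trees is a signed permutation of the basis
followed by an inner automorphism. -/
theorem exists_conj_perm [Fintype α] (hα : 2 ≤ Fintype.card α) (e : FreeGroup α ≃* FreeGroup α)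
    (h : ∀ s, IsHalf (e ⁻¹' St 1 {s})) :
    ∃ (u : FreeGroup α) (σ : Equiv.Perm (α × Bool)), (∀ a, σ (bar a) = bar (σ a)) ∧
      ∀ a, e (lt a) = u * lt (σ a) * u⁻¹ := by
  choose u t hut using h
  have hmem : ∀ s g, g ∈ e ⁻¹' St 1 {s} ↔ hd (e g) = some s := fun s g => by
    rw [Set.mem_preimage, mem_St_singleton]; simp
  have hu : ∀ s s', u s = u s' := fun s s' => by
    refine common_root hα hut ?_ ?_ s' s
    · intro s s' hs
      exact (St_disjoint (by simpa using hs)).preimage _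
    · intro g hg
      obtain ⟨c, hc⟩ : ∃ c, hd (e g) = some c := by
        rw [← Option.ne_none_iff_exists', Ne, hd_eq_none]; simpa using hg
      exact ⟨c, (hmem _ _).2 hc⟩
  obtain ⟨i⟩ : Nonempty α := Fintype.card_pos_iff.1 (by lia)
  obtain ⟨v, hv⟩ : ∃ v, ∀ s, u s = v := ⟨u (i, true), fun s => hu _ _⟩
  have h2 : ∀ s, v * lt (t s) = e.symm (lt s) * v ∧ bar (t s) = t (bar s) := by
    intro s
    have h3 := (hut s).compl
    rw [St_compl_singleton, hv] at h3
    have h4 := (hut (bar s)).translate (e.symm (lt s))⁻¹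
    rw [hv] at h4
    have h5 : (fun g => (e.symm (lt s))⁻¹ * g) ⁻¹' (e ⁻¹' St 1 {bar s}) = (e ⁻¹' St 1 {s})ᶜ := by
      ext g
      rw [Set.mem_preimage, hmem, Set.mem_compl_iff, hmem, _root_.map_mul, _root_.map_inv,
        MulEquiv.apply_symm_apply, hd_inv_lt_mul_iff]
    rw [h5] at h4
    have h6 : (fun g => (e.symm (lt s))⁻¹ * g) ⁻¹' St v {t (bar s)} =
        St (e.symm (lt s) * v) {t (bar s)} := by
      ext g
      rw [Set.mem_preimage, mem_St_singleton, mem_St_singleton, mul_inv_rev, mul_assoc]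
    rw [h6] at h4
    exact (h3.symm.trans h4).half_unique hα
  have ht : Function.Injective t := by
    intro s s' hs
    have h3 := (h2 s).1
    rw [hs, (h2 s').1] at h3
    exact (lt_injective (e.symm.injective (mul_right_cancel h3))).symm
  set τ := Equiv.ofBijective t (Finite.injective_iff_bijective.1 ht)
  have hτ : ∀ a, t (τ.symm a) = a := fun a => τ.apply_symm_apply a
  refine ⟨(e v)⁻¹, τ.symm, ?_, ?_⟩
  · intro a
    apply τ.injective
    rw [Equiv.apply_symm_apply]
    change bar a = t (bar (τ.symm a))
    rw [← (h2 _).2, hτ]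
  · intro a
    have h3 := congrArg e (h2 (τ.symm a)).1
    rw [hτ, _root_.map_mul, _root_.map_mul, MulEquiv.apply_symm_apply] at h3
    rw [inv_inv, mul_assoc, ← h3, inv_mul_cancel_left]

end HalfTrees

section Whitehead
variable {α : Type*} [DecidableEq α] [Fintype α]

/-- The asymptotic frequency of crossings of a star with directions `J`. -/
def freq (J : Finset (α × Bool)) : ℝ :=
  J.card * (2 * Fintype.card α - J.card) / (Fintype.card α * (2 * Fintype.card α - 1))

/-- The crossing numbers of `x` with stars are close to those of a random word. -/
def Balanced (x : FreeGroup α) (N : ℕ) : Prop :=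
  0 < N ∧ ∀ J : Finset (α × Bool), ∃ m : ℕ, crossing x (St 1 J) = m ∧
    |(m : ℝ) - freq J * N| ≤ N / (100 * Fintype.card α)

omit [DecidableEq α] in
theorem freq_singleton (hα : 2 ≤ Fintype.card α) (s : α × Bool) :
    freq {s} = 1 / (Fintype.card α : ℝ) := by
  have : (2 : ℝ) ≤ Fintype.card α := by exact_mod_cast hα
  unfold freq
  rw [Finset.card_singleton]
  have h2 : (2 * (Fintype.card α : ℝ) - 1) ≠ 0 := by linarith
  field_simp
  simp

omit [DecidableEq α] in
theorem le_freq (hα : 2 ≤ Fintype.card α) {J : Finset (α × Bool)} (h1 : 2 ≤ J.card)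
    (h2 : J.card + 2 ≤ 2 * Fintype.card α) : (4 / 3) / (Fintype.card α : ℝ) ≤ freq J := by
  have h0 : (2 : ℝ) ≤ Fintype.card α := by exact_mod_cast hα
  have h1' : (2 : ℝ) ≤ J.card := by exact_mod_cast h1
  have h2' : (J.card : ℝ) + 2 ≤ 2 * Fintype.card α := by exact_mod_cast h2
  unfold freq
  rw [div_le_div_iff₀ (by positivity) (by nlinarith)]
  have : 4 * ((Fintype.card α : ℝ) - 1) ≤ J.card * (2 * Fintype.card α - J.card) := by nlinarith
  nlinarith

theorem Balanced.dichotomy (hα : 2 ≤ Fintype.card α) {x : FreeGroup α} {N : ℕ} (hx : x ≠ 1)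
    (h : Balanced x N) {U : Set (FreeGroup α)} (hU : AI U) (hi : U.Infinite) (hi' : Uᶜ.Infinite)
    {m : ℕ} (hm : crossing x U = m) :
    (IsHalf U ∧ (1 - 1 / 100) * (N / Fintype.card α) ≤ (m : ℝ)) ∨
      (4 / 3 - 3 / 100) * (N / Fintype.card α) ≤ (m : ℝ) := by
  obtain ⟨hN, h⟩ := h
  set k : ℝ := (Fintype.card α : ℝ) with hk
  have hk2 : (2 : ℝ) ≤ k := by rw [hk]; exact_mod_cast hα
  set r : ℝ := N / k with hr
  have hr0 : 0 < r := by positivity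
  have e1 : (N : ℝ) / (100 * k) = r / 100 := by rw [hr]; field_simp
  rw [e1] at h
  have hs : ∀ s : α × Bool, ∃ m : ℕ, crossing x (St 1 {s}) = m ∧ |(m : ℝ) - r| ≤ r / 100 := by
    intro s
    obtain ⟨m, hm, hm'⟩ := h {s}
    refine ⟨m, hm, ?_⟩
    rwa [freq_singleton hα, ← hk, one_div_mul_eq_div] at hm'
  set lo := ⌈r - r / 100⌉₊
  set hh := ⌊r + r / 100⌋₊
  set gap := ⌈4 / 3 * r - r / 100⌉₊
  have hlo : ∀ s, (lo : ℕ∞) ≤ crossing x (St 1 {s}) := by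
    intro s
    obtain ⟨m, hm, hm'⟩ := hs s
    rw [hm, Nat.cast_le, Nat.ceil_le]
    linarith [(abs_le.1 hm').1]
  have hhi : ∀ s, crossing x (St 1 {s}) ≤ (hh : ℕ∞) := by
    intro s
    obtain ⟨m, hm, hm'⟩ := hs s
    rw [hm, Nat.cast_le]
    exact Nat.le_floor (by linarith [(abs_le.1 hm').2])
  have hgap : ∀ J : Finset (α × Bool), 2 ≤ J.card → J.card + 2 ≤ 2 * Fintype.card α →
      (gap : ℕ∞) ≤ crossing x (St 1 J) := by
    intro J h1 h2
    obtain ⟨m, hm, hm'⟩ := h J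
    rw [hm, Nat.cast_le, Nat.ceil_le]
    have := mul_le_mul_of_nonneg_right (le_freq hα h1 h2) (Nat.cast_nonneg N)
    rw [← hk, div_mul_eq_mul_div, mul_div_assoc, ← hr] at this
    linarith [(abs_le.1 hm').1]
  have hlh : lo ≤ hh := by
    obtain ⟨i⟩ : Nonempty α := Fintype.card_pos_iff.1 (by lia)
    exact_mod_cast (hlo (i, true)).trans (hhi (i, true))
  have f1 : (lo : ℝ) ≥ r - r / 100 := Nat.le_ceil _
  have f2 : (hh : ℝ) ≤ r + r / 100 := Nat.floor_le (by positivity)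
  have f3 : (gap : ℝ) ≥ 4 / 3 * r - r / 100 := Nat.le_ceil _
  have hhg : hh ≤ gap := by
    have : (hh : ℝ) ≤ gap := by linarith
    exact_mod_cast this
  rcases isHalf_or_le_crossing hx hα (lo := lo) (hi := hh) (gap := gap) (T := gap + lo - hh) hlo hhi
    hgap (by lia) (by lia) (by lia) U hU hi hi' with h5 | h5
  · left
    refine ⟨h5, ?_⟩
    obtain ⟨v, s, h6⟩ := h5
    have := hlo s
    rw [← crossing_St_eq x v, ← h6.crossing_eq hx, hm, Nat.cast_le] at this
    have : (lo : ℝ) ≤ m := by exact_mod_cast this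
    linarith
  · right
    rw [hm, Nat.cast_le] at h5
    have : (gap : ℝ) + lo ≤ m + hh := by exact_mod_cast (by lia : gap + lo ≤ m + hh)
    linarith

/-- If two elements related by an automorphism are both balanced, then the automorphism is a signed
permutation of the basis followed by an inner automorphism. -/
theorem Balanced.exists_conj_perm (hα : 2 ≤ Fintype.card α) {x : FreeGroup α} {N N' : ℕ}
    (e : FreeGroup α ≃* FreeGroup α) (hx : x ≠ 1)
    (h : Balanced x N) (h' : Balanced (e.symm x) N') :
    ∃ (u : FreeGroup α) (σ : Equiv.Perm (α × Bool)), (∀ a, σ (bar a) = bar (σ a)) ∧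
      ∀ a, e (lt a) = u * lt (σ a) * u⁻¹ := by
  have hx' : e.symm x ≠ 1 := by simpa using hx
  have hinf : ∀ (f : FreeGroup α ≃* FreeGroup α) s, (f ⁻¹' St 1 {s}).Infinite ∧
      (f ⁻¹' St 1 {s})ᶜ.Infinite := by
    intro f s
    have key : ∀ V : Set (FreeGroup α), V.Infinite → (f ⁻¹' V).Infinite := fun V hV hf => by
      have := hf.image f
      rw [Set.image_preimage_eq _ f.surjective] at this
      exact hV this
    refine ⟨key _ (St_singleton_infinite _ _), ?_⟩
    rw [← Set.preimage_compl, St_compl_singleton]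
    exact key _ (St_singleton_infinite _ _)
  have hkk : (2 : ℝ) ≤ Fintype.card α := by exact_mod_cast hα
  have up : ∀ {x : FreeGroup α} {N : ℕ}, Balanced x N → ∀ s, ∃ m : ℕ, crossing x (St 1 {s}) = m ∧
      (m : ℝ) ≤ (1 + 1 / 100) * (N / Fintype.card α) := by
    intro x N h s
    obtain ⟨m, hm, hm'⟩ := h.2 {s}
    refine ⟨m, hm, ?_⟩
    rw [freq_singleton hα] at hm'
    have := (abs_le.1 hm').2
    have e1 : (N : ℝ) / (100 * Fintype.card α) = 1 / 100 * (N / Fintype.card α) := by field_simp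
    rw [e1, one_div_mul_eq_div] at this
    linarith
  obtain ⟨i⟩ : Nonempty α := Fintype.card_pos_iff.1 (by lia)
  have hr : (0 : ℝ) < N / Fintype.card α := by
    have := h.1
    positivity
  refine AutMal.exists_conj_perm hα e fun s => ?_
  obtain ⟨m, hm, hm'⟩ := up h s
  obtain ⟨m1, hm1, hm1'⟩ := up h' (i, true)
  have c1 : crossing (e.symm x) (e ⁻¹' St 1 {s}) = m := by
    rw [crossing_map, MulEquiv.apply_symm_apply, hm]
  have c2 : crossing x (e.symm ⁻¹' St 1 {(i, true)}) = m1 := by rw [crossing_map, hm1]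
  rcases h'.dichotomy hα hx' ((AI_St _ _).preimage_equiv e) (hinf e s).1 (hinf e s).2 c1 with
    h1 | h1
  · exact h1.1
  · exfalso
    rcases h.dichotomy hα hx ((AI_St _ _).preimage_equiv e.symm) (hinf e.symm _).1
      (hinf e.symm _).2 c2 with h2 | h2
    · linarith [h2.2]
    · linarith

end Whitehead

section Axis

/-- Bi-infinite partial products. -/
theorem exists_int_prod {G : Type*} [Group G] (d : ℤ → G) :
    ∃ S : ℤ → G, S 0 = 1 ∧ ∀ j, S (j + 1) = S j * d j := by
  refine ⟨fun j => match j with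
    | Int.ofNat n => ((List.range n).map fun i : ℕ => d i).prod
    | Int.negSucc n => ((List.range (n + 1)).map fun i : ℕ => (d (-i - 1))⁻¹).prod, by simp, ?_⟩
  rintro (n | n)
  · have : Int.ofNat n + 1 = Int.ofNat (n + 1) := rfl
    rw [this]
    simp [List.range_succ]
  · rcases n with _ | n
    · simp
    · have : Int.negSucc (n + 1) + 1 = Int.negSucc n := by simp [Int.negSucc_eq]
      rw [this]
      simp only [List.range_succ (n := n + 1), List.map_append, List.map_cons, List.map_nil,
        List.prod_append, List.prod_cons, List.prod_nil, mul_one]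
      have h2 : (-((n + 1 : ℕ) : ℤ) - 1) = Int.negSucc (n + 1) := by
        simp [Int.negSucc_eq]; ring
      rw [h2, inv_mul_cancel_right]

theorem int_prod_add {G : Type*} [Group G] {d S : ℤ → G} {r : ℤ} (h0 : S 0 = 1)
    (hS : ∀ j, S (j + 1) = S j * d j) (hd : ∀ j, d (j + r) = d j) (j : ℤ) :
    S (j + r) = S r * S j := by
  induction j using Int.induction_on with
  | zero => simp [h0]
  | succ i ih => rw [add_right_comm, hS, hS, ih, hd, mul_assoc]
  | pred i ih =>
    have h1 := hS (-↑i - 1 + r)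
    have h2 := hS (-↑i - 1)
    rw [hd, show (-(i : ℤ) - 1 + r + 1) = -i + r by ring, ih] at h1
    rw [sub_add_cancel] at h2
    rw [h2, ← mul_assoc] at h1
    exact (mul_right_cancel h1).symm

variable {α : Type*} [DecidableEq α]

theorem exists_axis {z : FreeGroup α} (hz : z ≠ 1) :
    ∃ (V : ℤ → FreeGroup α) (a : ℤ → α × Bool) (r : ℕ), IsLine V a ∧ 0 < r ∧
      (∀ j, V (j + r) = z * V j) ∧ ∀ j, a (j + r) = a j := by
  set L := FreeGroup.reduceCyclically (toWord z) with hL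
  set q : FreeGroup α := FreeGroup.mk (FreeGroup.reduceCyclically.conjugator (toWord z)) with hq
  have hzq : z = q * FreeGroup.mk L * q⁻¹ := by
    conv_lhs => rw [← mk_toWord (x := z),
      ← FreeGroup.reduceCyclically.conj_conjugator_reduceCyclically (toWord z)]
    rw [← mul_mk, ← mul_mk, hq, inv_mk]
  have hcyc : FreeGroup.IsCyclicallyReduced L :=
    FreeGroup.reduceCyclically.isCyclicallyReduced isReduced_toWord
  have hLne : L ≠ [] := by
    intro h
    apply hz
    rw [hzq, h, ← one_eq_mk]; group
  set r := L.length with hr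
  have hr0 : 0 < r := List.length_pos_iff.2 hLne
  have hr0' : (0 : ℤ) < r := by exact_mod_cast hr0
  have hlt : ∀ j : ℤ, (j % r).toNat < L.length := fun j => by
    have := Int.emod_nonneg j hr0'.ne'
    have := Int.emod_lt_of_pos j hr0'
    lia
  set a : ℤ → α × Bool := fun j => L[(j % r).toNat]'(hlt j) with ha
  have haper : ∀ j, a (j + r) = a j := fun j => by simp [ha]
  obtain ⟨S, hS0, hS⟩ := exists_int_prod fun j => lt (a j)
  have hSr : S r = FreeGroup.mk L := by
    have key : ∀ n : ℕ, n ≤ r → S n = FreeGroup.mk (L.take n) := by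
      intro n
      induction n with
      | zero => intro _; simp [hS0, ← one_eq_mk]
      | succ n ih =>
        intro hn
        push_cast
        have hn' : n < L.length := hn
        rw [hS, ih (by lia), List.take_succ_eq_append_getElem hn', ← mul_mk, lt]
        congr 3
        simp only [ha]
        congr 1
        rw [Int.emod_eq_of_lt (by lia) (by lia)]; simp
    rw [key r le_rfl, List.take_of_length_le le_rfl]
  refine ⟨fun j => q * S j, a, r, ⟨fun n => by rw [hS, mul_assoc], ?_⟩, hr0, ?_, haper⟩
  · intro n
    have e1 := Int.emod_nonneg n hr0'.ne'
    have e2 := Int.emod_lt_of_pos n hr0'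
    obtain ⟨i, hi⟩ := Int.eq_ofNat_of_zero_le e1
    have e3 : (n + 1) % r = ((i + 1 : ℕ) : ℤ) % r := by
      rw [← Int.emod_add_emod, hi]; simp
    simp only [ha, hi, e3]
    have hir : i < r := by lia
    by_cases hc : i + 1 < r
    · have e4 : (((i + 1 : ℕ) : ℤ) % r).toNat = i + 1 := by
        rw [Int.emod_eq_of_lt (by lia) (by lia)]; simp
      simp only [e4, Int.toNat_natCast]
      have := List.isChain_iff_getElem.1 ((isReduced_iff L).1 hcyc.1) i hc
      exact this
    · have e4 : i + 1 = r := by lia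
      have e5 : (((i + 1 : ℕ) : ℤ) % r).toNat = 0 := by rw [e4]; simp
      simp only [e5, Int.toNat_natCast]
      have h2 := hcyc.2 (L[i]) (by
        rw [List.getLast?_eq_getElem?, Option.mem_def, ← hr, ← e4]; simp) (L[0])
          (by rw [List.head?_eq_getElem?, Option.mem_def]; simp)
      rwa [rel_iff] at h2
  · intro j
    change q * S (j + r) = z * (q * S j)
    rw [int_prod_add hS0 hS (fun j => by rw [haper]), hSr, hzq]
    group

end Axis

section Concat

theorem exists_int_sum (d : ℤ → ℤ) : ∃ S : ℤ → ℤ, S 0 = 0 ∧ ∀ j, S (j + 1) = S j + d j :=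
  exists_int_prod (G := Multiplicative ℤ) d

theorem int_sum_add {d S : ℤ → ℤ} {r : ℤ} (h0 : S 0 = 0)
    (hS : ∀ j, S (j + 1) = S j + d j) (hd : ∀ j, d (j + r) = d j) (j : ℤ) :
    S (j + r) = S r + S j :=
  int_prod_add (G := Multiplicative ℤ) (d := d) (S := S) h0 hS hd j

theorem exists_mem_tile {d S : ℤ → ℤ} (h0 : S 0 = 0) (hS : ∀ j, S (j + 1) = S j + d j)
    (hd : ∀ j, 1 ≤ d j) (n : ℤ) : ∃ j, S j ≤ n ∧ n < S (j + 1) := by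
  induction n using Int.induction_on with
  | zero => exact ⟨0, h0.le, by rw [hS, h0]; have := hd 0; lia⟩
  | succ n ih =>
    obtain ⟨j, h1, h2⟩ := ih
    by_cases h : (n : ℤ) + 1 < S (j + 1)
    · exact ⟨j, by lia, h⟩
    · refine ⟨j + 1, by lia, ?_⟩
      rw [hS (j + 1)]
      have := hd (j + 1)
      lia
  | pred n ih =>
    obtain ⟨j, h1, h2⟩ := ih
    by_cases h : S j ≤ -(n : ℤ) - 1
    · exact ⟨j, h, by lia⟩
    · refine ⟨j - 1, ?_, by rw [sub_add_cancel]; lia⟩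
      have h3 := hS (j - 1)
      rw [sub_add_cancel] at h3
      have := hd (j - 1)
      lia

theorem tile_mono {d S : ℤ → ℤ} (hS : ∀ j, S (j + 1) = S j + d j)
    (hd : ∀ j, 1 ≤ d j) : StrictMono S :=
  strictMono_int_of_lt_succ fun j => by rw [hS]; have := hd j; lia

variable {α : Type*} [DecidableEq α]

omit [DecidableEq α] in
/-- Concatenating reduced words without cancellation yields a line. -/
theorem exists_concat [Nonempty α] {p : ℤ → FreeGroup α} {M : ℤ → List (α × Bool)} (hM : ∀ j, M j ≠ [])
    (hred : ∀ j, FreeGroup.IsReduced (M j)) (hp : ∀ j, p (j + 1) = p j * FreeGroup.mk (M j))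
    (hjun : ∀ j, ∀ a ∈ (M j).getLast?, ∀ b ∈ (M (j + 1)).head?, b ≠ bar a) :
    ∃ (v : ℤ → FreeGroup α) (Y : ℤ → α × Bool) (S : ℤ → ℤ), IsLine v Y ∧ S 0 = 0 ∧
      (∀ j, S (j + 1) = S j + (M j).length) ∧
      (∀ n, ∃ (j : ℤ) (i : ℕ), i < (M j).length ∧ n = S j + i) ∧
      ∀ (j : ℤ) (i : ℕ) (hi : i < (M j).length), Y (S j + i) = (M j)[i] ∧
        v (S j + i) = p j * FreeGroup.mk ((M j).take i) := by
  obtain ⟨S, hS0, hS⟩ := exists_int_sum fun j => ((M j).length : ℤ)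
  have hlen : ∀ j, 1 ≤ ((M j).length : ℤ) := fun j => by
    have := List.length_pos_iff.2 (hM j); lia
  choose J hJ using exists_mem_tile hS0 hS hlen
  have hmono := tile_mono hS hlen
  have hJeq : ∀ (j : ℤ) (i : ℕ), i < (M j).length → J (S j + i) = j := by
    intro j i hi
    have h1 := hJ (S j + i)
    have h2 : J (S j + i) < j + 1 := hmono.lt_iff_lt.1 (by rw [hS j]; lia)
    have h3 : j < J (S j + i) + 1 := hmono.lt_iff_lt.1 (by lia)
    lia
  have hmem : ∀ n, ∃ (j : ℤ) (i : ℕ), i < (M j).length ∧ n = S j + i := by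
    intro n
    refine ⟨J n, (n - S (J n)).toNat, ?_, ?_⟩ <;> have := hJ n <;> rw [hS] at this <;> lia
  have hb : Nonempty (α × Bool) := inferInstance
  obtain ⟨b⟩ := hb
  set v : ℤ → FreeGroup α := fun n => p (J n) * FreeGroup.mk ((M (J n)).take (n - S (J n)).toNat)
  set Y : ℤ → α × Bool := fun n => (M (J n)).getD (n - S (J n)).toNat b
  have key : ∀ (j : ℤ) (i : ℕ) (hi : i < (M j).length), Y (S j + i) = (M j)[i] ∧
        v (S j + i) = p j * FreeGroup.mk ((M j).take i) := by
    intro j i hi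
    simp [v, Y, hJeq j i hi, hi]
  have next : ∀ n, ∃ (j : ℤ) (i : ℕ) (_ : i < (M j).length), n = S j + i ∧
      ((i + 1 < (M j).length ∧ n + 1 = S j + (i + 1 : ℕ)) ∨
        (i + 1 = (M j).length ∧ n + 1 = S (j + 1) + (0 : ℕ))) := by
    intro n
    obtain ⟨j, i, hi, hn⟩ := hmem n
    refine ⟨j, i, hi, hn, ?_⟩
    rcases Nat.lt_or_ge (i + 1) (M j).length with h | h
    · left; exact ⟨h, by push_cast; lia⟩
    · right; refine ⟨by lia, ?_⟩
      rw [hS]; lia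
  have h0 : ∀ j, 0 < (M j).length := fun j => by have := hlen j; lia
  refine ⟨v, Y, S, ⟨fun n => ?_, fun n => ?_⟩, hS0, hS, hmem, key⟩
  · obtain ⟨j, i, hi, hn, ⟨h1, h2⟩ | ⟨h1, h2⟩⟩ := next n
    · rw [h2, hn, (key j _ h1).2, (key j i hi).1, (key j i hi).2,
        List.take_succ_eq_append_getElem hi, ← mul_mk, mul_assoc]
      rfl
    · rw [h2, hn, (key _ _ (h0 _)).2, (key j i hi).1, (key j i hi).2, hp]
      rw [List.take_zero, ← one_eq_mk, mul_one, mul_assoc]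
      congr 1
      conv_lhs => rw [← List.take_of_length_le h1.ge]
      rw [List.take_succ_eq_append_getElem hi, ← mul_mk]
      rfl
  · obtain ⟨j, i, hi, hn, ⟨h1, h2⟩ | ⟨h1, h2⟩⟩ := next n
    · rw [h2, hn, (key j _ h1).1, (key j i hi).1]
      exact List.isChain_iff_getElem.1 ((isReduced_iff _).1 (hred j)) i h1
    · rw [h2, hn, (key _ _ (h0 _)).1, (key j i hi).1]
      refine hjun j _ ?_ _ ?_
      · rw [List.getLast?_eq_getElem?, Option.mem_def, ← h1]; simp
      · rw [List.head?_eq_getElem?, Option.mem_def]; simp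

end Concat

section Tiles
variable {α ι : Type*} [DecidableEq α]

/-- The reduced word of the generator, or inverse of a generator, labelled by `a`. -/
def genWord (w : ι → FreeGroup α) (a : ι × Bool) : List (α × Bool) :=
  toWord (FreeGroup.lift w (lt a))

theorem mk_genWord (w : ι → FreeGroup α) (a : ι × Bool) :
    FreeGroup.mk (genWord w a) = FreeGroup.lift w (lt a) := mk_toWord

theorem genWord_bar (w : ι → FreeGroup α) (a : ι × Bool) :
    genWord w (bar a) = invRev (genWord w a) := by
  rw [genWord, lt_bar, _root_.map_inv, toWord_inv]; rfl

omit [DecidableEq α] in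
theorem getElem_invRev (L : List (α × Bool)) (i : ℕ) (hi : i < L.length) :
    (invRev L)[i]? = some (bar (L[L.length - 1 - i])) := by
  simp only [invRev, List.getElem?_reverse, List.length_map, hi, List.getElem?_map]
  rw [List.getElem?_eq_getElem (by lia)]
  rfl

theorem exists_first_difference {β : Type*} {L L' : List β} {ℓ : ℕ}
    (h : ¬ ∀ i < ℓ, L[i]? = L'[i]?) : ∃ c < ℓ, L.take c = L'.take c ∧ L[c]? ≠ L'[c]? := by
  classical
  have h' : ∃ i : ℕ, L[i]? ≠ L'[i]? := by push Not at h; obtain ⟨i, -, hi⟩ := h; exact ⟨i, hi⟩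
  refine ⟨Nat.find h', ?_, ?_, Nat.find_spec h'⟩
  · push Not at h
    obtain ⟨i, hi, hi'⟩ := h
    exact (Nat.find_min' h' hi').trans_lt hi
  · apply List.ext_getElem?
    intro i
    simp only [List.getElem?_take]
    split_ifs with hi
    · have := Nat.find_min h' hi; simpa using this
    · rfl

/-- The data describing how the axis of an element of the subgroup generated by `w` decomposes
into subwords of the generators. -/
structure TileLine (w : ι → FreeGroup α) (ℓ : ℕ) (x : FreeGroup α) (N : ℕ) where
  v : ℤ → FreeGroup α
  Y : ℤ → α × Bool
  a : ℤ → ι × Bool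
  h : ℤ → FreeGroup α
  c : ℤ → ℕ
  m : ℤ → ℕ
  S : ℤ → ℤ
  r : ℕ
  line : IsLine v Y
  pos : 0 < N
  per : ∀ n, v (n + N) = x * v n
  mem : ∀ j, h j ∈ Subgroup.closure (Set.range w)
  lt_c : ∀ j, c j < ℓ
  le_len : ∀ j, c j + m j ≤ (genWord w (a j)).length
  len_le : ∀ j, (genWord w (a j)).length ≤ m j + 2 * ℓ
  S_zero : S 0 = 0
  S_succ : ∀ j, S (j + 1) = S j + m j
  S_r : S r = N
  cover : ∀ n, ∃ (j : ℤ) (i : ℕ), i < m j ∧ n = S j + i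
  letter : ∀ (j : ℤ) (i : ℕ), i < m j → (genWord w (a j))[c j + i]? = some (Y (S j + i))
  vertex : ∀ (j : ℤ) (i : ℕ), i < m j →
    v (S j + i) = h j * FreeGroup.mk ((genWord w (a j)).take (c j + i))

theorem exists_tileLine [Nonempty α] [DecidableEq ι] (w : ι → FreeGroup α) {ℓ : ℕ}
    (hlong : ∀ a, 2 * ℓ + 1 ≤ (genWord w a).length)
    (hcoin : ∀ a b, a ≠ b → ¬ ∀ i < ℓ, (genWord w a)[i]? = (genWord w b)[i]?)
    {x : FreeGroup α} (hx : x ∈ Subgroup.closure (Set.range w)) (hx1 : x ≠ 1) :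
    ∃ N, Nonempty (TileLine w ℓ x N) := by
  have hrange : (FreeGroup.lift w).range = Subgroup.closure (Set.range w) := by
    rw [FreeGroup.range_lift_eq_closure]
  rw [← hrange] at hx
  obtain ⟨z, rfl⟩ := hx
  have hz : z ≠ 1 := by rintro rfl; exact hx1 (_root_.map_one _)
  obtain ⟨V, a, r, hV, hr, hVr, har⟩ := exists_axis hz
  have hc : ∀ j, ∃ c < ℓ, (genWord w (bar (a j))).take c = (genWord w (a (j + 1))).take c ∧
      (genWord w (bar (a j)))[c]? ≠ (genWord w (a (j + 1)))[c]? := fun j =>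
    exists_first_difference (hcoin _ _ (hV.red j).symm)
  choose c' hc'1 hc'2 hc'3 using hc
  set c : ℤ → ℕ := fun j => c' (j - 1) with hcdef
  have hcc : ∀ j, c (j + 1) = c' j := fun j => by simp [hcdef]
  have hcl : ∀ j, c j < ℓ := fun j => hc'1 _
  set W : ℤ → List (α × Bool) := fun j => genWord w (a j) with hW
  have hWl : ∀ j, 2 * ℓ + 1 ≤ (W j).length := fun j => hlong _
  have hWr : ∀ j, FreeGroup.IsReduced (W j) := fun j => isReduced_toWord
  set m : ℤ → ℕ := fun j => (W j).length - c j - c (j + 1) with hm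
  have hm1 : ∀ j, c j + m j + c (j + 1) = (W j).length := fun j => by
    have := hWl j; have := hcl j; have := hcl (j + 1); lia
  have hm0 : ∀ j, 0 < m j := fun j => by
    have := hWl j; have := hcl j; have := hcl (j + 1); have := hm1 j; lia
  set h : ℤ → FreeGroup α := fun j => FreeGroup.lift w (V j) with hh
  set M : ℤ → List (α × Bool) := fun j => ((W j).drop (c j)).take (m j) with hMdef
  have hMlen : ∀ j, (M j).length = m j := fun j => by
    have := hm1 j; simp [hMdef]; lia
  set p : ℤ → FreeGroup α := fun j => h j * FreeGroup.mk ((W j).take (c j)) with hp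
  have hbar : ∀ j, genWord w (bar (a j)) = invRev (W j) := fun j => genWord_bar _ _
  have hstep : ∀ j, p (j + 1) = p j * FreeGroup.mk (M j) := by
    intro j
    have h1 : h (j + 1) = h j * FreeGroup.mk (W j) := by
      rw [hh]
      simp only [hV.step, _root_.map_mul]
      rw [← mk_genWord]
    have h2 : (W (j + 1)).take (c (j + 1)) = invRev ((W j).drop (c j + m j)) := by
      rw [hcc, ← hc'2, hbar, invRev, List.take_reverse, List.length_map, ← List.map_drop, invRev]
      congr 3
      have := hm1 j; rw [hcc] at this; lia
    have h3 : W j = (W j).take (c j) ++ M j ++ (W j).drop (c j + m j) := by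
      conv_lhs => rw [← List.take_append_drop (c j + m j) (W j)]
      rw [List.take_add]
    simp only [hp]
    rw [h2, ← inv_mk, h1]
    conv_lhs => enter [1, 2]; rw [h3]
    rw [← mul_mk, ← mul_mk]
    group
  have hjun : ∀ j, ∀ y ∈ (M j).getLast?, ∀ b ∈ (M (j + 1)).head?, b ≠ bar y := by
    intro j y hy b hb hby
    have e1 : (W (j + 1))[c (j + 1)]? = some b := by
      rw [Option.mem_def, List.head?_eq_getElem?] at hb
      simp only [hMdef] at hb
      rw [List.getElem?_take_of_lt (hm0 _)] at hb
      simpa using hb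
    have e2 : (W j)[c j + (m j - 1)]? = some y := by
      rw [Option.mem_def, List.getLast?_eq_getElem?, hMlen] at hy
      simp only [hMdef] at hy
      rw [List.getElem?_take_of_lt (by have := hm0 j; lia)] at hy
      simpa using hy
    apply hc'3 j
    change _ = (W (j + 1))[c' j]?
    rw [hbar, ← hcc, e1, getElem_invRev _ _ (by have := hm1 j; have := hm0 j; lia), hby]
    have e3 : (W j).length - 1 - c (j + 1) = c j + (m j - 1) := by
      have := hm1 j; have := hm0 j; lia
    have e4 := (List.getElem?_eq_some_iff.1 e2).2
    congr 2
    rw [← e4]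
    congr 1
  obtain ⟨v, Y, S, hl, hS0, hS, hcov, hkey⟩ := exists_concat (p := p) (M := M)
    (fun j => List.length_pos_iff.1 (by rw [hMlen]; exact hm0 j))
    (fun j => (hWr j).infix
      ((List.take_prefix _ _).isInfix.trans (List.drop_suffix _ _).isInfix)) hstep hjun
  have hper : ∀ j, W (j + r) = W j ∧ c (j + r) = c j := by
    have hW' : ∀ j, W (j + r) = W j := fun j => by simp only [hW, har]
    have hcr : ∀ j, c' (j + r) = c' j := by
      intro j
      by_contra hne
      have key : ∀ i j, a i = a j → a (i + 1) = a (j + 1) → ¬ c' i < c' j := by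
        intro i j h1 h2 hlt
        apply hc'3 i
        rw [h1, h2]
        have := congrArg (fun L => L[c' i]?) (hc'2 j)
        simpa [List.getElem?_take_of_lt hlt] using this
      have h1 := har j
      have h2 : a (j + r + 1) = a (j + 1) := by rw [← har (j + 1)]; congr 1; ring
      rcases Nat.lt_or_gt_of_ne hne with h3 | h3
      · exact key _ _ h1 h2 h3
      · exact key _ _ h1.symm h2.symm h3
    refine fun j => ⟨hW' j, ?_⟩
    simp only [hcdef]
    rw [show j + (r : ℤ) - 1 = (j - 1) + r by ring, hcr]
  have hmr : ∀ j, m (j + r) = m j := fun j => by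
    simp only [hm]
    rw [(hper j).1, (hper j).2, show j + (r : ℤ) + 1 = (j + 1) + r by ring, (hper (j + 1)).2]
  have hS' : ∀ j, S (j + 1) = S j + m j := fun j => by rw [hS, hMlen]
  have hmono := tile_mono hS' fun j => by have := hm0 j; omega
  have hSr : 0 < S r := by rw [← hS0]; exact hmono (by exact_mod_cast hr)
  have hpr : ∀ j, p (j + r) = FreeGroup.lift w z * p j := fun j => by
    simp only [hp, hh]
    rw [(hper j).1, (hper j).2, hVr, _root_.map_mul, mul_assoc]
  have hcov' : ∀ n, ∃ (j : ℤ) (i : ℕ), i < m j ∧ n = S j + i := fun n => by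
    obtain ⟨j, i, h1, h2⟩ := hcov n
    exact ⟨j, i, by rwa [hMlen] at h1, h2⟩
  refine ⟨(S r).toNat, ⟨⟨v, Y, a, h, c, m, S, r, hl, by omega, ?_, ?_, hcl, ?_, ?_, hS0, hS',
    by omega, hcov', ?_, ?_⟩⟩⟩
  · intro n
    obtain ⟨j, i, hi, rfl⟩ := hcov n
    have h5 : S j + i + ((S r).toNat : ℤ) = S (j + r) + i := by
      rw [int_sum_add (d := fun j => (m j : ℤ)) hS0 hS' (fun j => by rw [hmr]) j]; omega
    have hMr : M (j + r) = M j := by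
      simp only [hMdef]; rw [(hper j).1, (hper j).2, hmr]
    rw [h5, (hkey j i hi).2, (hkey (j + r) i (by rwa [hMr])).2, hMr, hpr, mul_assoc]
  · intro j
    rw [← hrange]; exact ⟨_, rfl⟩
  · intro j
    have := hm1 j
    change _ ≤ (W j).length
    omega
  · intro j
    have := hm1 j
    have := hcl j
    have := hcl (j + 1)
    change (W j).length ≤ _
    omega
  · intro j i hi
    rw [(hkey j i (by rwa [hMlen])).1]
    have : (M j)[i]? = some ((M j)[i]'(by rwa [hMlen])) := List.getElem?_eq_getElem _
    rw [← this]
    simp only [hMdef]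
    rw [List.getElem?_take_of_lt hi, List.getElem?_drop]
  · intro j i hi
    rw [(hkey j i (by rwa [hMlen])).2]
    simp only [hp]
    rw [mul_assoc, mul_mk, List.take_add]
    congr 3
    simp only [hMdef]
    rw [List.take_take, min_eq_left hi.le]

end Tiles

section TileCount
variable {α ι : Type*} [DecidableEq α]

/-- The `i`-th and `(i+1)`-st letters of `L` exist and cross the star with directions `J`. -/
def CrossAt (J : Finset (α × Bool)) (L : List (α × Bool)) (i : ℕ) : Prop :=
  ∃ a b, L[i]? = some a ∧ L[i + 1]? = some b ∧ ¬ (b ∈ J ↔ bar a ∈ J)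

open Classical in
/-- Number of consecutive pairs of letters of `L` which cross the star with directions `J`. -/
def crossCount (J : Finset (α × Bool)) (L : List (α × Bool)) : ℕ :=
  ((Finset.range L.length).filter (CrossAt J L)).card

variable {w : ι → FreeGroup α} {ℓ : ℕ} {x : FreeGroup α} {N : ℕ}

theorem TileLine.cross_iff (t : TileLine w ℓ x N) (J : Finset (α × Bool)) (j : ℤ) {i : ℕ}
    (hi : i + 1 < t.m j) : CrossAt J (genWord w (t.a j)) (t.c j + i) ↔
      ¬ (t.Y (t.S j + (i + 1 : ℕ)) ∈ J ↔ bar (t.Y (t.S j + (i + 1 : ℕ) - 1)) ∈ J) := by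
  have h1 := t.letter j i (by lia)
  have h2 := t.letter j (i + 1) hi
  have h3 : t.S j + (i + 1 : ℕ) - 1 = t.S j + i := by push_cast; ring
  rw [h3]
  constructor
  · rintro ⟨a, b, ha, hb, h⟩
    rw [h1] at ha
    rw [add_assoc, h2] at hb
    cases ha; cases hb
    exact h
  · intro h
    exact ⟨_, _, h1, by rw [add_assoc]; exact h2, h⟩

open Classical in
theorem TileLine.card_le (t : TileLine w ℓ x N) (J : Finset (α × Bool)) (j : ℤ) :
    ((Finset.Ico (t.S j) (t.S (j + 1))).filter fun n =>
      ¬ (t.Y n ∈ J ↔ bar (t.Y (n - 1)) ∈ J)).card ≤ crossCount J (genWord w (t.a j)) + 1 := by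
  have : ((Finset.Ico (t.S j) (t.S (j + 1))).filter fun n =>
      ¬ (t.Y n ∈ J ↔ bar (t.Y (n - 1)) ∈ J)) ⊆ insert (t.S j)
        (((Finset.range (genWord w (t.a j)).length).filter (CrossAt J (genWord w (t.a j)))).image
          fun i : ℕ => t.S j + i + 1 - t.c j) := by
    intro n hn
    rw [Finset.mem_filter, Finset.mem_Ico, t.S_succ] at hn
    obtain ⟨⟨h1, h2⟩, h3⟩ := hn
    rw [Finset.mem_insert, Finset.mem_image]
    by_cases h : n = t.S j
    · exact Or.inl h
    right
    obtain ⟨i, hi⟩ := Int.eq_ofNat_of_zero_le (a := n - t.S j - 1) (by lia)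
    have hn : n = t.S j + (i + 1 : ℕ) := by push_cast; lia
    have hi' : i + 1 < t.m j := by lia
    refine ⟨t.c j + i, ?_, by push_cast; lia⟩
    rw [Finset.mem_filter, Finset.mem_range]
    exact ⟨by have := t.le_len j; lia, (t.cross_iff J j hi').2 (hn ▸ h3)⟩
  exact (Finset.card_le_card this).trans ((Finset.card_insert_le _ _).trans
    (Nat.add_le_add_right Finset.card_image_le 1))

open Classical in
theorem TileLine.le_card (t : TileLine w ℓ x N) (J : Finset (α × Bool)) (j : ℤ) :
    crossCount J (genWord w (t.a j)) ≤ ((Finset.Ico (t.S j) (t.S (j + 1))).filter fun n =>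
      ¬ (t.Y n ∈ J ↔ bar (t.Y (n - 1)) ∈ J)).card + (2 * ℓ + 1) := by
  set A := (Finset.Ico (t.S j) (t.S (j + 1))).filter fun n =>
      ¬ (t.Y n ∈ J ↔ bar (t.Y (n - 1)) ∈ J) with hA
  set W := genWord w (t.a j)
  have hl := t.le_len j
  have hl' := t.len_le j
  have : (Finset.range W.length).filter (CrossAt J W) ⊆
      A.image (fun n => (n - t.S j + t.c j - 1).toNat) ∪
        (Finset.range W.length \ Finset.Ico (t.c j) (t.c j + (t.m j - 1))) := by
    intro i hi
    rw [Finset.mem_filter, Finset.mem_range] at hi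
    rw [Finset.mem_union, Finset.mem_image, Finset.mem_sdiff, Finset.mem_Ico, Finset.mem_range]
    by_cases h : t.c j ≤ i ∧ i < t.c j + (t.m j - 1)
    · left
      obtain ⟨i', rfl⟩ := Nat.exists_eq_add_of_le h.1
      have hi' : i' + 1 < t.m j := by lia
      refine ⟨t.S j + (i' + 1 : ℕ), ?_, by push_cast; lia⟩
      rw [hA, Finset.mem_filter, Finset.mem_Ico, t.S_succ]
      exact ⟨⟨by lia, by lia⟩, (t.cross_iff J j hi').1 hi.2⟩
    · exact Or.inr ⟨hi.1, h⟩
  have h1 : (Finset.range W.length \ Finset.Ico (t.c j) (t.c j + (t.m j - 1))).card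
      ≤ 2 * ℓ + 1 := by
    rw [Finset.card_sdiff_of_subset]
    · simp; lia
    · intro i hi
      rw [Finset.mem_Ico] at hi
      rw [Finset.mem_range]
      have : t.c j + t.m j ≤ W.length := hl
      lia
  exact (Finset.card_le_card this).trans ((Finset.card_union_le _ _).trans
    (Nat.add_le_add Finset.card_image_le h1))

variable [Fintype α]

omit [DecidableEq α] in
theorem freq_nonneg_le_one (hα : 2 ≤ Fintype.card α) (J : Finset (α × Bool)) :
    0 ≤ freq J ∧ freq J ≤ 1 := by
  have h0 : (2 : ℝ) ≤ Fintype.card α := by exact_mod_cast hα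
  have h1 : (J.card : ℝ) ≤ 2 * Fintype.card α := by
    have : J.card ≤ Fintype.card α * 2 := by
      have := Finset.card_le_univ J
      simpa [Fintype.card_prod] using this
    exact_mod_cast (by lia : J.card ≤ 2 * Fintype.card α)
  have h2 : (0 : ℝ) ≤ J.card := Nat.cast_nonneg _
  unfold freq
  constructor
  · apply div_nonneg <;> nlinarith
  · rw [div_le_one (by nlinarith)]
    nlinarith [sq_nonneg ((J.card : ℝ) - Fintype.card α)]

theorem TileLine.balanced (hα : 2 ≤ Fintype.card α) (t : TileLine w ℓ x N) (hℓ : 1 ≤ ℓ)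
    (hlong : ∀ a, 2000 * Fintype.card α * ℓ ≤ (genWord w a).length)
    (hcross : ∀ a J, |(crossCount J (genWord w a) : ℝ) - freq J * (genWord w a).length| ≤
      (genWord w a).length / (400 * Fintype.card α)) : Balanced x N := by
  classical
  refine ⟨t.pos, fun J => ⟨_, crossing_St t.line (by exact_mod_cast t.pos) t.per J, ?_⟩⟩
  set k : ℝ := (Fintype.card α : ℝ) with hk
  have hk2 : (2 : ℝ) ≤ k := by rw [hk]; exact_mod_cast hα
  obtain ⟨hf0, hf1⟩ := freq_nonneg_le_one hα J
  set P : ℤ → Prop := fun n => ¬ (t.Y n ∈ J ↔ bar (t.Y (n - 1)) ∈ J) with hP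
  have htile : ∀ j, |(((Finset.Ico (t.S j) (t.S (j + 1))).filter P).card : ℝ) - freq J * t.m j| ≤
      t.m j / (100 * k) := by
    intro j
    have h1 : (((Finset.Ico (t.S j) (t.S (j + 1))).filter P).card : ℝ) ≤
      crossCount J (genWord w (t.a j)) + 1 := by exact_mod_cast t.card_le J j
    have h2 : (crossCount J (genWord w (t.a j)) : ℝ) ≤
      ((Finset.Ico (t.S j) (t.S (j + 1))).filter P).card + (2 * ℓ + 1) := by
        exact_mod_cast t.le_card J j
    have h3 := abs_le.1 (hcross (t.a j) J)
    have h4 : 2000 * k * ℓ ≤ (genWord w (t.a j)).length := by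
      rw [hk]; exact_mod_cast hlong (t.a j)
    have h5 : ((genWord w (t.a j)).length : ℝ) ≤ t.m j + 2 * ℓ := by exact_mod_cast t.len_le j
    have h6 : (t.m j : ℝ) ≤ (genWord w (t.a j)).length := by
      have := t.le_len j
      exact_mod_cast (by lia : t.m j ≤ (genWord w (t.a j)).length)
    have h7 : (1 : ℝ) ≤ ℓ := by exact_mod_cast hℓ
    set W : ℝ := ((genWord w (t.a j)).length : ℝ)
    set m : ℝ := (t.m j : ℝ)
    have h8 : W / (400 * k) = W / k / 400 := by field_simp
    have h9 : m / (100 * k) = m / k / 100 := by field_simp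
    rw [h8] at h3
    rw [h9]
    have h10 : 2000 * (ℓ : ℝ) ≤ W / k := by rw [le_div_iff₀ (by linarith)]; linarith
    have h11 : W / k ≤ m / k + ℓ := by
      rw [div_le_iff₀ (by linarith), add_mul, div_mul_cancel₀ _ (by linarith)]
      nlinarith
    have h12 : freq J * W ≤ freq J * m + 2 * ℓ := by nlinarith
    have h13 : freq J * m ≤ freq J * W := by nlinarith
    rw [abs_le]
    constructor <;> linarith [h3.1, h3.2]
  have hmono : ∀ j, t.S j ≤ t.S (j + 1) := fun j => by rw [t.S_succ]; lia
  have key : ∀ q : ℕ, 0 ≤ t.S q ∧ |(((Finset.Ico 0 (t.S q)).filter P).card : ℝ) - freq J * t.S q| ≤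
      t.S q / (100 * k) := by
    intro q
    induction q with
    | zero => simp [t.S_zero]
    | succ q ih =>
      obtain ⟨ih1, ih2⟩ := ih
      have h1 := hmono q
      push_cast
      refine ⟨by lia, ?_⟩
      have h2 : ((Finset.Ico 0 (t.S (q + 1))).filter P).card =
          ((Finset.Ico 0 (t.S q)).filter P).card +
            ((Finset.Ico (t.S q) (t.S (q + 1))).filter P).card := by
        rw [← Finset.Ico_union_Ico_eq_Ico ih1 h1, Finset.filter_union, Finset.card_union_of_disjoint]
        exact Finset.disjoint_filter_filter (Finset.Ico_disjoint_Ico_consecutive _ _ _)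
      have h3 := htile q
      have h4 : (t.S (q + 1) : ℝ) = t.S q + t.m q := by exact_mod_cast t.S_succ q
      rw [h2, h4, Nat.cast_add, add_div]
      rw [abs_le] at *
      constructor <;> nlinarith
  have h := (key t.r).2
  rw [t.S_r, Int.cast_natCast] at h
  convert h using 3

end TileCount

section Deterministic
variable {α ι : Type*} [DecidableEq α] [Fintype α]

/-- Small cancellation and equidistribution conditions ensuring Aut-malnormality. -/
structure Good (w : ι → FreeGroup α) (ℓ : ℕ) : Prop where
  pos : 1 ≤ ℓ
  long : ∀ a, 2000 * Fintype.card α * ℓ ≤ (genWord w a).length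
  cross : ∀ a J, |(crossCount J (genWord w a) : ℝ) - freq J * (genWord w a).length| ≤
      (genWord w a).length / (400 * Fintype.card α)
  coin : ∀ σ : Equiv.Perm (α × Bool), (∀ a, σ (bar a) = bar (σ a)) → ∀ (a b : ι × Bool) (s t : ℕ),
    s + ℓ ≤ (genWord w a).length → t + ℓ ≤ (genWord w b).length →
    (∀ i < ℓ, (genWord w a)[s + i]? = (genWord w b)[t + i]?.map σ) → σ = 1 ∧ a = b ∧ s = t

theorem Good.exists_conj [DecidableEq ι] {w : ι → FreeGroup α} {ℓ : ℕ} (hα : 2 ≤ Fintype.card α)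
    (hw : Good w ℓ) (e : FreeGroup α ≃* FreeGroup α) {x : FreeGroup α} (hx1 : x ≠ 1)
    (hx : x ∈ Subgroup.closure (Set.range w)) (hx' : e.symm x ∈ Subgroup.closure (Set.range w)) :
    ∃ h ∈ Subgroup.closure (Set.range w), ∀ g, e g = h * g * h⁻¹ := by
  have hne : Nonempty α := Fintype.card_pos_iff.1 (by lia)
  have hlong : ∀ a, 6 * ℓ + 1 ≤ (genWord w a).length := fun a => by
    have := hw.long a
    have := hw.pos
    have : 2000 * 1 * ℓ ≤ 2000 * Fintype.card α * ℓ := by gcongr; lia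
    lia
  have hcoin : ∀ a b, a ≠ b → ¬ ∀ i < ℓ, (genWord w a)[i]? = (genWord w b)[i]? := by
    intro a b hab h
    refine hab (hw.coin 1 (fun _ => rfl) a b 0 0 ?_ ?_ ?_).2.1
    · have := hlong a; lia
    · have := hlong b; lia
    · intro i hi
      rw [zero_add, h i hi]; simp
  have hx1' : e.symm x ≠ 1 := by simpa using hx1
  obtain ⟨N, ⟨T⟩⟩ := exists_tileLine w (fun a => by have := hlong a; lia) hcoin hx hx1
  obtain ⟨N', ⟨T'⟩⟩ := exists_tileLine w (fun a => by have := hlong a; lia) hcoin hx' hx1'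
  obtain ⟨u, σ, hσ, hu⟩ := Balanced.exists_conj_perm hα e hx1
    (T.balanced hα hw.pos hw.long hw.cross) (T'.balanced hα hw.pos hw.long hw.cross)
  have hline : IsLine (fun n => e (T'.v n) * u) (fun n => σ (T'.Y n)) := by
    constructor
    · intro n
      rw [T'.line.step, _root_.map_mul, hu]; group
    · intro n h
      rw [← hσ] at h
      exact T'.line.red n (σ.injective h)
  obtain ⟨d, hd⟩ := T.line.unique (by exact_mod_cast T.pos) T.per hline
    (N' := N') (by exact_mod_cast T'.pos) (fun n => by
      rw [T'.per, _root_.map_mul, MulEquiv.apply_symm_apply, mul_assoc])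
  have hm : ∀ j, 4 * ℓ + 1 ≤ T.m j := fun j => by
    have := hlong (T.a j); have := T.len_le j; lia
  have hm' : ∀ j, 4 * ℓ + 1 ≤ T'.m j := fun j => by
    have := hlong (T'.a j); have := T'.len_le j; lia
  obtain ⟨j₀, q, i, hj₀, hq, hi⟩ : ∃ (j₀ : ℕ) (q : ℤ) (i : ℕ), j₀ ≤ ℓ ∧ d + j₀ = T.S q + i ∧
      i + ℓ ≤ T.m q := by
    obtain ⟨q, i, h1, h2⟩ := T.cover d
    by_cases h : i + ℓ ≤ T.m q
    · exact ⟨0, q, i, by lia, by rw [h2]; simp, h⟩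
    · refine ⟨T.m q - i, q + 1, 0, by lia, ?_, by have := hm (q + 1); lia⟩
      rw [T.S_succ]; lia
  have hS0 : ∀ i : ℕ, T'.S 0 + i = i := fun i => by rw [T'.S_zero, zero_add]
  have hletter : ∀ i' < ℓ, (genWord w (T.a q))[T.c q + i + i']? =
      (genWord w (T'.a 0))[T'.c 0 + j₀ + i']?.map σ := by
    intro i' hi'
    have h1 := T.letter q (i + i') (by lia)
    have h2 := T'.letter 0 (j₀ + i') (by have := hm' 0; lia)
    rw [add_assoc, add_assoc, h1, h2, hS0, Option.map_some]
    have h3 := (hd (j₀ + i')).2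
    rw [h3]
    congr 2
    push_cast
    lia
  obtain ⟨hσ1, hab, hst⟩ := hw.coin σ hσ _ _ _ _ (by have := T.le_len q; lia)
    (by have := T'.le_len 0; have := hm' 0; lia) hletter
  have he : ∀ g, e g = u * g * u⁻¹ := by
    have : e.toMonoidHom = (MulAut.conj u).toMonoidHom := by
      refine FreeGroup.ext_hom _ _ fun a => ?_
      have := hu (a, true)
      rw [hσ1] at this
      exact this
    intro g
    exact DFunLike.congr_fun this g
  refine ⟨u, ?_, he⟩
  have h1 := T.vertex q i (by have := hw.pos; lia)
  have h2 := T'.vertex 0 j₀ (by have := hm' 0; lia)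
  have h3 := (hd j₀).1
  rw [hS0] at h2
  rw [hq, h1, h2, he, hab, hst] at h3
  have h4 : u = T.h q * (T'.h 0)⁻¹ := by
    rw [inv_mul_cancel_right, ← mul_assoc] at h3
    rw [eq_mul_inv_iff_mul_eq]
    exact mul_right_cancel h3
  rw [h4]
  exact mul_mem (T.mem q) (inv_mem (T'.mem 0))

end Deterministic

section Counting
variable {α : Type*} [DecidableEq α] [Fintype α]

/-- Letters which may be added on the left of `L` without cancellation. -/
def ext (L : List (α × Bool)) : Finset (α × Bool) :=
  Finset.univ.filter fun a => ∀ b ∈ L.head?, b ≠ bar a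

theorem mem_ext {L : List (α × Bool)} {a : α × Bool} : a ∈ ext L ↔ ∀ b ∈ L.head?, b ≠ bar a := by
  simp [ext]

/-- The reduced words of length `m`. -/
def words : ℕ → Finset (List (α × Bool))
  | 0 => {[]}
  | m + 1 => (words m).biUnion fun L => (ext L).image (· :: L)

theorem mem_words {m : ℕ} {L : List (α × Bool)} :
    L ∈ words m ↔ FreeGroup.IsReduced L ∧ L.length = m := by
  induction m generalizing L with
  | zero =>
    simp only [words, Finset.mem_singleton, List.length_eq_zero_iff]
    constructor
    · rintro rfl; simp
    · exact fun h => h.2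
  | succ m ih =>
    simp only [words, Finset.mem_biUnion, Finset.mem_image]
    constructor
    · rintro ⟨L, hL, a, ha, rfl⟩
      rw [ih] at hL
      refine ⟨?_, by simp [hL.2]⟩
      rw [isReduced_iff, List.isChain_cons]
      exact ⟨mem_ext.1 ha, (isReduced_iff _).1 hL.1⟩
    · rintro ⟨h, h2⟩
      rcases L with _ | ⟨a, L⟩
      · simp at h2
      · rw [isReduced_iff, List.isChain_cons] at h
        exact ⟨L, ih.2 ⟨(isReduced_iff _).2 h.2, by simpa using h2⟩, a, mem_ext.2 h.1, rfl⟩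

theorem sum_words_succ (m : ℕ) (f : List (α × Bool) → ℝ) :
    ∑ L ∈ words (m + 1), f L = ∑ L ∈ words m, ∑ a ∈ ext L, f (a :: L) := by
  rw [words, Finset.sum_biUnion]
  · refine Finset.sum_congr rfl fun L _ => ?_
    rw [Finset.sum_image]
    intro a _ b _ h
    simpa using h
  · intro L _ L' _ h
    simp only [Function.onFun, Finset.disjoint_left, Finset.mem_image]
    rintro _ ⟨a, _, rfl⟩ ⟨b, _, h2⟩
    simp only [List.cons.injEq] at h2
    exact h h2.2.symm

theorem ext_nil : ext ([] : List (α × Bool)) = Finset.univ := by simp [ext]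

theorem ext_cons (c : α × Bool) (L : List (α × Bool)) :
    ext (c :: L) = Finset.univ.erase (bar c) := by
  ext a
  simp only [mem_ext, List.head?_cons, Option.mem_def, Option.some.injEq, forall_eq',
    Finset.mem_erase, Finset.mem_univ, and_true, Ne]
  rw [bar_eq_comm.symm, eq_comm]

theorem card_ext_of_length {L L' : List (α × Bool)} (h : L.length = L'.length) :
    (ext L).card = (ext L').card := by
  rcases L with _ | ⟨c, L⟩ <;> rcases L' with _ | ⟨c', L'⟩
  · rfl
  · simp at h
  · simp at h
  · rw [ext_cons, ext_cons, Finset.card_erase_of_mem (Finset.mem_univ _),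
      Finset.card_erase_of_mem (Finset.mem_univ _)]

theorem le_card_ext (L : List (α × Bool)) : 2 * Fintype.card α - 1 ≤ (ext L).card := by
  rcases L with _ | ⟨c, L⟩
  · rw [ext_nil]; simp [Fintype.card_prod]; lia
  · rw [ext_cons, Finset.card_erase_of_mem (Finset.mem_univ _)]; simp [Fintype.card_prod]; lia

theorem card_ext_le (L : List (α × Bool)) : (ext L).card ≤ 2 * Fintype.card α :=
  (Finset.card_le_univ _).trans (by simp [Fintype.card_prod]; lia)

/-- A multiplicative bound along the uniform random reduced word. -/
theorem sum_words_le {f : List (α × Bool) → ℝ} {K : ℕ → ℝ}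
    (hK : ∀ q, 0 ≤ K q) (m : ℕ)
    (h : ∀ L : List (α × Bool), L.length < m →
      ∑ a ∈ ext L, f (a :: L) ≤ (ext L).card * (K L.length * f L)) :
    ∑ L ∈ words m, f L ≤ (∏ q ∈ Finset.range m, K q) * ((words (α := α) m).card * f []) := by
  induction m with
  | zero => simp [words]
  | succ m ih =>
    have ih := ih fun L hL => h L (by lia)
    rw [sum_words_succ, Finset.prod_range_succ]
    have hcard : ∃ D : ℝ, 0 ≤ D ∧ ∀ L ∈ words (α := α) m, ((ext L).card : ℝ) = D := by
      by_cases hne : (words (α := α) m).Nonempty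
      · obtain ⟨L, hL⟩ := hne
        refine ⟨(ext L).card, Nat.cast_nonneg _, fun L' hL' => ?_⟩
        rw [card_ext_of_length ((mem_words.1 hL').2.trans (mem_words.1 hL).2.symm)]
      · exact ⟨0, le_rfl, fun L hL => absurd ⟨L, hL⟩ hne⟩
    obtain ⟨D, hD0, hD⟩ := hcard
    have hw : ((words (α := α) (m + 1)).card : ℝ) = (words (α := α) m).card * D := by
      have := sum_words_succ (α := α) m fun _ => 1
      simp only [Finset.sum_const, nsmul_eq_mul, mul_one] at this
      rw [this, Finset.sum_congr rfl hD]; simp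
    rw [hw]
    calc ∑ L ∈ words m, ∑ a ∈ ext L, f (a :: L) ≤ ∑ L ∈ words m, D * (K m * f L) := by
          refine Finset.sum_le_sum fun L hL => ?_
          have := h L (by rw [(mem_words.1 hL).2]; lia)
          rwa [hD L hL, (mem_words.1 hL).2] at this
      _ = D * K m * ∑ L ∈ words m, f L := by rw [Finset.mul_sum]; simp only [mul_assoc]
      _ ≤ D * K m * ((∏ q ∈ Finset.range m, K q) * ((words (α := α) m).card * f [])) :=
          mul_le_mul_of_nonneg_left ih (mul_nonneg hD0 (hK m))
      _ = _ := by ring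

/-- The proportion of letters which survive when one of at most `2 * card α` is excluded. -/
def shrink (α : Type*) [Fintype α] : ℝ := 1 - 1 / (2 * Fintype.card α)

omit [DecidableEq α] in
theorem shrink_nonneg (hα : 2 ≤ Fintype.card α) : 0 ≤ shrink α := by
  have hk2 : (2 : ℝ) ≤ Fintype.card α := by exact_mod_cast hα
  unfold shrink
  rw [sub_nonneg, div_le_one (by linarith)]; linarith

/-- If in each position of a window of length `h` at least one letter is excluded by the letters to
its right, then the proportion of such words is exponentially small in `h`. -/
theorem card_window_le (hα : 2 ≤ Fintype.card α) (m s h : ℕ) (hs : s + h ≤ m)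
    (D : ℕ → List (α × Bool) → α × Bool → Prop)
    (hD : ∀ p T, ∃ a ∈ ext T, ¬ D p T a) (E : List (α × Bool) → Prop) [DecidablePred E]
    (hE : ∀ L, E L → ∀ p a, s ≤ p → p < s + h → L[p]? = some a → D p (L.drop (p + 1)) a) :
    (((words (α := α) m).filter E).card : ℝ) ≤ shrink α ^ h * (words (α := α) m).card := by
  classical
  have hk2 : (2 : ℝ) ≤ Fintype.card α := by exact_mod_cast hα
  have hρ0 : 0 ≤ shrink α := shrink_nonneg hα
  set I : Finset ℕ := (Finset.range m).filter fun q => s ≤ m - 1 - q ∧ m - 1 - q < s + h with hI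
  set f : List (α × Bool) → ℝ := fun L => if ∀ p < L.length, ∀ a, L[p]? = some a →
    L.length - 1 - p ∈ I → D (m - L.length + p) (L.drop (p + 1)) a then 1 else 0 with hf
  set K : ℕ → ℝ := fun q => if q ∈ I then shrink α else 1 with hK
  have hrec : ∀ (L : List (α × Bool)) a, L.length < m → f (a :: L) =
      if L.length ∈ I → D (m - 1 - L.length) L a then f L else 0 := by
    intro L a hL
    have hiff : (∀ p < (a :: L).length, ∀ b, (a :: L)[p]? = some b →
        (a :: L).length - 1 - p ∈ I → D (m - (a :: L).length + p) ((a :: L).drop (p + 1)) b) ↔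
        (L.length ∈ I → D (m - 1 - L.length) L a) ∧ ∀ p < L.length, ∀ b, L[p]? = some b →
          L.length - 1 - p ∈ I → D (m - L.length + p) (L.drop (p + 1)) b := by
      constructor
      · intro h
        refine ⟨fun h2 => ?_, fun p hp b hb hI => ?_⟩
        · have := h 0 (by simp) a rfl (by simpa using h2)
          simpa [Nat.sub_sub, add_comm] using this
        · have := h (p + 1) (by simpa using hp) b (by simpa using hb)
            (by simpa [Nat.sub_sub, add_comm] using hI)
          have e : m - (a :: L).length + (p + 1) = m - L.length + p := by simp; lia
          rw [e] at this
          simpa using this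
      · rintro ⟨h1, h2⟩ p hp b hb hI
        rcases p with _ | p
        · simp only [List.getElem?_cons_zero, Option.some.injEq] at hb
          subst hb
          have := h1 (by simpa using hI)
          simpa [Nat.sub_sub, add_comm] using this
        · have := h2 p (by simpa using hp) b (by simpa using hb)
            (by simpa [Nat.sub_sub, add_comm] using hI)
          have e : m - (a :: L).length + (p + 1) = m - L.length + p := by simp; lia
          rw [e]
          simpa using this
    simp only [hf]
    rw [if_congr hiff rfl rfl, ite_and]
  have hf0 : ∀ L, 0 ≤ f L := fun L => by simp only [hf]; split_ifs <;> norm_num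
  have hstep : ∀ L : List (α × Bool), L.length < m →
      ∑ a ∈ ext L, f (a :: L) ≤ (ext L).card * (K L.length * f L) := by
    intro L hL
    rw [Finset.sum_congr rfl fun a _ => hrec L a hL]
    by_cases hLI : L.length ∈ I
    · simp only [hLI, true_imp_iff, hK, if_true]
      obtain ⟨a₀, ha₀, hna₀⟩ := hD (m - 1 - L.length) L
      have hc0 : (0 : ℝ) < (ext L).card := by exact_mod_cast Finset.card_pos.2 ⟨a₀, ha₀⟩
      have hc1 : ((ext L).card : ℝ) ≤ 2 * Fintype.card α := by exact_mod_cast card_ext_le L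
      rw [← Finset.add_sum_erase _ _ ha₀, if_neg hna₀, zero_add]
      calc ∑ a ∈ (ext L).erase a₀, (if D (m - 1 - L.length) L a then f L else 0)
          ≤ ∑ a ∈ (ext L).erase a₀, f L := Finset.sum_le_sum fun a _ => by
            split_ifs
            · exact le_rfl
            · exact hf0 L
        _ = ((ext L).card - 1) * f L := by
            rw [Finset.sum_const, Finset.card_erase_of_mem ha₀, nsmul_eq_mul, Nat.cast_sub
              (by exact_mod_cast hc0), Nat.cast_one]
        _ ≤ (ext L).card * (shrink α * f L) := by
            rw [← mul_assoc]
            refine mul_le_mul_of_nonneg_right ?_ (hf0 L)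
            unfold shrink
            have : ((ext L).card : ℝ) * (1 / (2 * Fintype.card α)) ≤ 1 := by
              rw [mul_one_div, div_le_one (by linarith)]; exact hc1
            linarith
    · simp [hLI, hK]
  have hmain := sum_words_le (fun q => by simp only [hK]; split_ifs <;> first | exact hρ0 | norm_num)
    m hstep
  have hprod : ∏ q ∈ Finset.range m, K q = shrink α ^ h := by
    simp only [hK]
    rw [Finset.prod_ite, Finset.prod_const, Finset.prod_const_one, mul_one]
    congr 1
    have : (Finset.range m).filter (· ∈ I) = (Finset.Ico s (s + h)).image fun p => m - 1 - p := by
      ext q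
      simp only [hI, Finset.mem_filter, Finset.mem_range, Finset.mem_image, Finset.mem_Ico]
      constructor
      · rintro ⟨h1, -, h2, h3⟩
        exact ⟨m - 1 - q, ⟨h2, h3⟩, by lia⟩
      · rintro ⟨p, ⟨h1, h2⟩, rfl⟩
        exact ⟨by lia, by lia, by lia, by lia⟩
    rw [this, Finset.card_image_of_injOn]
    · simp
    · intro p hp p' hp' h
      simp only [Finset.coe_Ico, Set.mem_Ico] at hp hp'
      simp only at h
      lia
  have hfnil : f [] = 1 := by simp [hf]
  rw [hprod, hfnil, mul_one] at hmain
  refine le_trans ?_ hmain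
  rw [Finset.card_filter, Nat.cast_sum]
  refine Finset.sum_le_sum fun L hL => ?_
  split_ifs with hEL
  · have hl := (mem_words.1 hL).2
    simp only [hf]
    rw [if_pos]
    · simp
    · intro p hp a ha hI'
      rw [hl, hI, Finset.mem_filter] at hI'
      rw [hl, Nat.sub_self, zero_add]
      exact hE L hEL p a (by lia) (by lia) ha
  · simpa using hf0 L

end Counting

section Coincidence
variable {α : Type*} [DecidableEq α] [Fintype α]

omit [DecidableEq α] [Fintype α] in
theorem length_invRev (L : List (α × Bool)) : (invRev L).length = L.length := by simp [invRev]

/-- The subwords of length `ℓ` at position `s` of `L` and `t` of `L'` differ by the relabelling `σ`. -/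
def Match (σ : Equiv.Perm (α × Bool)) (ℓ : ℕ) (L L' : List (α × Bool)) (s t : ℕ) : Prop :=
  s + ℓ ≤ L.length ∧ t + ℓ ≤ L'.length ∧ ∀ i < ℓ, L[s + i]? = L'[t + i]?.map σ

variable {σ : Equiv.Perm (α × Bool)} {ℓ : ℕ} {L L' : List (α × Bool)} {s t : ℕ}

omit [DecidableEq α] [Fintype α] in
theorem Match.symm (h : Match σ ℓ L L' s t) : Match σ⁻¹ ℓ L' L t s := by
  refine ⟨h.2.1, h.1, fun i hi => ?_⟩
  rw [h.2.2 i hi, Option.map_map]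
  have : (σ⁻¹ : Equiv.Perm (α × Bool)) ∘ σ = id := by ext1 a; simp
  rw [this, Option.map_id, id]

omit [DecidableEq α] [Fintype α] in
theorem Match.invRev (hσ : ∀ a, σ (bar a) = bar (σ a)) (h : Match σ ℓ L L' s t) :
    Match σ ℓ (FreeGroup.invRev L) (FreeGroup.invRev L') (L.length - s - ℓ)
      (L'.length - t - ℓ) := by
  obtain ⟨h1, h2, h3⟩ := h
  refine ⟨by rw [length_invRev]; lia, by rw [length_invRev]; lia, fun i hi => ?_⟩
  have h4 := h3 (ℓ - 1 - i) (by lia)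
  have hx : L.length - 1 - (L.length - s - ℓ + i) = s + (ℓ - 1 - i) := by lia
  have hy : L'.length - 1 - (L'.length - t - ℓ + i) = t + (ℓ - 1 - i) := by lia
  rw [getElem_invRev _ _ (by lia), getElem_invRev _ _ (by lia)]
  simp only [hx, hy]
  rw [List.getElem?_eq_getElem (by lia), List.getElem?_eq_getElem (by lia)] at h4
  simp only [Option.map_some, Option.some.injEq] at h4 ⊢
  rw [h4, hσ]

open Classical in
theorem card_window_le_of_determined (hα : 2 ≤ Fintype.card α) (m s h : ℕ) (hs : s + h ≤ m)
    (g : ℕ → List (α × Bool) → Option (α × Bool)) (E : List (α × Bool) → Prop)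
    (hE : ∀ L, L.length = m → E L → ∀ p, s ≤ p → p < s + h → L[p]? = g p (L.drop (p + 1))) :
    (((words (α := α) m).filter E).card : ℝ) ≤ shrink α ^ h * (words (α := α) m).card := by
  have := card_window_le hα m s h hs (fun p T a => g p T = some a) (fun p T => ?_)
    (fun L => L.length = m ∧ E L) (fun L hL p a h1 h2 h3 => by rw [← hE L hL.1 hL.2 p h1 h2, h3])
  · convert this using 3
    refine Finset.filter_congr fun L hL => ?_
    simp [(mem_words.1 hL).2]
  · have h2 : 1 < (ext T).card := by have := le_card_ext T; lia
    obtain ⟨a, ha, b, hb, hab⟩ := Finset.one_lt_card.1 h2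
    by_cases h : g p T = some a
    · exact ⟨b, hb, by rw [h]; simpa using hab⟩
    · exact ⟨a, ha, h⟩

open Classical in
theorem card_match_const_le (hα : 2 ≤ Fintype.card α) (m : ℕ) (σ : Equiv.Perm (α × Bool)) (ℓ : ℕ)
    (L' : List (α × Bool)) (s t : ℕ) :
    (((words (α := α) m).filter fun L => Match σ ℓ L L' s t).card : ℝ) ≤
      shrink α ^ ℓ * (words (α := α) m).card := by
  by_cases hs : s + ℓ ≤ m
  · refine card_window_le_of_determined hα m s ℓ hs (fun p _ => L'[t + (p - s)]?.map σ) _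
      fun L hL h p h1 h2 => ?_
    rw [← h.2.2 _ (by lia)]
    congr 1; lia
  · rw [Finset.filter_false_of_mem]
    · have : 0 ≤ shrink α := shrink_nonneg hα
      simp; positivity
    · intro L hL h
      have := h.1; have := (mem_words.1 hL).2
      lia

open Classical in
theorem card_match_self_le (hα : 2 ≤ Fintype.card α) (m : ℕ) (σ : Equiv.Perm (α × Bool)) (ℓ : ℕ)
    (hσ : ∀ a, σ (bar a) = bar (σ a)) (s t : ℕ) (hne : ¬ (σ = 1 ∧ s = t)) :
    (((words (α := α) m).filter fun L => Match σ ℓ L L s t).card : ℝ) ≤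
      shrink α ^ ℓ * (words (α := α) m).card := by
  have key : ∀ (σ : Equiv.Perm (α × Bool)) (s t : ℕ), s < t →
      (((words (α := α) m).filter fun L => Match σ ℓ L L s t).card : ℝ) ≤
      shrink α ^ ℓ * (words (α := α) m).card := by
    intro σ s t hst
    by_cases hs : s + ℓ ≤ m
    · refine card_window_le_of_determined hα m s ℓ hs (fun p T => T[t - s - 1]?.map σ) _
        fun L hL h p h1 h2 => ?_
      have := h.2.2 (p - s) (by lia)
      rw [List.getElem?_drop]
      convert this using 3 <;> lia
    · rw [Finset.filter_false_of_mem]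
      · have : 0 ≤ shrink α := shrink_nonneg hα
        simp; positivity
      · intro L hL h
        have := h.1; have := (mem_words.1 hL).2
        lia
  rcases lt_trichotomy s t with h | rfl | h
  · exact key σ s t h
  · have hσ1 : σ ≠ 1 := fun h => hne ⟨h, rfl⟩
    obtain ⟨a, ha⟩ : ∃ a, σ a ≠ a := by
      by_contra hcon
      push Not at hcon
      exact hσ1 (Equiv.ext hcon)
    by_cases hs : s + ℓ ≤ m
    · refine card_window_le hα m s ℓ hs (fun _ _ b => σ b = b) (fun p T => ?_) _
        (fun L hL p b h1 h2 hb => ?_)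
      · by_cases hT : a ∈ ext T
        · exact ⟨a, hT, ha⟩
        · refine ⟨bar a, ?_, by rw [hσ]; exact fun h => ha (bar_injective h)⟩
          rw [mem_ext] at hT ⊢
          push Not at hT
          obtain ⟨b, hb, rfl⟩ := hT
          intro c hc
          rw [Option.mem_def] at hb hc
          rw [hb] at hc
          cases hc
          rw [bar_bar]
          exact bar_ne a
      · have := hL.2.2 (p - s) (by lia)
        have e : s + (p - s) = p := by lia
        rw [e, hb] at this
        simpa using this.symm
    · rw [Finset.filter_false_of_mem]
      · have : 0 ≤ shrink α := shrink_nonneg hα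
        simp; positivity
      · intro L hL h
        have := h.1; have := (mem_words.1 hL).2
        lia
  · refine le_trans ?_ (key σ⁻¹ t s h)
    exact_mod_cast Finset.card_le_card fun L hL => by
      rw [Finset.mem_filter] at hL ⊢
      exact ⟨hL.1, Match.symm hL.2⟩

open Classical in
theorem card_match_invRev_le (hα : 2 ≤ Fintype.card α) (m : ℕ) (σ : Equiv.Perm (α × Bool)) (ℓ : ℕ)
    (s t : ℕ) :
    (((words (α := α) m).filter fun L => Match σ ℓ L (FreeGroup.invRev L) s t).card : ℝ) ≤
      shrink α ^ (ℓ / 2) * (words (α := α) m).card := by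
  by_cases hs : s + ℓ ≤ m ∧ t + ℓ ≤ m
  · obtain ⟨hs, ht⟩ := hs
    rcases Nat.eq_zero_or_pos ℓ with rfl | hℓ
    · have : ((words (α := α) m).filter fun L => Match σ 0 L (FreeGroup.invRev L) s t).card ≤
        (words (α := α) m).card := Finset.card_filter_le _ _
      simpa using this
    obtain ⟨c, hc⟩ : ∃ c, c = m - 1 - t := ⟨_, rfl⟩
    have hL : ∀ L : List (α × Bool), L.length = m → Match σ ℓ L (FreeGroup.invRev L) s t →
        ∀ i < ℓ, L[s + i]? = L[c - i]?.map fun a => σ (bar a) := by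
      intro L hLm h i hi
      rw [h.2.2 i hi, getElem_invRev _ _ (by lia)]
      have e : L.length - 1 - (t + i) = c - i := by lia
      simp only [e]
      rw [List.getElem?_eq_getElem (by lia)]
      rfl
    by_cases hcase : s + 2 * (ℓ / 2) ≤ c + 1
    · refine card_window_le_of_determined hα m s (ℓ / 2) (by lia)
        (fun p T => T[c + s - 2 * p - 1]?.map fun a => σ (bar a)) _ fun L hLm h p h1 h2 => ?_
      have := hL L hLm h (p - s) (by lia)
      rw [List.getElem?_drop]
      convert this using 3 <;> lia
    · refine card_window_le_of_determined hα m (c + 1 - 2 * (ℓ / 2)) (ℓ / 2) (by lia)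
        (fun p T => T[c + s - 2 * p - 1]?.map fun a => bar (σ⁻¹ a)) _ fun L hLm h p h1 h2 => ?_
      have h3 := hL L hLm h (c - p) (by lia)
      have e1 : c - (c - p) = p := by lia
      have e2 : p + 1 + (c + s - 2 * p - 1) = s + (c - p) := by lia
      rw [e1] at h3
      rw [List.getElem?_drop, e2, h3, Option.map_map]
      have : (fun a => bar (σ⁻¹ a)) ∘ (fun a => σ (bar a)) = id := by ext1 a; simp
      rw [this, Option.map_id, id]
  · rw [Finset.filter_false_of_mem]
    · have : 0 ≤ shrink α := shrink_nonneg hα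
      simp; positivity
    · intro L hL h
      have h1 := h.1; have h2 := h.2.1; have := (mem_words.1 hL).2
      rw [length_invRev] at h2
      lia

end Coincidence

section Concentration
variable {α : Type*} [DecidableEq α]

omit [DecidableEq α] in
theorem crossCount_le_invRev (J : Finset (α × Bool)) (L : List (α × Bool)) :
    crossCount J L ≤ crossCount J (invRev L) := by
  classical
  unfold crossCount
  refine Finset.card_le_card_of_injOn (fun i => L.length - 2 - i) ?_ ?_
  · intro i hi
    rw [Finset.mem_coe, Finset.mem_filter, Finset.mem_range] at hi ⊢
    obtain ⟨h1, a, b, ha, hb, h⟩ := hi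
    have h2 : i + 1 < L.length := by
      by_contra hcon
      rw [List.getElem?_eq_none (by lia)] at hb
      cases hb
    refine ⟨by rw [length_invRev]; lia, bar b, bar a, ?_, ?_, ?_⟩
    · rw [getElem_invRev _ _ (by lia)]
      have e : L.length - 1 - (L.length - 2 - i) = i + 1 := by lia
      simp only [e]
      rw [List.getElem?_eq_getElem h2] at hb
      simpa using congrArg (Option.map bar) hb
    · rw [getElem_invRev _ _ (by lia)]
      have e : L.length - 1 - (L.length - 2 - i + 1) = i := by lia
      simp only [e]
      rw [List.getElem?_eq_getElem h1] at ha
      simpa using congrArg (Option.map bar) ha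
    · rw [bar_bar, iff_comm]; exact h
  · intro i hi j hj h
    rw [Finset.mem_coe, Finset.mem_filter, Finset.mem_range] at hi hj
    obtain ⟨h1, a, b, ha, hb, -⟩ := hi
    obtain ⟨h3, a', b', ha', hb', -⟩ := hj
    have h2 : i + 1 < L.length := by
      by_contra hcon
      rw [List.getElem?_eq_none (by lia)] at hb
      cases hb
    have h4 : j + 1 < L.length := by
      by_contra hcon
      rw [List.getElem?_eq_none (by lia)] at hb'
      cases hb'
    simp only at h
    lia

omit [DecidableEq α] in
theorem crossCount_invRev (J : Finset (α × Bool)) (L : List (α × Bool)) :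
    crossCount J (invRev L) = crossCount J L := by
  refine le_antisymm ?_ (crossCount_le_invRev J L)
  conv_rhs => rw [← invRev_invRev (L₁ := L)]
  exact crossCount_le_invRev J (invRev L)

omit [DecidableEq α] in
theorem crossCount_of_length_le_one (J : Finset (α × Bool)) {L : List (α × Bool)}
    (hL : L.length ≤ 1) : crossCount J L = 0 := by
  classical
  unfold crossCount
  rw [Finset.card_eq_zero, Finset.filter_eq_empty_iff]
  rintro i - ⟨a, b, ha, hb, -⟩
  rw [List.getElem?_eq_none (by lia)] at hb
  cases hb

theorem crossCount_cons_cons (J : Finset (α × Bool)) (a c : α × Bool) (L : List (α × Bool)) :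
    crossCount J (a :: c :: L) = (if c ∈ J ↔ bar a ∈ J then 0 else 1) + crossCount J (c :: L) := by
  classical
  unfold crossCount
  rw [Finset.card_filter, List.length_cons, Finset.sum_range_succ', Finset.card_filter, add_comm]
  congr 1
  have : CrossAt J (a :: c :: L) 0 ↔ ¬ (c ∈ J ↔ bar a ∈ J) := by
    constructor
    · rintro ⟨a', b', ha, hb, h⟩
      simp only [List.getElem?_cons_zero, zero_add, List.getElem?_cons_succ,
        Option.some.injEq] at ha hb
      subst ha hb
      exact h
    · exact fun h => ⟨a, c, rfl, rfl, h⟩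
  simp only [this, ite_not]

variable [Fintype α]

/-- The corrector turning the crossing count of a random reduced word into a martingale. -/
def corrector (J : Finset (α × Bool)) (c : α × Bool) : ℝ :=
  (2 * Fintype.card α - 1) * (2 * Fintype.card α - 2 * J.card) /
      ((2 * Fintype.card α - 2) * (2 * Fintype.card α)) * (if c ∈ J then 1 else 0) -
    (2 * Fintype.card α - 2 * J.card) / ((2 * Fintype.card α - 2) * (2 * Fintype.card α)) *
      (if bar c ∈ J then 1 else 0)

theorem abs_corrector_le (hα : 2 ≤ Fintype.card α) (J : Finset (α × Bool)) (c : α × Bool) :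
    |corrector J c| ≤ 2 := by
  have hk : (2 : ℝ) ≤ Fintype.card α := by exact_mod_cast hα
  have hj0 : (0 : ℝ) ≤ J.card := Nat.cast_nonneg _
  have hj : (J.card : ℝ) ≤ 2 * Fintype.card α := by
    have := Finset.card_le_univ J
    rw [Fintype.card_prod, Fintype.card_bool] at this
    have h2 : (J.card : ℝ) ≤ Fintype.card α * 2 := by exact_mod_cast this
    linarith
  set k : ℝ := (Fintype.card α : ℝ)
  set r : ℝ := (2 * k - 2 * J.card) / ((2 * k - 2) * (2 * k)) with hr
  have hr1 : |r| ≤ 1 / (2 * k - 2) := by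
    rw [hr, abs_div, abs_of_pos (show 0 < (2 * k - 2) * (2 * k) by nlinarith),
      div_le_div_iff₀ (by nlinarith) (by linarith)]
    have : |2 * k - 2 * (J.card : ℝ)| ≤ 2 * k := abs_le.2 ⟨by linarith, by linarith⟩
    nlinarith
  have hr2 : |(2 * k - 1) * r| ≤ 3 / 2 := by
    rw [abs_mul, abs_of_pos (show 0 < 2 * k - 1 by linarith)]
    refine (mul_le_mul_of_nonneg_left hr1 (by linarith)).trans ?_
    rw [mul_one_div, div_le_div_iff₀ (by linarith) (by norm_num)]
    linarith
  have hr3 : |r| ≤ 1 / 2 := hr1.trans (one_div_le_one_div_of_le (by norm_num) (by linarith))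
  have e : corrector J c = (2 * k - 1) * r * (if c ∈ J then 1 else 0) -
      r * (if bar c ∈ J then 1 else 0) := by
    unfold corrector
    rw [hr]; ring
  rw [e]
  rw [abs_le] at hr2 hr3 ⊢
  split_ifs <;> constructor <;> linarith

/-- One-step increment of the corrected crossing count. -/
def increment (J : Finset (α × Bool)) (c a : α × Bool) : ℝ :=
  (if c ∈ J ↔ bar a ∈ J then 0 else 1) - freq J + corrector J a - corrector J c

theorem abs_increment_le (hα : 2 ≤ Fintype.card α) (J : Finset (α × Bool)) (c a : α × Bool) :
    |increment J c a| ≤ 5 := by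
  have h1 := abs_le.1 (abs_corrector_le hα J c)
  have h2 := abs_le.1 (abs_corrector_le hα J a)
  have h3 := freq_nonneg_le_one hα J
  unfold increment
  rw [abs_le]
  split_ifs <;> constructor <;> linarith [h3.1, h3.2]

theorem sum_increment (hα : 2 ≤ Fintype.card α) (J : Finset (α × Bool)) (c : α × Bool) :
    ∑ a ∈ Finset.univ.erase (bar c), increment J c a = 0 := by
  have hk : (2 : ℝ) ≤ Fintype.card α := by exact_mod_cast hα
  set u : ℝ := if c ∈ J then 1 else 0 with hu
  set v : ℝ := if bar c ∈ J then 1 else 0 with hv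
  have hJ : ∑ a, (if a ∈ J then (1 : ℝ) else 0) = J.card := by simp
  have h1 : ∑ a ∈ Finset.univ.erase (bar c), (if a ∈ J then (1 : ℝ) else 0) = J.card - v := by
    rw [← hJ, ← Finset.add_sum_erase _ _ (Finset.mem_univ (bar c))]; ring
  have hJ2 : ∑ a, (if bar a ∈ J then (1 : ℝ) else 0) = J.card := by
    rw [← hJ]
    exact Function.Bijective.sum_comp (Function.Involutive.bijective bar_bar)
      (fun a => if a ∈ J then (1 : ℝ) else 0)
  have h2 : ∑ a ∈ Finset.univ.erase (bar c), (if bar a ∈ J then (1 : ℝ) else 0) = J.card - u := by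
    rw [← hJ2, ← Finset.add_sum_erase _ _ (Finset.mem_univ (bar c)), bar_bar]; ring
  have h3 : ((Finset.univ.erase (bar c)).card : ℝ) = 2 * Fintype.card α - 1 := by
    rw [Finset.card_erase_of_mem (Finset.mem_univ _), Finset.card_univ, Fintype.card_prod,
      Fintype.card_bool, Nat.cast_sub (by lia)]
    push_cast; ring
  have hX : ∀ a, (if c ∈ J ↔ bar a ∈ J then (0 : ℝ) else 1) =
      u + (1 - 2 * u) * (if bar a ∈ J then 1 else 0) := by
    intro a
    rw [hu]
    by_cases h : c ∈ J <;> by_cases h' : bar a ∈ J <;> simp [h, h']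
    norm_num
  have huu : u * u = u := by rw [hu]; split_ifs <;> simp
  simp only [increment, hX]
  unfold corrector
  rw [← hu, ← hv]
  simp only [Finset.sum_sub_distrib, Finset.sum_add_distrib, ← Finset.mul_sum, Finset.sum_const,
    nsmul_eq_mul, h1, h2, h3]
  unfold freq
  set k : ℝ := (Fintype.card α : ℝ)
  have e1 : (2 * k - 2) ≠ 0 := by linarith
  have e2 : k ≠ 0 := by linarith
  have e3 : 2 * k - 1 ≠ 0 := by linarith
  have e4 : k - 1 ≠ 0 := by linarith
  have e5 : 2 * k - 2 = 2 * (k - 1) := by ring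
  rw [e5]
  field_simp
  linear_combination (4 * k ^ 2 - 4 * k) * huu

end Concentration

section Chernoff
variable {α : Type*} [DecidableEq α] [Fintype α]

/-- The exponential moment function of the corrected crossing count. -/
def expMoment (J : Finset (α × Bool)) (z : ℝ) (L : List (α × Bool)) : ℝ :=
  Real.exp (z * (crossCount J L - freq J * L.length + (L.head?.map (corrector J)).getD 0))

theorem sum_expMoment_le (hα : 2 ≤ Fintype.card α) (J : Finset (α × Bool)) {z : ℝ}
    (hz : |z| ≤ 1 / 5) (m : ℕ) :
    ∑ L ∈ words m, expMoment J z L ≤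
      Real.exp (1 + 25 * z ^ 2 * m) * (words (α := α) m).card := by
  have hexp : ∀ y : ℝ, |y| ≤ 1 → Real.exp y ≤ 1 + y + y ^ 2 := fun y hy => by
    have := (abs_le.1 (Real.abs_exp_sub_one_sub_id_le hy)).2
    linarith
  set K : ℕ → ℝ := fun q => if q = 0 then Real.exp 1 else Real.exp (25 * z ^ 2) with hK
  have hK0 : ∀ q, 0 ≤ K q := fun q => by simp only [hK]; split_ifs <;> positivity
  have hstep : ∀ L : List (α × Bool), L.length < m →
      ∑ a ∈ ext L, expMoment J z (a :: L) ≤ (ext L).card * (K L.length * expMoment J z L) := by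
    rintro (_ | ⟨c, L⟩) -
    · have hb : ∀ a ∈ ext ([] : List (α × Bool)), expMoment J z [a] ≤ Real.exp 1 := by
        intro a _
        unfold expMoment
        rw [Real.exp_le_exp, crossCount_of_length_le_one J (by simp)]
        have h2 := abs_le.1 (abs_corrector_le hα J a)
        have h3 := freq_nonneg_le_one hα J
        simp only [List.head?_cons, Option.map_some, Option.getD_some, List.length_singleton,
          Nat.cast_zero, Nat.cast_one]
        refine (le_abs_self _).trans ?_
        rw [abs_mul]
        have : |0 - freq J * 1 + corrector J a| ≤ 5 := by
          rw [abs_le]; constructor <;> linarith [h3.1, h3.2]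
        calc |z| * |0 - freq J * 1 + corrector J a| ≤ 1 / 5 * 5 := by gcongr
          _ = 1 := by norm_num
      refine (Finset.sum_le_card_nsmul _ _ _ hb).trans (le_of_eq ?_)
      rw [nsmul_eq_mul]
      simp [hK, expMoment, crossCount_of_length_le_one]
    · have hrec : ∀ a, expMoment J z (a :: c :: L) =
          Real.exp (z * increment J c a) * expMoment J z (c :: L) := by
        intro a
        unfold expMoment
        rw [← Real.exp_add, crossCount_cons_cons]
        congr 1
        simp only [increment, List.head?_cons, Option.map_some, Option.getD_some, List.length_cons]
        push_cast
        ring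
      simp only [hrec, ← Finset.sum_mul]
      rw [← mul_assoc]
      refine mul_le_mul_of_nonneg_right ?_ (by unfold expMoment; positivity)
      have hq : ∀ a ∈ Finset.univ.erase (bar c), Real.exp (z * increment J c a) ≤
          1 + z * increment J c a + 25 * z ^ 2 := by
        intro a _
        have h1 := abs_increment_le hα J c a
        have h2 : |z * increment J c a| ≤ 1 := by
          rw [abs_mul]
          calc |z| * |increment J c a| ≤ 1 / 5 * 5 := by gcongr
            _ = 1 := by norm_num
        refine (hexp _ h2).trans ?_
        have h3 : increment J c a ^ 2 ≤ 25 := by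
          rw [← sq_abs]
          nlinarith [abs_nonneg (increment J c a)]
        rw [mul_pow]
        nlinarith [sq_nonneg z]
      rw [ext_cons]
      refine (Finset.sum_le_sum hq).trans ?_
      rw [Finset.sum_add_distrib, Finset.sum_add_distrib, ← Finset.mul_sum, sum_increment hα]
      simp only [Finset.sum_const, nsmul_eq_mul, mul_one, mul_zero, add_zero, hK,
        List.length_cons, Nat.add_one_ne_zero, if_false]
      rw [← mul_one_add]
      refine mul_le_mul_of_nonneg_left ?_ (Nat.cast_nonneg _)
      linarith [Real.add_one_le_exp (25 * z ^ 2)]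
  refine (sum_words_le hK0 m hstep).trans ?_
  have h0 : expMoment J z [] = 1 := by
    simp [expMoment, crossCount_of_length_le_one]
  rw [h0, mul_one]
  refine mul_le_mul_of_nonneg_right ?_ (Nat.cast_nonneg _)
  rw [Real.exp_add, mul_comm (25 * z ^ 2), Real.exp_nat_mul]
  have h1 : (1 : ℝ) ≤ Real.exp (25 * z ^ 2) := Real.one_le_exp (by positivity)
  rcases m with _ | m
  · simp
  · rw [Finset.prod_range_succ', pow_succ]
    simp only [hK, Nat.add_one_ne_zero, if_false, if_true, Finset.prod_const, Finset.card_range]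
    have h2 : 0 ≤ Real.exp (25 * z ^ 2) ^ m * Real.exp 1 := by positivity
    nlinarith

open Classical in
theorem card_cross_le (hα : 2 ≤ Fintype.card α) (J : Finset (α × Bool)) {ε : ℝ} (hε0 : 0 < ε)
    (hε1 : ε ≤ 1) (m : ℕ) :
    (((words (α := α) m).filter fun L => ¬ |(crossCount J L : ℝ) - freq J * L.length| ≤
      ε * L.length).card : ℝ) ≤
      2 * Real.exp (2 - ε ^ 2 / 100 * m) * (words (α := α) m).card := by
  have key : ∀ z : ℝ, |z| = ε / 50 →
      (((words (α := α) m).filter fun L => ε / 50 * (ε * m) ≤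
        z * ((crossCount J L : ℝ) - freq J * L.length)).card : ℝ) ≤
      Real.exp (2 - ε ^ 2 / 100 * m) * (words (α := α) m).card := by
    intro z hz
    have h1 := sum_expMoment_le hα J (z := z) (by rw [hz]; linarith) m
    have h2 : ∀ L ∈ (words (α := α) m).filter fun L => ε / 50 * (ε * m) ≤
        z * ((crossCount J L : ℝ) - freq J * L.length),
        Real.exp (ε / 50 * (ε * m) - 1) ≤ expMoment J z L := by
      intro L hL
      rw [Finset.mem_filter] at hL
      unfold expMoment
      rw [Real.exp_le_exp, mul_add]
      have h3 : |(L.head?.map (corrector J)).getD 0| ≤ 2 := by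
        rcases L with _ | ⟨c, L⟩
        · simp
        · simpa using abs_corrector_le hα J c
      have h4 : |z * (L.head?.map (corrector J)).getD 0| ≤ 1 := by
        rw [abs_mul]
        have h6 : |z| ≤ 1 / 2 := by rw [hz]; linarith
        calc |z| * |(L.head?.map (corrector J)).getD 0| ≤ 1 / 2 * 2 := by gcongr
          _ = 1 := by norm_num
      have := (abs_le.1 h4).1
      linarith [hL.2]
    have h3 := Finset.card_nsmul_le_sum _ _ _ h2
    have h4 : ∑ L ∈ (words (α := α) m).filter fun L => ε / 50 * (ε * m) ≤
        z * ((crossCount J L : ℝ) - freq J * L.length), expMoment J z L ≤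
        ∑ L ∈ words m, expMoment J z L :=
      Finset.sum_le_sum_of_subset_of_nonneg (Finset.filter_subset _ _)
        fun L _ _ => by unfold expMoment; positivity
    rw [nsmul_eq_mul] at h3
    have h5 := h3.trans (h4.trans h1)
    rw [← le_div_iff₀ (Real.exp_pos _), mul_div_right_comm, ← Real.exp_sub] at h5
    refine h5.trans (le_of_eq ?_)
    congr 2
    rw [← sq_abs z, hz]
    ring
  have h1 := key (ε / 50) (abs_of_pos (by linarith))
  have h2 := key (-(ε / 50)) (by rw [abs_neg]; exact abs_of_pos (by linarith))
  have hsub : ((words (α := α) m).filter fun L => ¬ |(crossCount J L : ℝ) - freq J * L.length| ≤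
      ε * L.length) ⊆ ((words (α := α) m).filter fun L => ε / 50 * (ε * m) ≤
        ε / 50 * ((crossCount J L : ℝ) - freq J * L.length)) ∪
      ((words (α := α) m).filter fun L => ε / 50 * (ε * m) ≤
        -(ε / 50) * ((crossCount J L : ℝ) - freq J * L.length)) := by
    intro L hL
    rw [Finset.mem_union, Finset.mem_filter, Finset.mem_filter]
    have hL' := (Finset.mem_filter.1 hL).1
    rw [Finset.mem_filter, not_le, lt_abs, (mem_words.1 hL').2] at hL
    rw [(mem_words.1 hL').2]
    rcases hL with ⟨hL, h | h⟩
    · exact Or.inl ⟨hL, mul_le_mul_of_nonneg_left h.le (by linarith)⟩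
    · refine Or.inr ⟨hL, ?_⟩
      rw [neg_mul, ← mul_neg]
      exact mul_le_mul_of_nonneg_left h.le (by linarith)
  have h3 : (((words (α := α) m).filter fun L => ¬ |(crossCount J L : ℝ) - freq J * L.length| ≤
      ε * L.length).card : ℝ) ≤ _ :=
    Nat.cast_le.2 ((Finset.card_le_card hsub).trans (Finset.card_union_le _ _))
  push_cast at h3
  linarith

end Chernoff

section Radial
variable {k : ℕ}

instance {α : Type*} : DiscreteMeasurableSpace (FreeGroup α) := ⟨fun _ => trivial⟩

open Classical in
theorem measure_sphere_le {ν : Measure (FreeGroup (Fin k))} [IsProbabilityMeasure ν]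
    (hν : ∀ g g' : FreeGroup (Fin k), wlen g = wlen g' → ν {g} = ν {g'})
    {P : List (Fin k × Bool) → Prop} {η : ℝ} (hη : 0 ≤ η) (m : ℕ)
    (h : (((words (α := Fin k) m).filter P).card : ℝ) ≤ η * (words (α := Fin k) m).card) :
    ν {g | wlen g = m ∧ P (toWord g)} ≤ ENNReal.ofReal η * ν {g | wlen g = m} := by
  have hsum : ∀ Q : List (Fin k × Bool) → Prop, ν {g | wlen g = m ∧ Q (toWord g)} =
      ∑ L ∈ (words (α := Fin k) m).filter Q, ν {FreeGroup.mk L} := by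
    intro Q
    have : {g : FreeGroup (Fin k) | wlen g = m ∧ Q (toWord g)} =
        (((words (α := Fin k) m).filter Q).image FreeGroup.mk : Finset (FreeGroup (Fin k))) := by
      ext g
      simp only [Set.mem_ofPred_eq, Finset.coe_image, Set.mem_image, Finset.mem_coe,
        Finset.mem_filter, mem_words]
      constructor
      · rintro ⟨h1, h2⟩
        exact ⟨toWord g, ⟨⟨isReduced_toWord, h1⟩, h2⟩, mk_toWord⟩
      · rintro ⟨L, ⟨⟨h1, h2⟩, h3⟩, rfl⟩
        have : toWord (FreeGroup.mk L) = L := by rw [toWord_mk, h1.reduce_eq]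
        rw [wlen, this]
        exact ⟨h2, h3⟩
    rw [this, ← sum_measure_singleton, Finset.sum_image]
    intro L hL L' hL' hLL
    rw [Finset.mem_coe, Finset.mem_filter, mem_words] at hL hL'
    have := congrArg toWord hLL
    rwa [toWord_mk, toWord_mk, hL.1.1.reduce_eq, hL'.1.1.reduce_eq] at this
  obtain ⟨c, hc⟩ : ∃ c, ∀ L ∈ words (α := Fin k) m, ν {FreeGroup.mk L} = c := by
    by_cases hne : (words (α := Fin k) m).Nonempty
    · obtain ⟨L, hL⟩ := hne
      refine ⟨ν {FreeGroup.mk L}, fun L' hL' => hν _ _ ?_⟩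
      rw [mem_words] at hL hL'
      rw [wlen, wlen, toWord_mk, toWord_mk, hL.1.reduce_eq, hL'.1.reduce_eq, hL.2, hL'.2]
    · exact ⟨0, fun L hL => absurd ⟨L, hL⟩ hne⟩
  have h1 := hsum P
  have h2 := hsum fun _ => True
  simp only [and_true, Finset.filter_true] at h2
  rw [h1, h2, Finset.sum_congr rfl hc,
    Finset.sum_congr rfl fun L hL => hc L (Finset.mem_filter.1 hL).1]
  simp only [Finset.sum_const, nsmul_eq_mul]
  rw [← mul_assoc]
  gcongr
  have := ENNReal.ofReal_le_ofReal h
  rwa [ENNReal.ofReal_mul hη, ENNReal.ofReal_natCast, ENNReal.ofReal_natCast] at this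

open Classical in
/-- A bound on spheres transfers to any radially symmetric probability measure. -/
theorem measure_le_of_card_le {ν : Measure (FreeGroup (Fin k))} [IsProbabilityMeasure ν]
    (hν : ∀ g g' : FreeGroup (Fin k), wlen g = wlen g' → ν {g} = ν {g'})
    {P : List (Fin k × Bool) → Prop} {η : ℝ} (hη : 0 ≤ η)
    (h : ∀ m, (((words (α := Fin k) m).filter P).card : ℝ) ≤ η * (words (α := Fin k) m).card) :
    ν {g | P (toWord g)} ≤ ENNReal.ofReal η := by
  have h1 : {g : FreeGroup (Fin k) | P (toWord g)} = ⋃ m, {g | wlen g = m ∧ P (toWord g)} := by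
    ext g; simp
  have h2 : ∑' m, ν {g : FreeGroup (Fin k) | wlen g = m} = 1 := by
    rw [← measure_iUnion]
    · have : (⋃ m, {g : FreeGroup (Fin k) | wlen g = m}) = Set.univ := by
        ext g; simp
      rw [this, measure_univ]
    · intro m m' hm
      rw [Function.onFun, Set.disjoint_left]
      rintro g (hg : wlen g = m) (hg' : wlen g = m')
      exact hm (hg.symm.trans hg')
    · exact fun _ => trivial
  calc ν {g | P (toWord g)} ≤ ∑' m, ν {g | wlen g = m ∧ P (toWord g)} := by
        rw [h1]; exact measure_iUnion_le _
    _ ≤ ∑' m, ENNReal.ofReal η * ν {g | wlen g = m} :=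
        ENNReal.tsum_le_tsum fun m => measure_sphere_le hν hη m (h m)
    _ = ENNReal.ofReal η := by rw [ENNReal.tsum_mul_left, h2, mul_one]

end Radial

section Pairs
variable {k p : ℕ} {μ : Fin p → Measure (FreeGroup (Fin k))} [∀ i, IsProbabilityMeasure (μ i)]

theorem pi_apply_eval (i : Fin p) (S : Set (FreeGroup (Fin k))) :
    Measure.pi μ {w | w i ∈ S} = μ i S :=
  (measurePreserving_eval μ i).measure_preimage (MeasurableSet.of_discrete.nullMeasurableSet)

theorem pi_apply_pair_le {i j : Fin p} (hij : i ≠ j) {R : FreeGroup (Fin k) → FreeGroup (Fin k) → Prop}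
    {η : ENNReal} (h : ∀ y, μ i {x | R x y} ≤ η) :
    Measure.pi μ {w | R (w i) (w j)} ≤ η := by
  have hind := (ProbabilityTheory.iIndepFun_pi (μ := μ) (X := fun _ x => x)
    fun i => aemeasurable_id).indepFun hij
  rw [ProbabilityTheory.indepFun_iff_map_prod_eq_prod_map_map
    (measurable_pi_apply i).aemeasurable (measurable_pi_apply j).aemeasurable] at hind
  have e : ∀ i, Measure.map (fun w : Fin p → FreeGroup (Fin k) => w i) (Measure.pi μ) = μ i :=
    fun i => (measurePreserving_eval μ i).map_eq
  rw [e, e] at hind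
  have h2 : Measure.pi μ {w | R (w i) (w j)} = ((μ i).prod (μ j)) {q | R q.1 q.2} := by
    rw [← hind, Measure.map_apply (by fun_prop) MeasurableSet.of_discrete]
    rfl
  rw [h2, Measure.prod_apply_symm MeasurableSet.of_discrete]
  refine (lintegral_mono fun y => h y).trans ?_
  simp

end Pairs

section Signs
variable {α : Type*} [DecidableEq α] [Fintype α]

/-- The word `L` or its inverse, according to a sign. -/
def signed (e : Bool) (L : List (α × Bool)) : List (α × Bool) := bif e then L else invRev L

omit [DecidableEq α] [Fintype α] in
theorem length_signed (e : Bool) (L : List (α × Bool)) : (signed e L).length = L.length := by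
  cases e <;> simp [signed]

omit [Fintype α] in
theorem genWord_eq_signed {ι : Type*} (w : ι → FreeGroup α) (a : ι × Bool) :
    genWord w a = signed a.2 (toWord (w a.1)) := by
  have h : ∀ i, genWord w (i, true) = toWord (w i) := fun i => by
    rw [genWord, lt, FreeGroup.lift_mk]; simp
  obtain ⟨i, _ | _⟩ := a
  · have := genWord_bar w (i, true)
    rw [h] at this
    exact this
  · exact h i

variable {σ : Equiv.Perm (α × Bool)} {ℓ : ℕ} {s t : ℕ}

omit [DecidableEq α] in
theorem shrink_le_one : shrink α ≤ 1 := by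
  unfold shrink
  have : (0 : ℝ) ≤ 1 / (2 * Fintype.card α) := by positivity
  linarith

omit [DecidableEq α] in
theorem shrink_pow_le (hα : 2 ≤ Fintype.card α) (ℓ : ℕ) : shrink α ^ ℓ ≤ shrink α ^ (ℓ / 2) :=
  pow_le_pow_of_le_one (shrink_nonneg hα) shrink_le_one (Nat.div_le_self _ _)

open Classical in
theorem card_match_signed_const_le (hα : 2 ≤ Fintype.card α) (hσ : ∀ a, σ (bar a) = bar (σ a))
    (e : Bool) (L' : List (α × Bool)) (s t m : ℕ) :
    (((words (α := α) m).filter fun L => Match σ ℓ (signed e L) L' s t).card : ℝ) ≤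
      shrink α ^ (ℓ / 2) * (words (α := α) m).card := by
  cases e
  · have h1 := card_match_const_le hα m σ ℓ (invRev L') (m - s - ℓ) (L'.length - t - ℓ)
    refine le_trans ?_ (h1.trans
      (mul_le_mul_of_nonneg_right (shrink_pow_le hα ℓ) (Nat.cast_nonneg _)))
    refine Nat.cast_le.2 (Finset.card_le_card fun L hL => ?_)
    rw [Finset.mem_filter] at hL ⊢
    have h2 : Match σ ℓ (invRev L) L' s t := hL.2
    have := h2.invRev hσ
    rw [invRev_invRev, length_invRev, (mem_words.1 hL.1).2] at this
    exact ⟨hL.1, this⟩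
  · exact (card_match_const_le hα m σ ℓ L' s t).trans
      (mul_le_mul_of_nonneg_right (shrink_pow_le hα ℓ) (Nat.cast_nonneg _))

open Classical in
theorem card_match_signed_self_le (hα : 2 ≤ Fintype.card α) (hσ : ∀ a, σ (bar a) = bar (σ a))
    (e e' : Bool) (hne : ¬ (σ = 1 ∧ e = e' ∧ s = t)) (m : ℕ) :
    (((words (α := α) m).filter fun L => Match σ ℓ (signed e L) (signed e' L) s t).card : ℝ) ≤
      shrink α ^ (ℓ / 2) * (words (α := α) m).card := by
  cases e <;> cases e'
  · have key : ∀ L ∈ (words (α := α) m).filter fun L =>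
        Match σ ℓ (signed false L) (signed false L) s t,
        s + ℓ ≤ m ∧ t + ℓ ≤ m ∧ Match σ ℓ L L (m - s - ℓ) (m - t - ℓ) := by
      intro L hL
      rw [Finset.mem_filter] at hL
      have h2 : Match σ ℓ (invRev L) (invRev L) s t := hL.2
      have h3 := h2.1
      have h4 := h2.2.1
      have := h2.invRev hσ
      rw [length_invRev, (mem_words.1 hL.1).2] at h3 h4
      rw [invRev_invRev, length_invRev, (mem_words.1 hL.1).2] at this
      exact ⟨h3, h4, this⟩
    by_cases hb : s + ℓ ≤ m ∧ t + ℓ ≤ m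
    · refine le_trans ?_ ((card_match_self_le hα m σ ℓ hσ (m - s - ℓ) (m - t - ℓ) ?_).trans
        (mul_le_mul_of_nonneg_right (shrink_pow_le hα ℓ) (Nat.cast_nonneg _)))
      · refine Nat.cast_le.2 (Finset.card_le_card fun L hL => ?_)
        exact Finset.mem_filter.2 ⟨(Finset.mem_filter.1 hL).1, (key L hL).2.2⟩
      · rintro ⟨h1, h2⟩
        exact hne ⟨h1, rfl, by lia⟩
    · rw [Finset.eq_empty_of_forall_notMem
        fun L hL => hb ⟨(key L hL).1, (key L hL).2.1⟩]
      have := shrink_nonneg hα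
      simp; positivity
  · refine le_trans ?_ (card_match_invRev_le hα m σ ℓ (m - s - ℓ) (m - t - ℓ))
    refine Nat.cast_le.2 (Finset.card_le_card fun L hL => ?_)
    rw [Finset.mem_filter] at hL ⊢
    have h2 : Match σ ℓ (invRev L) L s t := hL.2
    have := h2.invRev hσ
    rw [invRev_invRev, length_invRev, (mem_words.1 hL.1).2] at this
    exact ⟨hL.1, this⟩
  · exact card_match_invRev_le hα m σ ℓ s t
  · refine (card_match_self_le hα m σ ℓ hσ s t ?_).trans
      (mul_le_mul_of_nonneg_right (shrink_pow_le hα ℓ) (Nat.cast_nonneg _))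
    exact fun h => hne ⟨h.1, rfl, h.2⟩

end Signs

section Probability
variable {k p : ℕ} {μ : Fin p → Measure (FreeGroup (Fin k))} [∀ i, IsProbabilityMeasure (μ i)]

theorem pi_match_le (hk : 2 ≤ k)
    (hμ : ∀ i (g g' : FreeGroup (Fin k)), wlen g = wlen g' → μ i {g} = μ i {g'})
    {σ : Equiv.Perm (Fin k × Bool)} (hσ : ∀ a, σ (bar a) = bar (σ a)) (ℓ : ℕ)
    (a b : Fin p × Bool) (s t : ℕ) (hne : ¬ (σ = 1 ∧ a = b ∧ s = t)) :
    Measure.pi μ {w | Match σ ℓ (genWord w a) (genWord w b) s t} ≤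
      ENNReal.ofReal (shrink (Fin k) ^ (ℓ / 2)) := by
  classical
  have hα : 2 ≤ Fintype.card (Fin k) := by simpa
  have h0 := pow_nonneg (shrink_nonneg hα) (ℓ / 2)
  obtain ⟨i, e⟩ := a
  obtain ⟨j, e'⟩ := b
  simp only [genWord_eq_signed]
  by_cases hij : i = j
  · subst hij
    have h1 := pi_apply_eval (μ := μ) i
      {g | Match σ ℓ (signed e (toWord g)) (signed e' (toWord g)) s t}
    simp only [Set.mem_ofPred_eq] at h1
    rw [h1]
    exact measure_le_of_card_le (hμ i) (P := fun L => Match σ ℓ (signed e L) (signed e' L) s t) h0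
      fun m => card_match_signed_self_le hα hσ e e' (by simpa using hne) m
  · exact pi_apply_pair_le hij (R := fun x y => Match σ ℓ (signed e (toWord x))
      (signed e' (toWord y)) s t) fun y =>
      measure_le_of_card_le (hμ i) (P := fun L => Match σ ℓ (signed e L) _ s t) h0
        fun m => card_match_signed_const_le hα hσ e _ s t m

theorem measure_cross_le (hk : 2 ≤ k) {ν : Measure (FreeGroup (Fin k))} [IsProbabilityMeasure ν]
    (hν : ∀ g g' : FreeGroup (Fin k), wlen g = wlen g' → ν {g} = ν {g'})
    (J : Finset (Fin k × Bool)) {ε : ℝ} (hε0 : 0 < ε) (hε1 : ε ≤ 1) (x : ℝ) :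
    ν {g | x < wlen g ∧ ¬ |(crossCount J (toWord g) : ℝ) - freq J * wlen g| ≤ ε * wlen g} ≤
      ENNReal.ofReal (2 * Real.exp (2 - ε ^ 2 / 100 * x)) := by
  classical
  have hα : 2 ≤ Fintype.card (Fin k) := by simpa
  obtain ⟨P, hP⟩ : ∃ P : List (Fin k × Bool) → Prop, ∀ L, P L ↔ x < L.length ∧
    ¬ |(crossCount J L : ℝ) - freq J * L.length| ≤ ε * L.length := ⟨_, fun _ => Iff.rfl⟩
  have e : {g : FreeGroup (Fin k) | x < wlen g ∧
      ¬ |(crossCount J (toWord g) : ℝ) - freq J * wlen g| ≤ ε * wlen g} = {g | P (toWord g)} := by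
    ext g
    exact (hP _).symm
  rw [e]
  refine measure_le_of_card_le hν (by positivity) fun m => ?_
  by_cases hm : x < m
  · refine le_trans ?_ ((card_cross_le hα J hε0 hε1 m).trans
      (mul_le_mul_of_nonneg_right ?_ (Nat.cast_nonneg _)))
    · refine Nat.cast_le.2 (Finset.card_le_card fun L hL => ?_)
      rw [Finset.mem_filter] at hL ⊢
      exact ⟨hL.1, ((hP L).1 hL.2).2⟩
    · gcongr
  · rw [Finset.filter_false_of_mem]
    · simp; positivity
    · intro L hL h1
      have h2 := ((hP L).1 h1).1
      rw [(mem_words.1 hL).2] at h2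
      exact hm h2

end Probability

section Assembly
variable {k p : ℕ}

theorem autMalnormal_of_generic (hk : 2 ≤ k) {w : Fin p → FreeGroup (Fin k)} {x y : ℝ} {ℓ : ℕ}
    (hℓ : 1 ≤ ℓ) (hℓx : 2000 * k * ℓ ≤ x) (hshort : ∀ i, x < wlen (w i))
    (hlong : ∀ i, (wlen (w i) : ℝ) ≤ y)
    (hcross : ∀ i J, |(crossCount J (toWord (w i)) : ℝ) - freq J * wlen (w i)| ≤
      1 / (400 * k) * wlen (w i))
    (hcoin : ∀ σ : Equiv.Perm (Fin k × Bool), (∀ a, σ (bar a) = bar (σ a)) →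
      ∀ (a b : Fin p × Bool), ∀ s < ⌊y⌋₊ + 1, ∀ t < ⌊y⌋₊ + 1,
      Match σ ℓ (genWord w a) (genWord w b) s t → σ = 1 ∧ a = b ∧ s = t) :
    AutMalnormal (Subgroup.closure (Set.range w)) := by
  have hlen : ∀ a, (genWord w a).length = wlen (w a.1) := fun a => by
    rw [genWord_eq_signed, length_signed]; rfl
  have hG : Good w ℓ := by
    refine ⟨hℓ, fun a => ?_, fun a J => ?_, fun σ hσ a b s t hs ht h => ?_⟩
    · rw [hlen, Fintype.card_fin]
      have := hℓx.trans (hshort a.1).le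
      exact_mod_cast this
    · have h1 : crossCount J (genWord w a) = crossCount J (toWord (w a.1)) := by
        rw [genWord_eq_signed, signed]
        cases a.2
        · exact crossCount_invRev J _
        · rfl
      rw [hlen, h1, Fintype.card_fin]
      refine (hcross a.1 J).trans (le_of_eq ?_)
      ring
    · refine hcoin σ hσ a b s ?_ t ?_ ⟨hs, ht, h⟩
      · rw [Nat.lt_succ_iff]
        refine le_trans ?_ (Nat.le_floor (hlong a.1))
        rw [hlen] at hs
        lia
      · rw [Nat.lt_succ_iff]
        refine le_trans ?_ (Nat.le_floor (hlong b.1))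
        rw [hlen] at ht
        lia
  rintro e ⟨g, hg1, hg, hg'⟩
  exact hG.exists_conj (by simpa using hk) e hg1 hg hg'

theorem pi_not_autMalnormal_le (hk : 2 ≤ k) (μ : Fin p → Measure (FreeGroup (Fin k)))
    [∀ i, IsProbabilityMeasure (μ i)]
    (hμ : ∀ i (g g' : FreeGroup (Fin k)), wlen g = wlen g' → μ i {g} = μ i {g'})
    {x y : ℝ} {ℓ : ℕ} (hℓ : 1 ≤ ℓ) (hℓx : 2000 * k * ℓ ≤ x) :
    Measure.pi μ {w | ¬ AutMalnormal (Subgroup.closure (Set.range w))} ≤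
      ∑ i, μ i {g | ¬ (x < wlen g)} + ∑ i, μ i {g | ¬ ((wlen g : ℝ) ≤ y)} +
      ∑ _i : Fin p, ∑ _J : Finset (Fin k × Bool),
        ENNReal.ofReal (2 * Real.exp (2 - (1 / (400 * k)) ^ 2 / 100 * x)) +
      ∑ _σ : Equiv.Perm (Fin k × Bool), ∑ _a : Fin p × Bool, ∑ _b : Fin p × Bool,
        ∑ _s ∈ Finset.range (⌊y⌋₊ + 1), ∑ _t ∈ Finset.range (⌊y⌋₊ + 1),
          ENNReal.ofReal (shrink (Fin k) ^ (ℓ / 2)) := by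
  have hk' : (2 : ℝ) ≤ k := by exact_mod_cast hk
  set ε : ℝ := 1 / (400 * k) with hε
  have hε0 : 0 < ε := by positivity
  have hε1 : ε ≤ 1 := by
    rw [hε, div_le_one (by positivity)]; linarith
  have hsub : {w : Fin p → FreeGroup (Fin k) | ¬ AutMalnormal (Subgroup.closure (Set.range w))} ⊆
      (((⋃ i, {w | w i ∈ {g | ¬ (x < wlen g)}}) ∪ ⋃ i, {w | w i ∈ {g | ¬ ((wlen g : ℝ) ≤ y)}}) ∪
      ⋃ i, ⋃ J, {w | w i ∈ {g | x < wlen g ∧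
        ¬ |(crossCount J (toWord g) : ℝ) - freq J * wlen g| ≤ ε * wlen g}}) ∪
      ⋃ σ : Equiv.Perm (Fin k × Bool), ⋃ a, ⋃ b, ⋃ s ∈ Finset.range (⌊y⌋₊ + 1),
        ⋃ t ∈ Finset.range (⌊y⌋₊ + 1), {w | (∀ a, σ (bar a) = bar (σ a)) ∧
          ¬ (σ = 1 ∧ a = b ∧ s = t) ∧ Match σ ℓ (genWord w a) (genWord w b) s t} := by
    intro w hw
    by_contra hcon
    simp only [Set.mem_union, Set.mem_iUnion, Set.mem_ofPred_eq, Finset.mem_range, exists_prop,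
      not_or, not_exists, not_and, not_not] at hcon
    obtain ⟨⟨⟨h1, h2⟩, h3⟩, h4⟩ := hcon
    refine hw (autMalnormal_of_generic hk hℓ hℓx h1 h2 (fun i J => h3 i J (h1 i)) ?_)
    intro σ hσ a b s hs t ht hm
    by_contra hne
    exact h4 σ a b s hs t ht hσ (fun h5 h6 h7 => hne ⟨h5, h6, h7⟩) hm
  refine (measure_mono hsub).trans ((measure_union_le _ _).trans (add_le_add
    ((measure_union_le _ _).trans (add_le_add ((measure_union_le _ _).trans (add_le_add ?_ ?_)) ?_))
      ?_))
  · refine (measure_iUnion_fintype_le _ _).trans (Finset.sum_le_sum fun i _ => ?_)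
    rw [pi_apply_eval]
  · refine (measure_iUnion_fintype_le _ _).trans (Finset.sum_le_sum fun i _ => ?_)
    rw [pi_apply_eval]
  · refine (measure_iUnion_fintype_le _ _).trans (Finset.sum_le_sum fun i _ =>
      (measure_iUnion_fintype_le _ _).trans (Finset.sum_le_sum fun J _ => ?_))
    rw [pi_apply_eval]
    exact measure_cross_le hk (hμ i) J hε0 hε1 x
  · refine (measure_iUnion_fintype_le _ _).trans (Finset.sum_le_sum fun σ _ =>
      (measure_iUnion_fintype_le _ _).trans (Finset.sum_le_sum fun a _ =>
      (measure_iUnion_fintype_le _ _).trans (Finset.sum_le_sum fun b _ =>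
      (measure_biUnion_finset_le _ _).trans (Finset.sum_le_sum fun s _ =>
      (measure_biUnion_finset_le _ _).trans (Finset.sum_le_sum fun t _ => ?_)))))
    by_cases h : (∀ a, σ (bar a) = bar (σ a)) ∧ ¬ (σ = 1 ∧ a = b ∧ s = t)
    · refine le_trans (measure_mono fun w hw => ?_) (pi_match_le hk hμ h.1 ℓ a b s t h.2)
      exact hw.2.2
    · refine le_trans (measure_mono (t := ∅) fun w hw => ?_) (by simp)
      exact h ⟨hw.1, hw.2.1⟩

theorem shrink_pow_window_le (hk : 2 ≤ k) {z : ℝ} {ℓ : ℕ} (hz : z ≤ ℓ) :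
    shrink (Fin k) ^ (ℓ / 2) ≤ Real.exp (-Real.log (shrink (Fin k)) / 2) *
      Real.exp (Real.log (shrink (Fin k)) / 2 * z) := by
  have hk' : (2 : ℝ) ≤ k := by exact_mod_cast hk
  have h0 : 0 < shrink (Fin k) := by
    unfold shrink
    rw [Fintype.card_fin, sub_pos, div_lt_one (by positivity)]; linarith
  have hl : Real.log (shrink (Fin k)) ≤ 0 := Real.log_nonpos h0.le shrink_le_one
  rw [← Real.exp_log h0, ← Real.exp_nat_mul, Real.exp_log h0, ← Real.exp_add, Real.exp_le_exp]
  have : (ℓ : ℝ) ≤ 2 * (ℓ / 2 : ℕ) + 1 := by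
    have : ℓ ≤ 2 * (ℓ / 2) + 1 := by lia
    exact_mod_cast this
  nlinarith

theorem log_shrink_neg (hk : 2 ≤ k) : Real.log (shrink (Fin k)) < 0 := by
  have hk' : (2 : ℝ) ≤ k := by exact_mod_cast hk
  refine Real.log_neg ?_ ?_
  · unfold shrink
    rw [Fintype.card_fin, sub_pos, div_lt_one (by positivity)]; linarith
  · unfold shrink
    rw [Fintype.card_fin, sub_lt_self_iff]; positivity

end Assembly

end AutMal

/-- `μ n i` is the distribution of the `i`-th random variable `w_{i,n}`
(independence is expressed by taking the product measure `Measure.pi (μ n)` as joint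
distribution). Under radial symmetry, positive drift and subexponential growth, with
probability going to 1 exponentially fast as `n → ∞` the subgroup
`H = ⟨w_{1,n}, …, w_{p,n}⟩` is Aut-malnormal. -/
theorem random_subgroup_AutMalnormal (k p : ℕ) (hk : 2 ≤ k) (hp : 1 ≤ p)
    (μ : ℕ → Fin p → Measure (FreeGroup (Fin k)))
    (hprob : ∀ n i, IsProbabilityMeasure (μ n i))
    (hradial : ∀ n i (g g' : FreeGroup (Fin k)), wlen g = wlen g' →
      μ n i {g} = μ n i {g'})
    (L : ℝ) (hL : 0 < L)
    (hdrift : ∀ i, ExpDecay (fun n => μ n i {g | ¬ (L * n < (wlen g : ℝ))}))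
    (hsubexp : ∀ θ : ℝ, 0 < θ → ∀ i,
      ExpDecay (fun n => μ n i {g | ¬ ((wlen g : ℝ) ≤ Real.exp (θ * n))})) :
    ExpDecay (fun n =>
      Measure.pi (μ n)
        {w : Fin p → FreeGroup (Fin k) |
          ¬ AutMalnormal (Subgroup.closure (Set.range w))}) := by
  have hk' : (2 : ℝ) ≤ k := by exact_mod_cast hk
  obtain ⟨c, hc⟩ : ∃ c, c = -Real.log (AutMal.shrink (Fin k)) := ⟨_, rfl⟩
  have hc0 : 0 < c := by rw [hc, neg_pos]; exact AutMal.log_shrink_neg hk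
  set r : ℝ := L / (4000 * k) with hr
  have hr0 : 0 < r := by positivity
  set θ : ℝ := c * r / 8 with hθ
  have hθ0 : 0 < θ := by positivity
  obtain ⟨n₀, hn₀⟩ := exists_nat_ge (4000 * k / L)
  have hcoin : ExpDecay fun n => ∑ _s ∈ Finset.range (⌊Real.exp (θ * n)⌋₊ + 1),
      ∑ _t ∈ Finset.range (⌊Real.exp (θ * n)⌋₊ + 1),
        ENNReal.ofReal (AutMal.shrink (Fin k) ^ ((⌊r * n⌋₊ + 1) / 2)) := by
    refine (ExpDecay.exp (C := 4 * Real.exp (c / 2)) (c := c * r / 4) (by positivity)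
      (by positivity)).mono fun n => ?_
    simp only [Finset.sum_const, Finset.card_range, nsmul_eq_mul]
    rw [← ENNReal.ofReal_natCast, ← ENNReal.ofReal_mul (by positivity),
      ← ENNReal.ofReal_mul (by positivity)]
    refine ENNReal.ofReal_le_ofReal ?_
    have h1 : ((⌊Real.exp (θ * n)⌋₊ + 1 : ℕ) : ℝ) ≤ 2 * Real.exp (θ * n) := by
      push_cast
      have := Nat.floor_le (Real.exp_pos (θ * n)).le
      have := Real.one_le_exp (show 0 ≤ θ * n by positivity)
      linarith
    have h2 := AutMal.shrink_pow_window_le hk (z := r * n) (ℓ := ⌊r * n⌋₊ + 1)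
      (by push_cast; exact (Nat.lt_floor_add_one _).le)
    rw [← hc] at h2
    have h3 : Real.log (AutMal.shrink (Fin k)) = -c := by rw [hc, neg_neg]
    rw [h3] at h2
    calc _ ≤ (2 * Real.exp (θ * n)) * ((2 * Real.exp (θ * n)) *
          (Real.exp (c / 2) * Real.exp (-c / 2 * (r * n)))) := by
          have h4 := pow_nonneg (AutMal.shrink_nonneg (α := Fin k) (by simpa using hk))
            ((⌊r * n⌋₊ + 1) / 2)
          gcongr
      _ = 4 * Real.exp (c / 2) *
          (Real.exp (θ * n) * Real.exp (θ * n) * Real.exp (-c / 2 * (r * n))) := by ring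
      _ = _ := by
          rw [← Real.exp_add, ← Real.exp_add]
          congr 2
          rw [hθ]; ring
  have hcross : ExpDecay fun n : ℕ =>
      ENNReal.ofReal (2 * Real.exp (2 - (1 / (400 * k)) ^ 2 / 100 * (L * n))) := by
    refine (ExpDecay.exp (C := 2 * Real.exp 2) (c := (1 / (400 * k)) ^ 2 / 100 * L) (by positivity)
      (by positivity)).mono fun n => le_of_eq ?_
    rw [mul_assoc, ← Real.exp_add]
    congr 3
    ring
  refine (((((ExpDecay.sum Finset.univ fun i _ => hdrift i).add
    (ExpDecay.sum Finset.univ fun i _ => hsubexp θ hθ0 i)).add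
    (ExpDecay.sum (Finset.univ : Finset (Fin p)) fun _ _ =>
      ExpDecay.sum (Finset.univ : Finset (Finset (Fin k × Bool))) fun _ _ => hcross)).add
    (ExpDecay.sum (Finset.univ : Finset (Equiv.Perm (Fin k × Bool))) fun _ _ =>
      ExpDecay.sum (Finset.univ : Finset (Fin p × Bool)) fun _ _ =>
      ExpDecay.sum (Finset.univ : Finset (Fin p × Bool)) fun _ _ => hcoin)).add
    (ExpDecay.initial n₀)).mono fun n => ?_
  have := hprob n
  by_cases hn : n < n₀
  · rw [if_pos hn]
    exact prob_le_one.trans le_add_self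
  · rw [if_neg hn, add_zero]
    refine AutMal.pi_not_autMalnormal_le hk (μ n) (hradial n) (by lia) ?_
    have h1 : 4000 * k / L ≤ n := hn₀.trans (by exact_mod_cast not_lt.1 hn)
    rw [div_le_iff₀ hL] at h1
    have h2 : (⌊r * n⌋₊ : ℝ) ≤ r * n := Nat.floor_le (by positivity)
    have h3 : 4000 * k * r = L := by rw [hr]; field_simp
    push_cast
    nlinarith [mul_le_mul_of_nonneg_left h2 (show (0 : ℝ) ≤ 2000 * k by positivity)]

end
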